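/- arXiv:1506.09034 — 2 statements merged into one kernel-verified Lean document; each statement's English description precedes it below -/
import Mathlib

section
/- Let X be a real random variable with p(1) = P(|X̃| > 1) > 0. Let d ≥ 1, let 0 < ε ≤ 1, 0 < θ ≤ 1, A > 0, B > 0 be constants, and let τ = τ_n ≥ 0 be a parameter that may depend on n. Suppose a = (a_1,…,a_n) ∈ (R^d)^n is a multi-subset of R^d such that q_j = Q(F_a^{(j)}, τ) ≥ n^{−A} for j = 1,…,d, where F_a^{(j)} is the distribution of the j-th coordinate of S_a, and let ρ_n be a non-random sequence with n^{−B} ≤ ρ_n ≤ 1. Then for any number n' between ε·n^θ and n there exists a d-dimensional CGAP K (a direct product of d one-dimensional CGAPs) such that: (1) at least n − d·n' elements of a are within τ·ρ_n of K in the sup-norm |·| (i.e. there exist y_j ∈ K with |a_j − y_j| ≤ τ·ρ_n); (2) K has rank R = O(1) and cardinality |K| ≤ ∏_{j=1}^d max{ O( q_j^{−1} · ρ_n^{−1} · (n')^{−1/2} ), 1 }, where the implied constants depend only on ε, θ, A, B, d and p(1), but not on n. -/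
open MeasureTheory

/-- The concentration function `Q(F, τ) = sup_x F(x + τ B)`, where `B` is the centered
closed ball of radius `1/2`. -/
noncomputable def concFn {E : Type*} [MeasurableSpace E] [PseudoMetricSpace E]
    (μ : Measure E) (τ : ℝ) : ℝ :=
  ⨆ x : E, (μ (Metric.closedBall x (τ / 2))).toReal

/-- `K ∈ 𝒦_{r,m}`: `K` is a one-dimensional CGAP of rank `r` and volume at most `m`. -/
def IsCGAP (r m : ℕ) (K : Set ℝ) : Prop :=
  ∃ (h : Fin r → ℝ) (V : Set (Fin r → ℝ)),
    (∀ v ∈ V, -v ∈ V) ∧ Convex ℝ V ∧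
    {ν : Fin r → ℤ | (fun j => (ν j : ℝ)) ∈ V}.Finite ∧
    Nat.card {ν : Fin r → ℤ | (fun j => (ν j : ℝ)) ∈ V} ≤ m ∧
    K = {x : ℝ | ∃ ν : Fin r → ℤ, (fun j => (ν j : ℝ)) ∈ V ∧ x = ∑ j, (ν j : ℝ) * h j}

/-- The distribution `F_a` of `S_a = ∑ X_k a_k`, where the `X_k` are i.i.d. with law `μ`. -/
noncomputable def Fa {d : ℕ} (n : ℕ) (μ : Measure ℝ) (a : Fin n → EuclideanSpace ℝ (Fin d)) :
    Measure (EuclideanSpace ℝ (Fin d)) :=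
  Measure.map (fun x : Fin n → ℝ => ∑ k, x k • a k) (Measure.pi fun _ => μ)

/-- `F_a^{(j)}`, the distribution of the `j`-th coordinate of `S_a`. -/
noncomputable def FaCoord {d : ℕ} (n : ℕ) (μ : Measure ℝ)
    (a : Fin n → EuclideanSpace ℝ (Fin d)) (j : Fin d) : Measure ℝ :=
  Measure.map (fun x : EuclideanSpace ℝ (Fin d) => x j) (Fa n μ a)

/-- The law `G` of the symmetrization `X̃ = X₁ - X₂` of two independent copies with law `μ`. -/
noncomputable def symG (μ : Measure ℝ) : Measure ℝ :=
  Measure.map (fun p : ℝ × ℝ => p.1 - p.2) (μ.prod μ)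

/-- `p(δ) = P(|X̃| > δ)`. -/
noncomputable def pOf (μ : Measure ℝ) (δ : ℝ) : ℝ :=
  (symG μ {z : ℝ | δ < |z|}).toReal

/-- A nonzero vector of a free `ℤ`-module is a multiple of a vector on which some functional
takes the value `1`. -/
theorem exists_dual_eq_one {M : Type*} [AddCommGroup M] [Module.Free ℤ M]
    [Module.Finite ℤ M] {x : M} (hx : x ≠ 0) :
    ∃ (u : M) (g : ℤ) (f : M →ₗ[ℤ] ℤ), x = g • u ∧ g ≠ 0 ∧ f u = 1 := by
  classical
  let b := Module.Free.chooseBasis ℤ M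
  have hne : ∃ i, b.repr x i ≠ 0 := by
    by_contra! h
    exact hx (b.repr.map_eq_zero_iff.1 (Finsupp.ext h))
  obtain ⟨i₀, hi₀⟩ := hne
  obtain ⟨c, hc⟩ := Finset.gcd_eq_sum_mul (Finset.univ) (fun i => b.repr x i)
  set g := Finset.univ.gcd (fun i => b.repr x i) with hg
  have hdvd : ∀ i, g ∣ b.repr x i := fun i => Finset.gcd_dvd (Finset.mem_univ i)
  choose y hy using hdvd
  have hg0 : g ≠ 0 := fun h => hi₀ (by rw [hy i₀, h, zero_mul])
  refine ⟨∑ i, y i • b i, g, ∑ i, c i • b.coord i, ?_, hg0, ?_⟩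
  · rw [← b.sum_repr x, Finset.smul_sum]
    refine Finset.sum_congr rfl fun i _ => ?_
    rw [smul_smul, ← hy i]
  · have hyr : ∀ i, b.repr (∑ j, y j • b j) i = y i := fun i => by
      rw [b.repr_sum_self]
    have hcoord : ∀ i, b.coord i (∑ j, y j • b j) = y i := fun i => hyr i
    have h2 : g * ∑ i, c i * y i = g * 1 := by
      rw [mul_one, Finset.mul_sum]
      conv_rhs => rw [hc]
      refine Finset.sum_congr rfl fun i _ => ?_
      rw [hy i]; ring
    simp only [LinearMap.sum_apply, LinearMap.smul_apply, hcoord, smul_eq_mul]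
    exact mul_left_cancel₀ hg0 h2

/-- Coarsening of a lattice with respect to a box: there is a sublattice which is separated at
scale `2⁻ʳ⁻¹`, while every point of the lattice is `r`-close to it. -/
theorem exists_separated_sublattice {κ : Type*} [Finite κ] (r : ℕ) :
    ∀ (M : Type) [AddCommGroup M] [Module.Free ℤ M] [Module.Finite ℤ M],
      Module.finrank ℤ M ≤ r → ∀ f : κ → M →ₗ[ℤ] ℝ,
      ∃ L : Submodule ℤ M, (∀ x, ∃ y ∈ L, ∀ i, |f i (x - y)| ≤ r) ∧
        ∀ y ∈ L, y ≠ 0 → ∃ i, (1 / 2 : ℝ) ^ (r + 1) < |f i y| := by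
  cases nonempty_fintype κ
  induction r with
  | zero =>
    intro M _ _ _ hM f
    refine ⟨⊥, fun x => ⟨0, Submodule.zero_mem _, fun i => ?_⟩, fun y hy h0 => ?_⟩
    · have : Subsingleton M := Module.finrank_zero_iff.1 (Nat.le_zero.1 hM)
      simp [Subsingleton.elim x 0]
    · exact absurd ((Submodule.mem_bot ℤ).1 hy) h0
  | succ r ih =>
    intro M _ _ _ hM f
    by_cases hsep : ∀ y : M, y ≠ 0 → ∃ i, (1 / 2 : ℝ) ^ (r + 2) < |f i y|
    · refine ⟨⊤, fun x => ⟨x, Submodule.mem_top, fun i => ?_⟩, fun y _ h0 => hsep y h0⟩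
      simp only [sub_self, map_zero, abs_zero]; positivity
    push Not at hsep
    obtain ⟨x, hx0, hx⟩ := hsep
    obtain ⟨u, g, φ, hxu, hg, hφu⟩ := exists_dual_eq_one hx0
    have hsmall : (1 / 2 : ℝ) ^ (r + 2) ≤ 1 / 2 := by
      calc (1 / 2 : ℝ) ^ (r + 2) ≤ (1 / 2) ^ 1 :=
            pow_le_pow_of_le_one (by norm_num) (by norm_num) (by omega)
        _ = 1 / 2 := by norm_num
    have hu : ∀ i, |f i u| ≤ 1 / 2 := fun i => by
      refine le_trans ?_ ((hx i).trans hsmall)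
      rw [hxu, map_smul, zsmul_eq_mul, abs_mul]
      have : (1 : ℝ) ≤ |(g : ℝ)| := by exact_mod_cast Int.one_le_abs hg
      nlinarith [abs_nonneg (f i u)]
    have hfin : Module.finrank ℤ (LinearMap.ker φ) ≤ r := by
      have h1 := (LinearMap.ker φ).finrank_quotient_add_finrank
      rw [φ.quotKerEquivRange.finrank_eq] at h1
      have hr : LinearMap.range φ = ⊤ := by
        rw [LinearMap.range_eq_top]
        exact fun z => ⟨z • u, by simp [hφu]⟩
      rw [hr, finrank_top, Module.finrank_self] at h1
      omega
    rcases isEmpty_or_nonempty κ with hκ | hκ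
    · exact ⟨⊥, fun x => ⟨0, Submodule.zero_mem _, fun i => hκ.elim i⟩,
        fun y hy h0 => absurd ((Submodule.mem_bot ℤ).1 hy) h0⟩
    obtain ⟨j, hj⟩ := Finite.exists_max fun i => |f i u|
    have hratio : ∀ i, |f i u / f j u| ≤ 1 := fun i => by
      rw [abs_div]; exact div_le_one_of_le₀ (hj i) (abs_nonneg _)
    let f' : κ → M →ₗ[ℤ] ℝ := fun i =>
      f i - (AddMonoidHom.mulLeft (f i u / f j u)).toIntLinearMap.comp (f j)
    have hf' : ∀ i w, f' i w = f i w - f i u / f j u * f j w := fun i w => rfl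
    have hf'u : ∀ i, f' i u = 0 := fun i => by
      rw [hf']
      by_cases h : f j u = 0
      · have h2 := hj i
        rw [h, abs_zero] at h2
        simp [abs_nonpos_iff.1 h2]
      · field_simp; ring
    obtain ⟨L, hL1, hL2⟩ := ih (LinearMap.ker φ) hfin
      fun i => (f' i).comp (LinearMap.ker φ).subtype
    set α := |f j u| with hα
    set t : ℕ := ⌊1 / α⌋₊ with ht
    have hα0 : 0 ≤ α := abs_nonneg _
    have htα : t * α ≤ 1 := by
      rcases hα0.eq_or_lt with h | h
      · rw [← h]; simp
      · calc (t : ℝ) * α ≤ 1 / α * α := by gcongr; exact Nat.floor_le (by positivity)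
          _ = 1 := by field_simp
    refine ⟨L.map (LinearMap.ker φ).subtype ⊔ Submodule.span ℤ {(t : ℤ) • u}, fun x => ?_, ?_⟩
    · have hmem : x - φ x • u ∈ LinearMap.ker φ := by simp [hφu]
      obtain ⟨y, hyL, hy⟩ := hL1 ⟨_, hmem⟩
      set w := x - (y : M) with hw
      set e : ℤ := round (f j w / (t * f j u)) with he
      refine ⟨(y : M) + e • ((t : ℤ) • u), Submodule.add_mem_sup ⟨y, hyL, rfl⟩
        (Submodule.smul_mem _ _ (Submodule.subset_span rfl)), fun i => ?_⟩
      have h1 : |f' i (x - ((y : M) + e • ((t : ℤ) • u)))| ≤ r := by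
        have h := hy i
        simp only [LinearMap.comp_apply, Submodule.subtype_apply,
          map_sub, map_smul, hf'u, smul_zero, sub_zero] at h
        simpa only [map_sub, map_add, map_smul, hf'u, smul_zero, add_zero] using h
      have h2 : |f i u / f j u * f j (x - ((y : M) + e • ((t : ℤ) • u)))| ≤ 1 := by
        by_cases h : f j u = 0
        · simp [h]
        have hαpos : 0 < α := abs_pos.2 h
        have htpos : 0 < (t : ℝ) := by
          have : 1 ≤ t := Nat.le_floor (by
            rw [Nat.cast_one, le_div_iff₀ hαpos]; linarith [hu j])
          exact_mod_cast this
        rw [abs_mul]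
        refine mul_le_one₀ (hratio i) (abs_nonneg _) ?_
        have h3 : f j (x - ((y : M) + e • ((t : ℤ) • u)))
            = (f j w / (t * f j u) - e) * (t * f j u) := by
          simp only [map_sub, map_add, map_smul, hw, zsmul_eq_mul, Int.cast_natCast]
          field_simp; ring
        rw [h3, abs_mul, abs_mul, Nat.abs_cast]
        have h4 := abs_sub_round (f j w / (t * f j u))
        calc _ ≤ 1 / 2 * (t * |f j u|) := by gcongr
          _ ≤ 1 := by linarith
      have h3 := hf' i (x - ((y : M) + e • ((t : ℤ) • u)))
      rw [eq_sub_iff_add_eq] at h3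
      rw [← h3]
      push_cast
      exact (abs_add_le _ _).trans (add_le_add h1 h2)
    · intro y hy hy0
      obtain ⟨y₁, ⟨z, hzL, rfl⟩, y₂, hy₂, rfl⟩ := Submodule.mem_sup.1 hy
      obtain ⟨s, rfl⟩ := Submodule.mem_span_singleton.1 hy₂
      by_cases hz : z = 0
      · subst hz
        simp only [map_zero, zero_add] at hy0 ⊢
        have hs : s ≠ 0 := fun h => hy0 (by simp [h])
        have ht0 : t ≠ 0 := fun h => hy0 (by simp [h])
        refine ⟨j, hsmall.trans_lt ?_⟩
        have hαpos : 0 < α := by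
          refine hα0.lt_of_ne fun h => ht0 ?_
          rw [ht, ← h]; simp
        rw [map_smul, map_smul, zsmul_eq_mul, zsmul_eq_mul, abs_mul, abs_mul, Int.cast_natCast,
          Nat.abs_cast, ← hα]
        have h1 : (1 : ℝ) ≤ |(s : ℝ)| := by exact_mod_cast Int.one_le_abs hs
        have h2 : 1 / α < t + 1 := Nat.lt_floor_add_one _
        rw [div_lt_iff₀ hαpos] at h2
        have h3 := hu j
        nlinarith [mul_nonneg (Nat.cast_nonneg (α := ℝ) t) hα0]
      · obtain ⟨i, hi⟩ := hL2 z hzL hz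
        simp only [LinearMap.comp_apply, Submodule.subtype_apply] at hi ⊢
        set y := (z : M) + s • (t : ℤ) • u with hyd
        have h1 : f' i y = f' i z := by
          simp [hyd, hf'u]
        rw [← h1, hf'] at hi
        have h2 : |f i y - f i u / f j u * f j y| ≤ |f i y| + |f j y| := by
          refine (abs_sub _ _).trans (add_le_add le_rfl ?_)
          rw [abs_mul]
          exact mul_le_of_le_one_left (abs_nonneg _) (hratio i)
        by_contra! hcon
        have := hcon i
        have := hcon j
        have e1 : (1 / 2 : ℝ) ^ (r + 1) = 2 * (1 / 2) ^ (r + 1 + 1) := by ring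
        linarith

/-- The integer combinations of the numbers `a i` with coefficients of total size at most `k`. -/
def boundedSums {ι : Type*} [Fintype ι] (a : ι → ℝ) (k : ℤ) : Set ℝ :=
  {x | ∃ c : ι → ℤ, ∑ i, |c i| ≤ k ∧ x = ∑ i, (c i : ℝ) * a i}

section boundedSums

variable {ι : Type*} [Fintype ι] {a : ι → ℝ}

theorem boundedSums_mono {k l : ℤ} (h : k ≤ l) : boundedSums a k ⊆ boundedSums a l :=
  fun _ ⟨c, hc, hx⟩ => ⟨c, hc.trans h, hx⟩

theorem add_mem_boundedSums {k l : ℤ} {x y : ℝ} (hx : x ∈ boundedSums a k)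
    (hy : y ∈ boundedSums a l) : x + y ∈ boundedSums a (k + l) := by
  obtain ⟨c, hc, rfl⟩ := hx
  obtain ⟨e, he, rfl⟩ := hy
  refine ⟨c + e, ?_, ?_⟩
  · calc ∑ i, |(c + e) i| ≤ ∑ i, (|c i| + |e i|) := Finset.sum_le_sum fun i _ => abs_add_le _ _
      _ ≤ k + l := by rw [Finset.sum_add_distrib]; exact add_le_add hc he
  · rw [← Finset.sum_add_distrib]
    refine Finset.sum_congr rfl fun i _ => ?_
    push_cast [Pi.add_apply]; ring

theorem zero_mem_boundedSums : (0 : ℝ) ∈ boundedSums a 0 := ⟨0, by simp, by simp⟩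

theorem mul_mem_boundedSums (m : ℤ) (i : ι) : (m : ℝ) * a i ∈ boundedSums a |m| := by
  classical
  refine ⟨Pi.single i m, ?_, ?_⟩
  · rw [Finset.sum_eq_single i] <;> simp +contextual
  · rw [Finset.sum_eq_single i] <;> simp +contextual

theorem sum_mem_boundedSums {κ : Type*} [Fintype κ] (g : κ → ι) (x : κ → ℤ) :
    ∑ i, (x i : ℝ) * a (g i) ∈ boundedSums a (∑ i, |x i|) := by
  classical
  have : ∀ s : Finset κ, ∑ i ∈ s, (x i : ℝ) * a (g i) ∈ boundedSums a (∑ i ∈ s, |x i|) := by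
    intro s
    induction s using Finset.induction_on with
    | empty => simpa using zero_mem_boundedSums
    | insert i s hi ih =>
      rw [Finset.sum_insert hi, Finset.sum_insert hi]
      exact add_mem_boundedSums (mul_mem_boundedSums _ _) ih
  exact this _

/-- `D` carries no nontrivial relation, up to an error `δ`, with coefficients at most `s`. -/
def IsFreeUpTo (a : ι → ℝ) (δ : ℝ) (s : ℕ) (D : Finset ι) : Prop :=
  ∀ c : ι → ℤ, (∀ i, i ∉ D → c i = 0) → (∀ i, |c i| ≤ s) → c ≠ 0 →
    δ < |∑ i, (c i : ℝ) * a i|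

theorem IsFreeUpTo.subset {δ : ℝ} {s : ℕ} {D D' : Finset ι} (h : IsFreeUpTo a δ s D)
    (hD : D' ⊆ D) : IsFreeUpTo a δ s D' :=
  fun c hc => h c fun i hi => hc i fun h' => hi (hD h')

theorem IsFreeUpTo.pow_card_le {δ : ℝ} (hδ : 0 ≤ δ) {s : ℕ} {D : Finset ι}
    (h : IsFreeUpTo a δ s D) {k : ℤ} (hk : (D.card * s : ℕ) ≤ k) {N : ℝ}
    (H : ∀ F : Finset ℝ, (∀ x ∈ F, x ∈ boundedSums a k) →
      (∀ x ∈ F, ∀ y ∈ F, x ≠ y → δ < |x - y|) → (F.card : ℝ) ≤ N) :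
    ((s : ℝ) + 1) ^ D.card ≤ N := by
  classical
  let P : Finset (ι → ℤ) :=
    Fintype.piFinset fun i => if i ∈ D then Finset.Icc (0 : ℤ) s else {0}
  have hP : P.card = (s + 1) ^ D.card := by
    rw [Fintype.card_piFinset]
    have : ∀ i, (if i ∈ D then Finset.Icc (0 : ℤ) s else {0}).card
        = if i ∈ D then s + 1 else 1 := fun i => by
      split_ifs <;> simp
    simp only [this]
    rw [Finset.prod_ite_mem, Finset.univ_inter, Finset.prod_const]
  have hmem : ∀ c ∈ P, (∀ i, i ∉ D → c i = 0) ∧ (∀ i, 0 ≤ c i ∧ c i ≤ s) := by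
    intro c hc
    rw [Fintype.mem_piFinset] at hc
    refine ⟨fun i hi => by simpa [hi] using hc i, fun i => ?_⟩
    have := hc i
    split_ifs at this
    · exact Finset.mem_Icc.1 this
    · rw [Finset.mem_singleton.1 this]; simp
  have hsep : ∀ c ∈ P, ∀ e ∈ P, c ≠ e →
      δ < |∑ i, (c i : ℝ) * a i - ∑ i, (e i : ℝ) * a i| := by
    intro c hc e he hce
    obtain ⟨hc1, hc2⟩ := hmem c hc
    obtain ⟨he1, he2⟩ := hmem e he
    have := h (c - e) (fun i hi => by simp [hc1 i hi, he1 i hi])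
      (fun i => by
        have := hc2 i
        have := he2 i
        rw [Pi.sub_apply, abs_le]; omega)
      (sub_ne_zero.2 hce)
    simpa [sub_mul, Finset.sum_sub_distrib] using this
  have hinj : Set.InjOn (fun c : ι → ℤ => ∑ i, (c i : ℝ) * a i) P := by
    intro c hc e he hce
    by_contra hne
    have := hsep c hc e he hne
    simp only at hce
    rw [hce, sub_self, abs_zero] at this
    exact absurd this (not_lt.2 hδ)
  have := H (P.image fun c => ∑ i, (c i : ℝ) * a i) ?_ ?_
  · rw [Finset.card_image_of_injOn hinj, hP] at this
    exact_mod_cast this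
  · intro x hx
    obtain ⟨c, hc, rfl⟩ := Finset.mem_image.1 hx
    obtain ⟨hc1, hc2⟩ := hmem c hc
    refine ⟨c, le_trans ?_ hk, rfl⟩
    calc ∑ i, |c i| ≤ ∑ i, if i ∈ D then (s : ℤ) else 0 := by
          refine Finset.sum_le_sum fun i _ => ?_
          split_ifs with hi
          · rw [abs_of_nonneg (hc2 i).1]; exact (hc2 i).2
          · simp [hc1 i hi]
      _ = _ := by
          rw [Finset.sum_ite_mem, Finset.univ_inter, Finset.sum_const]; simp
  · intro x hx y hy hxy
    obtain ⟨c, hc, rfl⟩ := Finset.mem_image.1 hx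
    obtain ⟨e, he, rfl⟩ := Finset.mem_image.1 hy
    exact hsep c hc e he fun h => hxy (by rw [h])

theorem exists_maximal_isFreeUpTo (a : ι → ℝ) {δ : ℝ} (hδ : 0 ≤ δ) {s : ℕ} (hs : 1 ≤ s) :
    ∃ D : Finset ι, IsFreeUpTo a δ s D ∧ ∀ i, ∃ (l : ℤ) (ν : D → ℤ), 1 ≤ l ∧ l ≤ s ∧
      (∀ j, |ν j| ≤ s) ∧ |l * a i - ∑ j, (ν j : ℝ) * a j| ≤ δ := by
  classical
  have h0 : IsFreeUpTo a δ s ∅ := fun c hc _ h => absurd (funext fun i => hc i (by simp)) h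
  obtain ⟨D, hD, hmax⟩ := Finset.exists_max_image
    (Finset.univ.filter fun D : Finset ι => IsFreeUpTo a δ s D) Finset.card ⟨∅, by simpa using h0⟩
  simp only [Finset.mem_filter, Finset.mem_univ, true_and] at hD hmax
  refine ⟨D, hD, fun i => ?_⟩
  by_cases hi : i ∈ D
  · refine ⟨1, Pi.single ⟨i, hi⟩ 1, le_rfl, by exact_mod_cast hs, fun j => ?_, ?_⟩
    · by_cases h : j = ⟨i, hi⟩
      · subst h; simpa using hs
      · simp [h]
    · rw [Finset.sum_eq_single ⟨i, hi⟩] <;> simp +contextual [hδ]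
  have hnot : ¬ IsFreeUpTo a δ s (insert i D) := fun h => by
    have := hmax _ h
    rw [Finset.card_insert_of_notMem hi] at this
    omega
  unfold IsFreeUpTo at hnot
  push Not at hnot
  obtain ⟨c, hc1, hc2, hc3, hc4⟩ := hnot
  have hci : c i ≠ 0 := fun h => by
    refine absurd (hD c (fun j hj => ?_) hc2 hc3) (not_lt.2 hc4)
    by_cases hji : j = i
    · rw [hji, h]
    · exact hc1 j (by simp [hj, hji])
  have hsum : ∑ j, (c j : ℝ) * a j = c i * a i + ∑ j : D, (c j : ℝ) * a j := by
    rw [Finset.sum_coe_sort D fun j => (c j : ℝ) * a j,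
      ← Finset.sum_insert (f := fun j => (c j : ℝ) * a j) hi]
    refine (Finset.sum_subset (Finset.subset_univ _) fun j _ hj => ?_).symm
    rw [hc1 j hj]; simp
  rw [hsum] at hc4
  rcases hci.lt_or_gt with h | h
  · refine ⟨-c i, fun j => c j, by omega, (neg_le_abs _).trans (hc2 i), fun j => hc2 j, ?_⟩
    have h1 : ((-c i : ℤ) : ℝ) * a i - ∑ j : D, ((c j : ℤ) : ℝ) * a j
        = -(c i * a i + ∑ j : D, (c j : ℝ) * a j) := by push_cast; ring
    rwa [h1, abs_neg]
  · refine ⟨c i, fun j => -c j, by omega, (le_abs_self _).trans (hc2 i),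
      fun j => by simpa using hc2 j, ?_⟩
    have h1 : ∑ j : D, ((-c j : ℤ) : ℝ) * a j = -∑ j : D, (c j : ℝ) * a j := by
      simp [Finset.sum_neg_distrib]
    rwa [h1, sub_neg_eq_add]

end boundedSums

section relationLattice

variable {D E : Type*} [Fintype D] [Fintype E]

/-- The map from `ℤ^D × ℤ^E` to `ℤ^E`, scaled by `q`, which sends the `i`-th vector of `D` to
`ν i / l i`. -/
def relationMap (q : ℤ) (l : D → ℤ) (ν : D → E → ℤ) : ((D → ℤ) × (E → ℤ)) →ₗ[ℤ] (E → ℤ) where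
  toFun p j := q * p.2 j + ∑ i, p.1 i * (ν i j * (q / l i))
  map_add' p p' := by
    funext j
    simp only [Prod.snd_add, Prod.fst_add, Pi.add_apply, add_mul, Finset.sum_add_distrib]
    ring
  map_smul' m p := by
    funext j
    simp only [Prod.smul_snd, Prod.smul_fst, Pi.smul_apply, smul_eq_mul, RingHom.id_apply,
      mul_add, Finset.mul_sum, mul_assoc]
    ring_nf

/-- The evaluation of a vector of `q⁻¹ ℤ^E` at the reals `e`. -/
noncomputable def evalMap (q : ℤ) (e : E → ℝ) : (E → ℤ) →ₗ[ℤ] ℝ where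
  toFun z := (∑ j, (z j : ℝ) * e j) / q
  map_add' z z' := by
    simp only [Pi.add_apply, Int.cast_add, add_mul, Finset.sum_add_distrib, add_div]
  map_smul' m z := by
    simp only [Pi.smul_apply, smul_eq_mul, Int.cast_mul, RingHom.id_apply, zsmul_eq_mul,
      mul_assoc, ← Finset.mul_sum, mul_div_assoc]

variable {q : ℤ} {l : D → ℤ} {ν : D → E → ℤ} {v : D → ℝ} {e : E → ℝ} {δ : ℝ} {s : ℕ}

theorem abs_evalMap_relationMap_sub_le (hq : q ≠ 0) (hl : ∀ i, 1 ≤ l i) (hlq : ∀ i, l i ∣ q)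
    (hδ : ∀ i, |l i * v i - ∑ j, (ν i j : ℝ) * e j| ≤ δ) (x : D → ℤ) (y : E → ℤ) :
    |evalMap q e (relationMap q l ν (x, y)) - (∑ i, (x i : ℝ) * v i + ∑ j, (y j : ℝ) * e j)|
      ≤ (∑ i, |x i| : ℤ) * δ := by
  have hqR : (q : ℝ) ≠ 0 := Int.cast_ne_zero.2 hq
  have hlR : ∀ i, (1 : ℝ) ≤ l i := fun i => by exact_mod_cast hl i
  have key : evalMap q e (relationMap q l ν (x, y))
      = ∑ j, (y j : ℝ) * e j + ∑ i, (x i : ℝ) * ((∑ j, (ν i j : ℝ) * e j) / l i) := by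
    have h1 : ∀ i, ((q / l i : ℤ) : ℝ) = q / l i := fun i =>
      Int.cast_div (hlq i) (by have := hlR i; positivity)
    simp only [evalMap, relationMap, LinearMap.coe_mk, AddHom.coe_mk, Int.cast_add, Int.cast_mul,
      Int.cast_sum, add_mul, Finset.sum_add_distrib, add_div, h1]
    congr 1
    · rw [Finset.sum_div]
      exact Finset.sum_congr rfl fun j _ => by field_simp
    · simp only [Finset.sum_mul, Finset.sum_div, Finset.mul_sum]
      rw [Finset.sum_comm]
      refine Finset.sum_congr rfl fun i _ => Finset.sum_congr rfl fun j _ => ?_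
      have := hlR i
      have : (l i : ℝ) ≠ 0 := by positivity
      field_simp
  have h2 : evalMap q e (relationMap q l ν (x, y))
      - (∑ i, (x i : ℝ) * v i + ∑ j, (y j : ℝ) * e j)
      = ∑ i, (x i : ℝ) * ((∑ j, (ν i j : ℝ) * e j) / l i - v i) := by
    rw [key]
    simp only [mul_sub, Finset.sum_sub_distrib]; ring
  rw [h2]
  push_cast
  rw [Finset.sum_mul]
  refine (Finset.abs_sum_le_sum_abs _ _).trans (Finset.sum_le_sum fun i _ => ?_)
  rw [abs_mul]
  refine mul_le_mul_of_nonneg_left ?_ (abs_nonneg _)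
  have hl0 : (0 : ℝ) < l i := by linarith [hlR i]
  have h3 : (∑ j, (ν i j : ℝ) * e j) / l i - v i
      = -((l i * v i - ∑ j, (ν i j : ℝ) * e j) / l i) := by field_simp; ring
  rw [h3, abs_neg, abs_div, abs_of_pos hl0]
  exact (div_le_self (abs_nonneg _) (hlR i)).trans (hδ i)

theorem abs_relationMap_le (hq : 0 ≤ q) (hl : ∀ i, 1 ≤ l i)
    (hν : ∀ i j, |ν i j| ≤ s) (x : D → ℤ) (j : E) :
    |relationMap q l ν (x, 0) j| ≤ q * (s * ∑ i, |x i|) := by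
  simp only [relationMap, LinearMap.coe_mk, AddHom.coe_mk, Pi.zero_apply, mul_zero, zero_add]
  rw [Finset.mul_sum, Finset.mul_sum]
  refine (Finset.abs_sum_le_sum_abs _ _).trans (Finset.sum_le_sum fun i _ => ?_)
  have h1 : |q / l i| ≤ q := by
    rw [abs_of_nonneg (Int.ediv_nonneg hq (by linarith [hl i]))]
    exact Int.ediv_le_self _ hq
  rw [abs_mul, abs_mul]
  calc |x i| * (|ν i j| * |q / l i|) ≤ |x i| * (s * q) := by
        gcongr
        exact hν i j
    _ = _ := by ring

/-- A vector of the relation lattice with bounded coordinates has a short representation. -/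
theorem exists_short_relationMap_eq (hq : 0 < q) (hl : ∀ i, 1 ≤ l i) (hls : ∀ i, l i ≤ s)
    (hlq : ∀ i, l i ∣ q) (hν : ∀ i j, |ν i j| ≤ s) {z : E → ℤ}
    (hz : z ∈ LinearMap.range (relationMap q l ν)) {T : ℤ} (hT : ∀ j, |z j| ≤ q * T) :
    ∃ x y, relationMap q l ν (x, y) = z ∧ ∑ i, |x i| ≤ Fintype.card D * s ∧
      ∑ j, |y j| ≤ Fintype.card E * (T + Fintype.card D * s) := by
  obtain ⟨⟨x, y⟩, rfl⟩ := hz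
  have hmod : ∀ i, |x i % l i| ≤ l i := fun i => by
    rw [abs_of_nonneg (Int.emod_nonneg _ (by linarith [hl i]))]
    exact (Int.emod_lt_of_pos _ (by linarith [hl i])).le
  have hrep : relationMap q l ν (fun i => x i % l i, fun j => y j + ∑ i, x i / l i * ν i j)
      = relationMap q l ν (x, y) := by
    funext j
    simp only [relationMap, LinearMap.coe_mk, AddHom.coe_mk, mul_add, Finset.mul_sum]
    rw [add_assoc, ← Finset.sum_add_distrib]
    congr 1
    refine Finset.sum_congr rfl fun i _ => ?_
    have h1 := Int.mul_ediv_cancel' (hlq i)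
    have h2 := Int.emod_add_mul_ediv (x i) (l i)
    calc _ = (x i / l i * ν i j) * q + x i % l i * (ν i j * (q / l i)) := by ring
      _ = (x i / l i * ν i j) * (l i * (q / l i)) + x i % l i * (ν i j * (q / l i)) := by rw [h1]
      _ = (x i % l i + l i * (x i / l i)) * (ν i j * (q / l i)) := by ring
      _ = _ := by rw [h2]
  refine ⟨_, _, hrep, ?_, ?_⟩
  · calc ∑ i, |x i % l i| ≤ ∑ i : D, (s : ℤ) :=
        Finset.sum_le_sum fun i _ => (hmod i).trans (hls i)
      _ = _ := by simp
  · rw [← hrep] at hT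
    have hbound : ∀ j, |y j + ∑ i, x i / l i * ν i j| ≤ T + Fintype.card D * s := fun j => by
      refine le_of_mul_le_mul_left ?_ hq
      set w := y j + ∑ i, x i / l i * ν i j
      have h1 := hT j
      simp only [relationMap, LinearMap.coe_mk, AddHom.coe_mk] at h1
      have h2 : |∑ i, x i % l i * (ν i j * (q / l i))| ≤ ∑ i : D, (s : ℤ) * q := by
        refine (Finset.abs_sum_le_sum_abs _ _).trans (Finset.sum_le_sum fun i _ => ?_)
        have h3 : (0 : ℤ) ≤ q / l i := Int.ediv_nonneg hq.le (by linarith [hl i])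
        rw [abs_mul, abs_mul, abs_of_nonneg h3]
        calc |x i % l i| * (|ν i j| * (q / l i)) ≤ l i * (s * (q / l i)) := by
              gcongr
              · linarith [hl i]
              · exact hmod i
              · exact hν i j
          _ = s * (l i * (q / l i)) := by ring
          _ = s * q := by rw [Int.mul_ediv_cancel' (hlq i)]
      simp only [Finset.sum_const, Finset.card_univ, nsmul_eq_mul] at h2
      have h4 : q * |w| = |q * w| := by rw [abs_mul, abs_of_pos hq]
      have h5 := abs_sub (q * w + ∑ i, x i % l i * (ν i j * (q / l i)))
        (∑ i, x i % l i * (ν i j * (q / l i)))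
      rw [add_sub_cancel_right] at h5
      rw [h4]
      calc _ ≤ _ := h5
        _ ≤ q * T + Fintype.card D * (s * q) := add_le_add h1 h2
        _ = _ := by ring
    calc _ ≤ ∑ j : E, (T + Fintype.card D * s : ℤ) := Finset.sum_le_sum fun j _ => hbound j
      _ = _ := by simp

end relationLattice

section separated

variable {E : Type*} [Fintype E]

theorem finite_integral_box (T : ℝ) : {z : E → ℤ | ∀ j, |(z j : ℝ)| ≤ T}.Finite := by
  classical
  refine (Set.finite_Icc (fun _ : E => -⌈T⌉) (fun _ => ⌈T⌉)).subset fun z hz => ?_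
  have h1 := fun j => abs_le.1 ((hz j).trans (Int.le_ceil T))
  exact ⟨fun j => by exact_mod_cast (h1 j).1, fun j => by exact_mod_cast (h1 j).2⟩

/-- The integral points of a box in a lattice, cut by a slab, are the parameters of a CGAP. -/
theorem isCGAP_image (Λ : Submodule ℤ (E → ℤ)) (ψ : (E → ℤ) →ₗ[ℤ] ℝ) (T M : ℝ) :
    IsCGAP (Module.finrank ℤ Λ)
      (Nat.card {z : E → ℤ | z ∈ Λ ∧ (∀ j, |(z j : ℝ)| ≤ T) ∧ |ψ z| ≤ M})
      (ψ '' {z : E → ℤ | z ∈ Λ ∧ (∀ j, |(z j : ℝ)| ≤ T) ∧ |ψ z| ≤ M}) := by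
  let b := Module.finBasis ℤ Λ
  let Φ : (Fin (Module.finrank ℤ Λ) → ℤ) → (E → ℤ) := fun ν => (b.equivFun.symm ν : Λ)
  have hΦinj : Function.Injective Φ := fun ν ν' h =>
    b.equivFun.symm.injective (Subtype.ext h)
  have hΦ : ∀ ν, Φ ν = ∑ j, ν j • (b j : E → ℤ) := fun ν => by
    simp [Φ, Module.Basis.equivFun_symm_apply]
  have hcoord : ∀ ν e, ((Φ ν e : ℤ) : ℝ) = ∑ j, (ν j : ℝ) * ((b j : E → ℤ) e : ℝ) := fun ν e => by
    rw [hΦ]; simp [Finset.sum_apply]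
  have hval : ∀ ν, ψ (Φ ν) = ∑ j, (ν j : ℝ) * ψ (b j) := fun ν => by
    rw [hΦ, map_sum]
    exact Finset.sum_congr rfl fun j _ => by rw [map_zsmul, zsmul_eq_mul]
  let V : Set (Fin (Module.finrank ℤ Λ) → ℝ) :=
    {v | (∀ e, |∑ j, v j * ((b j : E → ℤ) e : ℝ)| ≤ T) ∧ |∑ j, v j * ψ (b j)| ≤ M}
  have hV : ∀ ν : Fin (Module.finrank ℤ Λ) → ℤ, (fun j => (ν j : ℝ)) ∈ V ↔
      Φ ν ∈ {z : E → ℤ | z ∈ Λ ∧ (∀ j, |(z j : ℝ)| ≤ T) ∧ |ψ z| ≤ M} := fun ν => by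
    simp only [V, Set.mem_ofPred_eq, hcoord, hval]
    exact ⟨fun h => ⟨(b.equivFun.symm ν).2, h⟩, fun h => h.2⟩
  have hset : Φ '' {ν | (fun j => (ν j : ℝ)) ∈ V}
      = {z : E → ℤ | z ∈ Λ ∧ (∀ j, |(z j : ℝ)| ≤ T) ∧ |ψ z| ≤ M} := by
    ext z
    constructor
    · rintro ⟨ν, hν, rfl⟩
      exact (hV ν).1 hν
    · intro hz
      have h : Φ (b.equivFun ⟨z, hz.1⟩) = z :=
        congrArg Subtype.val (b.equivFun.symm_apply_apply _)
      exact ⟨b.equivFun ⟨z, hz.1⟩, (hV _).2 (by rw [h]; exact hz), h⟩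
  have hfin : {z : E → ℤ | z ∈ Λ ∧ (∀ j, |(z j : ℝ)| ≤ T) ∧ |ψ z| ≤ M}.Finite :=
    (finite_integral_box T).subset fun z hz => hz.2.1
  refine ⟨fun j => ψ (b j), V, fun v hv => ?_, fun v hv w hw s t hs ht hst => ?_, ?_, ?_, ?_⟩
  · refine ⟨fun e => ?_, ?_⟩
    · simpa [Finset.sum_neg_distrib] using hv.1 e
    · simpa [Finset.sum_neg_distrib] using hv.2
  · have key : ∀ (g : Fin (Module.finrank ℤ Λ) → ℝ) (K : ℝ), |∑ j, v j * g j| ≤ K →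
        |∑ j, w j * g j| ≤ K → |∑ j, (s • v + t • w) j * g j| ≤ K := by
      intro g K h1 h2
      have h3 : ∑ j, (s • v + t • w) j * g j = s * ∑ j, v j * g j + t * ∑ j, w j * g j := by
        simp [Finset.mul_sum, add_mul, Finset.sum_add_distrib, mul_assoc]
      rw [h3]
      calc _ ≤ |s * ∑ j, v j * g j| + |t * ∑ j, w j * g j| := abs_add_le _ _
        _ = s * |∑ j, v j * g j| + t * |∑ j, w j * g j| := by
            rw [abs_mul, abs_mul, abs_of_nonneg hs, abs_of_nonneg ht]
        _ ≤ s * K + t * K := by gcongr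
        _ = K := by rw [← add_mul, hst, one_mul]
    exact ⟨fun e => key _ T (hv.1 e) (hw.1 e), key _ M hv.2 hw.2⟩
  · exact Set.Finite.of_finite_image (hset ▸ hfin) hΦinj.injOn
  · rw [← hset]
    exact (Nat.card_image_of_injective hΦinj _).ge
  · rw [← hset, Set.image_image]
    ext x
    simp only [Set.mem_image, Set.mem_ofPred_eq, hval, eq_comm]

/-- A finite set of integral points in a box contains a proportional subset of small diameter. -/
theorem exists_subset_small_diam (P : Finset (E → ℤ)) {w : ℝ} (hw : 0 < w) (L : ℕ)
    (hP : ∀ z ∈ P, ∀ j, |(z j : ℝ)| ≤ L * w) :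
    ∃ Q ⊆ P, P.card ≤ (2 * L + 1) ^ Fintype.card E * Q.card ∧
      ∀ z ∈ Q, ∀ z' ∈ Q, ∀ j, |(z j : ℝ) - z' j| ≤ w := by
  classical
  let t : Finset (E → ℤ) := Fintype.piFinset fun _ => Finset.Icc (-(L : ℤ)) L
  let f : (E → ℤ) → (E → ℤ) := fun z j => ⌊(z j : ℝ) / w⌋
  have hft : ∀ z ∈ P, f z ∈ t := fun z hz => by
    refine Fintype.mem_piFinset.2 fun j => Finset.mem_Icc.2 ?_
    have h1 := abs_le.1 (hP z hz j)
    refine ⟨Int.le_floor.2 ?_, ?_⟩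
    · push_cast
      rw [le_div_iff₀ hw]; linarith
    · have h2 : (⌊(z j : ℝ) / w⌋ : ℝ) ≤ (L : ℤ) :=
        (Int.floor_le _).trans (by push_cast; rw [div_le_iff₀ hw]; exact h1.2)
      exact_mod_cast h2
  have htc : t.card = (2 * L + 1) ^ Fintype.card E := by
    rw [Fintype.card_piFinset, Finset.prod_const, Int.card_Icc, Finset.card_univ]
    congr 1; omega
  obtain ⟨c, hc, hmax⟩ := Finset.exists_max_image t (fun c => (P.filter fun z => f z = c).card)
    (Finset.card_pos.1 (by rw [htc]; positivity))
  refine ⟨P.filter fun z => f z = c, Finset.filter_subset _ _, ?_, ?_⟩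
  · rw [← htc, mul_comm]
    exact Finset.card_le_mul_card_image_of_maps_to hft _ hmax
  · intro z hz z' hz' j
    have h1 := congrFun ((Finset.mem_filter.1 hz).2.trans (Finset.mem_filter.1 hz').2.symm) j
    have h2 := Int.abs_sub_lt_one_of_floor_eq_floor h1
    rw [← sub_div, abs_div, abs_of_pos hw, div_lt_one hw] at h2
    exact h2.le

/-- Translates of a separated set by multiples of a large vector are separated. -/
theorem card_mul_le_of_translates {α : Type*} (Q : Finset α) (v : α → ℝ) (u : α → ℕ → ℝ)
    {b M e η N : ℝ} {J : ℕ} {S : Set ℝ} (hη : 0 ≤ η) (hb : |b| = M) (hM : η + 2 * e < M)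
    (hv : ∀ z ∈ Q, |v z| ≤ 2 * M)
    (hsep : ∀ z ∈ Q, ∀ z' ∈ Q, z ≠ z' → η + 2 * e < |v z - v z'|)
    (hu : ∀ z ∈ Q, ∀ j < J, u z j ∈ S ∧ |u z j - (v z + 5 * j * b)| ≤ e)
    (H : ∀ F : Finset ℝ, (∀ x ∈ F, x ∈ S) → (∀ x ∈ F, ∀ y ∈ F, x ≠ y → η < |x - y|) →
      (F.card : ℝ) ≤ N) : (Q.card : ℝ) * J ≤ N := by
  classical
  have key : ∀ p ∈ Q ×ˢ Finset.range J, ∀ p' ∈ Q ×ˢ Finset.range J, p ≠ p' →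
      η < |u p.1 p.2 - u p'.1 p'.2| := by
    rintro ⟨z, j⟩ hp ⟨z', j'⟩ hp' hne
    simp only [Finset.mem_product, Finset.mem_range] at hp hp' ⊢
    have h1 := abs_le.1 (hu z hp.1 j hp.2).2
    have h2 := abs_le.1 (hu z' hp'.1 j' hp'.2).2
    have h3 : η + 2 * e < |(v z + 5 * j * b) - (v z' + 5 * j' * b)| := by
      by_cases hj : j = j'
      · subst hj
        have := hsep z hp.1 z' hp'.1 fun h => hne (by rw [h])
        rwa [add_sub_add_right_eq_sub]
      · have h4 : (1 : ℝ) ≤ |(j : ℝ) - j'| := by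
          have : (1 : ℤ) ≤ |(j : ℤ) - j'| := Int.one_le_abs (by omega)
          exact_mod_cast this
        have h5 : |5 * ((j : ℝ) - j') * b| = 5 * |(j : ℝ) - j'| * M := by
          rw [abs_mul, abs_mul, hb]; norm_num
        have hM0 : 0 ≤ M := hb ▸ abs_nonneg b
        have h6 : 5 * M ≤ |5 * ((j : ℝ) - j') * b| := by rw [h5]; nlinarith
        have h7 := abs_sub_abs_le_abs_sub (5 * ((j : ℝ) - j') * b) (v z' - v z)
        have h8 := abs_sub (v z') (v z)
        have h9 := hv z hp.1
        have h10 := hv z' hp'.1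
        have h11 : (v z + 5 * j * b) - (v z' + 5 * j' * b)
            = 5 * ((j : ℝ) - j') * b - (v z' - v z) := by ring
        rw [h11]; linarith
    rw [lt_abs] at h3 ⊢
    rcases h3 with h3 | h3
    · left; linarith
    · right; linarith
  have hinj : Set.InjOn (fun p : α × ℕ => u p.1 p.2) (Q ×ˢ Finset.range J : Finset (α × ℕ)) := by
    intro p hp p' hp' h
    by_contra hne
    have := key p hp p' hp' hne
    simp only at h
    rw [h, sub_self, abs_zero] at this
    linarith
  have := H ((Q ×ˢ Finset.range J).image fun p : α × ℕ => u p.1 p.2) ?_ ?_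
  · rw [Finset.card_image_of_injOn hinj, Finset.card_product, Finset.card_range] at this
    exact_mod_cast this
  · intro x hx
    obtain ⟨p, hp, rfl⟩ := Finset.mem_image.1 hx
    rw [Finset.mem_product, Finset.mem_range] at hp
    exact (hu p.1 hp.1 p.2 hp.2).1
  · intro x hx y hy hxy
    obtain ⟨p, hp, rfl⟩ := Finset.mem_image.1 hx
    obtain ⟨p', hp', rfl⟩ := Finset.mem_image.1 hy
    exact key p hp p' hp' fun h => hxy (by rw [h])

end separated

/-- A form of `exists_separated_sublattice` for lattices of integral points and a box cut by a
slab. -/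
theorem exists_sparse_sublattice {E : Type} [Fintype E] (Λ : Submodule ℤ (E → ℤ))
    (ψ : (E → ℤ) →ₗ[ℤ] ℝ) {w η : ℝ} (hw : 0 < w) (hη : 0 < η) {r : ℕ} (hr : Fintype.card E ≤ r) :
    ∃ Λ' ≤ Λ, (∀ x ∈ Λ, ∃ y ∈ Λ', (∀ j, |(x j : ℝ) - y j| ≤ r * w) ∧ |ψ x - ψ y| ≤ r * η) ∧
      ∀ y ∈ Λ', y ≠ 0 →
        (∃ j, (1 / 2 : ℝ) ^ (r + 1) * w < |(y j : ℝ)|) ∨ (1 / 2 : ℝ) ^ (r + 1) * η < |ψ y| := by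
  let f : E ⊕ Unit → Λ →ₗ[ℤ] ℝ := Sum.elim
    (fun j => LinearMap.mulLeft ℤ w⁻¹ ∘ₗ Algebra.linearMap ℤ ℝ ∘ₗ LinearMap.proj j ∘ₗ Λ.subtype)
    (fun _ => LinearMap.mulLeft ℤ η⁻¹ ∘ₗ ψ ∘ₗ Λ.subtype)
  have hf1 : ∀ j (x : Λ), |f (Sum.inl j) x| = |((x : E → ℤ) j : ℝ)| / w := fun j x => by
    simp [f, abs_mul, abs_of_pos hw, div_eq_inv_mul]
  have hf2 : ∀ x : Λ, |f (Sum.inr ()) x| = |ψ x| / η := fun x => by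
    simp [f, abs_mul, abs_of_pos hη, div_eq_inv_mul]
  have hrank : Module.finrank ℤ Λ ≤ r :=
    (Submodule.finrank_le Λ).trans (by rwa [Module.finrank_fintype_fun_eq_card])
  obtain ⟨L, hL1, hL2⟩ := exists_separated_sublattice r Λ hrank f
  refine ⟨L.map Λ.subtype, Submodule.map_subtype_le Λ L, fun x hx => ?_, ?_⟩
  · obtain ⟨y, hy, h⟩ := hL1 ⟨x, hx⟩
    refine ⟨y, Submodule.mem_map_of_mem hy, fun j => ?_, ?_⟩
    · have := h (Sum.inl j)
      rw [hf1, div_le_iff₀ hw] at this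
      simpa using this
    · have := h (Sum.inr ())
      rw [hf2, div_le_iff₀ hη] at this
      simpa using this
  · rintro _ ⟨y, hy, rfl⟩ h0
    obtain ⟨i, hi⟩ := hL2 y hy fun h => h0 (by rw [h, map_zero])
    rcases i with j | _
    · rw [hf1, lt_div_iff₀ hw] at hi
      exact Or.inl ⟨j, hi⟩
    · rw [hf2, lt_div_iff₀ hη] at hi
      exact Or.inr hi

theorem exists_gt_forall_abs_le {Y : Set ℝ} (hY : Y.Finite) (δ : ℝ) :
    ∃ η > δ, ∀ y ∈ Y, |y| ≤ η → |y| ≤ δ := by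
  have h : ∀ᶠ η in nhdsWithin δ (Set.Ioi δ), ∀ y ∈ Y, |y| ≤ η → |y| ≤ δ := by
    refine (hY.eventually_all).2 fun y _ => ?_
    by_cases hy : |y| ≤ δ
    · exact Filter.Eventually.of_forall fun _ _ => hy
    · filter_upwards [nhdsWithin_le_nhds (eventually_lt_nhds (not_le.1 hy))] with η hη h
      exact absurd h (not_le.2 hη)
  obtain ⟨η, hη, h1⟩ := (h.and self_mem_nhdsWithin).exists
  exact ⟨η, h1, hη⟩

/-- If the sums of `k` terms have few separated values, then up to small errors all the terms are
values of a functional on short vectors of a lattice of small rank, and conversely these values are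
sums of few terms. -/
theorem exists_lattice_of_card_le {ι : Type} [Fintype ι] (a : ι → ℝ) {δ : ℝ} (hδ : 0 ≤ δ)
    {k S g : ℕ} {N : ℝ} (hS : 1 ≤ S) (hSk : S + 1 ≤ k) (hgk : g * S ≤ k)
    (hN1 : N < 2 ^ (S + 1)) (hN2 : N < ((S : ℝ) + 1) ^ g)
    (H : ∀ F : Finset ℝ, (∀ x ∈ F, x ∈ boundedSums a k) →
      (∀ x ∈ F, ∀ y ∈ F, x ≠ y → δ < |x - y|) → (F.card : ℝ) ≤ N) :
    ∃ (E : Type) (_ : Fintype E) (q : ℤ) (Λ : Submodule ℤ (E → ℤ)) (ψ : (E → ℤ) →ₗ[ℤ] ℝ),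
      Fintype.card E ≤ g ∧ 0 < q ∧
      (∀ i, ∃ z ∈ Λ, (∀ j, |z j| ≤ q * S ^ 2) ∧ |ψ z - a i| ≤ (S + 1) * δ) ∧
      ∀ z ∈ Λ, ∀ T : ℕ, (∀ j, |z j| ≤ q * T) →
        ∃ u ∈ boundedSums a (S ^ 2 + g * (T + S ^ 2)), |u - ψ z| ≤ S ^ 2 * δ := by
  obtain ⟨D, hD, hDm⟩ := exists_maximal_isFreeUpTo a hδ le_rfl
  obtain ⟨E, hE, hEm⟩ := exists_maximal_isFreeUpTo a hδ hS
  have hDc : D.card ≤ S := by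
    by_contra! h
    obtain ⟨D', hD', hc⟩ := Finset.exists_subset_card_eq (show S + 1 ≤ D.card by omega)
    have := (hD.subset hD').pow_card_le hδ (k := k) (by rw [hc]; exact_mod_cast (by omega)) H
    rw [hc, Nat.cast_one, one_add_one_eq_two] at this
    linarith
  have hEc : E.card ≤ g := by
    by_contra! h
    obtain ⟨E', hE', hc⟩ := Finset.exists_subset_card_eq h.le
    have := (hE.subset hE').pow_card_le hδ (k := k) (by rw [hc]; exact_mod_cast hgk) H
    rw [hc] at this
    linarith
  choose l ν hl hls hν hrel using fun i : D => hEm i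
  let q : ℤ := (S.factorial : ℕ)
  have hq : 0 < q := Int.natCast_pos.2 S.factorial_pos
  have hlq : ∀ i, l i ∣ q := fun i => by
    obtain ⟨m, hm⟩ := Int.eq_ofNat_of_zero_le (by linarith [hl i] : 0 ≤ l i)
    have h1 := hl i
    have h2 := hls i
    rw [hm] at h1 h2 ⊢
    exact Int.natCast_dvd_natCast.2 (Nat.dvd_factorial (by omega) (by omega))
  have hDc' : (Fintype.card D : ℤ) ≤ S := by rw [Fintype.card_coe]; exact_mod_cast hDc
  have hEc' : (Fintype.card E : ℤ) ≤ g := by rw [Fintype.card_coe]; exact_mod_cast hEc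
  refine ⟨E, inferInstance, q, LinearMap.range (relationMap q l ν), evalMap q fun j => a j,
    by rwa [Fintype.card_coe], hq, fun i => ?_, fun z hz T hT => ?_⟩
  · obtain ⟨l', x, hl1, hl2, hx, hr⟩ := hDm i
    have hl' : l' = 1 := le_antisymm (by exact_mod_cast hl2) hl1
    have hxS : ∑ i, |x i| ≤ (S : ℤ) := calc
      ∑ i, |x i| ≤ ∑ i : D, (1 : ℤ) := Finset.sum_le_sum fun i _ => by exact_mod_cast hx i
      _ ≤ S := by simpa using hDc
    refine ⟨relationMap q l ν (x, 0), LinearMap.mem_range_self _ _, fun j => ?_, ?_⟩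
    · refine (abs_relationMap_le hq.le hl hν x j).trans ?_
      rw [sq]
      gcongr
    · have h1 := abs_evalMap_relationMap_sub_le hq.ne' hl hlq hrel x 0
      simp only [Pi.zero_apply, Int.cast_zero, zero_mul, Finset.sum_const_zero, add_zero] at h1
      have h2 : ((∑ i, |x i| : ℤ) : ℝ) ≤ S := by exact_mod_cast hxS
      rw [hl', Int.cast_one, one_mul, abs_sub_comm] at hr
      calc _ ≤ _ := abs_sub_le _ (∑ i, (x i : ℝ) * a i) _
        _ ≤ S * δ + δ := add_le_add (h1.trans (mul_le_mul_of_nonneg_right h2 hδ)) hr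
        _ = _ := by ring
  · obtain ⟨x, y, rfl, hx, hy⟩ := exists_short_relationMap_eq hq hl hls hlq hν hz hT
    have hx' : ∑ i, |x i| ≤ (S : ℤ) ^ 2 := hx.trans (by rw [sq]; gcongr)
    refine ⟨∑ i, (x i : ℝ) * a i + ∑ j, (y j : ℝ) * a j, boundedSums_mono ?_
      (add_mem_boundedSums (sum_mem_boundedSums (fun i : D => (i : ι)) x)
        (sum_mem_boundedSums (fun j : E => (j : ι)) y)), ?_⟩
    · refine add_le_add hx' (hy.trans ?_)
      rw [sq]
      gcongr
    · rw [abs_sub_comm]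
      refine (abs_evalMap_relationMap_sub_le hq.ne' hl hlq hrel x y).trans ?_
      have h2 : ((∑ i, |x i| : ℤ) : ℝ) ≤ (S : ℝ) ^ 2 := by exact_mod_cast hx'
      gcongr

theorem isCGAP_singleton_zero : IsCGAP 0 1 {0} := by
  refine ⟨0, Set.univ, fun _ _ => trivial, convex_univ, Set.toFinite _, ?_, ?_⟩
  · simp
  · ext x; simp

theorem exists_isCGAP_of_card_le {ι : Type} [Fintype ι] (a : ι → ℝ) {δ : ℝ} (hδ : 0 ≤ δ)
    {k S g J : ℕ} {N : ℝ} (hS : 1 ≤ S) (hg : 1 ≤ g) (hgk : g * S ≤ k)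
    (hN1 : N * k ^ 2 < 2 ^ (S + 1)) (hN2 : N * k ^ 2 < ((S : ℝ) + 1) ^ g)
    (hSk : (S + 1) * 2 ≤ k) (hJ : S ^ 2 + g * ((1 + g) * S ^ 2 + S ^ 2) + 5 * J ≤ k)
    {σ : ℝ} (hσ : σ = (1 / 2) ^ (g + 1) / (4 * g)) (hkσ : 2 * S ^ 2 ≤ σ * k ^ 2)
    (H : ∀ σ : ℝ, 0 < σ → σ ≤ 1 → ∀ F : Finset ℝ, (∀ x ∈ F, x ∈ boundedSums a k) →
      (∀ x ∈ F, ∀ y ∈ F, x ≠ y → σ * δ < |x - y|) → σ * F.card ≤ N) :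
    ∃ (r m : ℕ) (K : Set ℝ), IsCGAP r m K ∧ r ≤ g ∧ (∀ i, ∃ y ∈ K, |a i - y| ≤ δ) ∧
      (Nat.card K ≤ 1 ∨
        σ * (Nat.card K * J) ≤ (2 * ((1 + g) * 2 ^ (g + 1) : ℕ) + 1) ^ g * N) := by
  classical
  by_cases hsmall : ∀ i, |a i| ≤ δ
  · exact ⟨0, 1, {0}, isCGAP_singleton_zero, Nat.zero_le _,
      fun i => ⟨0, rfl, by simpa using hsmall i⟩, Or.inl (by simp)⟩
  push Not at hsmall
  obtain ⟨i₀, hi₀⟩ := hsmall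
  have : Nonempty ι := ⟨i₀⟩
  obtain ⟨i₁, hi₁⟩ := Finite.exists_max fun i => |a i|
  have hM : δ < |a i₁| := hi₀.trans_le (hi₁ i₀)
  set M := |a i₁| with hMdef
  have hk : 0 < k := by omega
  have hkR : (0 : ℝ) < k := by exact_mod_cast hk
  have hgR : (0 : ℝ) < g := by exact_mod_cast hg
  have hσ0 : 0 < σ := by rw [hσ]; positivity
  have hσ4 : 4 * σ ≤ 1 := by
    have h1 : (1 / 2 : ℝ) ^ (g + 1) ≤ 1 := pow_le_one₀ (by norm_num) (by norm_num)
    have h2 : (1 : ℝ) ≤ g := by exact_mod_cast hg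
    rw [hσ, mul_div_assoc', div_le_one (by positivity)]
    linarith
  obtain ⟨E, _, q, Λ, ψ, hE, hq, happ, hshort⟩ := exists_lattice_of_card_le a
    (δ := 1 / k ^ 2 * δ) (by positivity) (N := N * k ^ 2) hS (by omega) hgk hN1 hN2
    (fun F hF hsep => by
      have h1 : (1 : ℝ) / k ^ 2 ≤ 1 := by
        rw [div_le_one (by positivity)]
        exact one_le_pow₀ (by exact_mod_cast hk)
      have h2 := H (1 / k ^ 2) (by positivity) h1 F hF hsep
      rwa [one_div_mul_eq_div, div_le_iff₀ (by positivity)] at h2)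
  have hqR : (0 : ℝ) < q := by exact_mod_cast hq
  have hSR : (0 : ℝ) < S := by exact_mod_cast hS
  set w : ℝ := q * S ^ 2 with hw
  have hw0 : 0 < w := by positivity
  obtain ⟨η, hη, hηψ⟩ := exists_gt_forall_abs_le
    ((finite_integral_box (E := E) (g * w)).image ψ) (δ / 2)
  have hη0 : 0 < η := by linarith
  obtain ⟨Λ', hΛ, hclose, hsep⟩ := exists_sparse_sublattice Λ ψ hw0 (div_pos hη0 hgR) hE
  set c : ℝ := (1 / 2) ^ (g + 1) with hc
  have hc0 : 0 < c := by positivity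
  have happ' : ∀ i, ∃ y ∈ Λ', (∀ j, |(y j : ℝ)| ≤ (1 + g) * w) ∧ |a i - ψ y| ≤ δ := by
    intro i
    obtain ⟨z, hz, hz1, hz2⟩ := happ i
    obtain ⟨y, hy, hy1, hy2⟩ := hclose z hz
    have hz1' : ∀ j, |(z j : ℝ)| ≤ w := fun j => by rw [hw]; exact_mod_cast hz1 j
    refine ⟨y, hy, fun j => ?_, ?_⟩
    · have h1 := abs_sub_abs_le_abs_sub (y j : ℝ) (z j)
      rw [abs_sub_comm] at h1
      linarith [hy1 j, hz1' j]
    · rw [mul_div_cancel₀ _ hgR.ne', ← map_sub] at hy2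
      have h1 := hηψ (ψ (z - y)) ⟨z - y, fun j => by simpa using hy1 j, rfl⟩ hy2
      have h2 : ((S : ℝ) + 1) * (1 / k ^ 2 * δ) ≤ δ / 2 := by
        have h3 : ((S : ℝ) + 1) * 2 ≤ k := by exact_mod_cast hSk
        have h4 : (1 : ℝ) ≤ k := by exact_mod_cast hk
        have h5 : ((S : ℝ) + 1) * 2 ≤ k ^ 2 := h3.trans (by nlinarith)
        have h6 : ((S : ℝ) + 1) / k ^ 2 ≤ 1 / 2 := by
          rw [div_le_div_iff₀ (by positivity) (by norm_num)]; linarith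
        calc _ = ((S : ℝ) + 1) / k ^ 2 * δ := by ring
          _ ≤ 1 / 2 * δ := by gcongr
          _ = _ := by ring
      rw [map_sub] at h1
      have h3 := abs_sub_le (a i) (ψ z) (ψ y)
      rw [abs_sub_comm] at hz2
      linarith
  have hfin : {z : E → ℤ | z ∈ Λ' ∧ (∀ j, |(z j : ℝ)| ≤ (1 + g) * w) ∧ |ψ z| ≤ 2 * M}.Finite :=
    (finite_integral_box _).subset fun z hz => hz.2.1
  refine ⟨_, _, _, isCGAP_image Λ' ψ ((1 + g) * w) (2 * M),
    ((Submodule.finrank_le Λ').trans_eq (Module.finrank_fintype_fun_eq_card ℤ)).trans hE,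
    fun i => ?_, Or.inr ?_⟩
  · obtain ⟨y, hy, hy1, hy2⟩ := happ' i
    refine ⟨ψ y, ⟨y, ⟨hy, hy1, ?_⟩, rfl⟩, hy2⟩
    have h1 := abs_sub_abs_le_abs_sub (ψ y) (a i)
    rw [abs_sub_comm] at h1
    linarith [hi₁ i]
  set L : ℕ := (1 + g) * 2 ^ (g + 1) with hL
  have hmem : ∀ z ∈ hfin.toFinset,
      z ∈ Λ' ∧ (∀ j, |(z j : ℝ)| ≤ (1 + g) * w) ∧ |ψ z| ≤ 2 * M := fun z hz => by simpa using hz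
  obtain ⟨Q, hQ, hPQ, hdiam⟩ := exists_subset_small_diam hfin.toFinset (mul_pos hc0 hw0) L
    fun z hz j => by
      refine ((hmem z hz).2.1 j).trans_eq ?_
      rw [hL, hc]
      push_cast
      rw [one_div, inv_pow]
      field_simp
  have herr : 2 * (S ^ 2 * (1 / k ^ 2 * δ)) ≤ σ * δ := by
    have h1 : 2 * (S : ℝ) ^ 2 / k ^ 2 ≤ σ := by rwa [div_le_iff₀ (by positivity)]
    calc _ = 2 * (S : ℝ) ^ 2 / k ^ 2 * δ := by ring
      _ ≤ _ := by gcongr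
  choose! u hu1 hu2 using fun (z : E → ℤ) (hz : z ∈ Q) =>
    hshort z (hΛ (hmem z (hQ hz)).1) ((1 + g) * S ^ 2) fun j => by
      have h1 := (hmem z (hQ hz)).2.1 j
      have h2 : (1 + (g : ℝ)) * w = ((q * ((1 + g) * S ^ 2 : ℕ) : ℤ) : ℝ) := by
        rw [hw]; push_cast; ring
      rw [h2] at h1
      exact_mod_cast h1
  have hcount : (Q.card : ℝ) * J ≤ N / σ := by
    refine card_mul_le_of_translates Q ψ (fun z j => u z + ((5 * j : ℤ) : ℝ) * a i₁)
      (b := a i₁) (M := M) (η := σ * δ) (e := S ^ 2 * (1 / k ^ 2 * δ)) (S := boundedSums a k)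
      (by positivity) rfl ?_ (fun z hz => (hmem z (hQ hz)).2.2) ?_ ?_ ?_
    · nlinarith
    · intro z hz z' hz' hne
      rcases hsep (z - z') (Λ'.sub_mem (hmem z (hQ hz)).1 (hmem z' (hQ hz')).1)
        (sub_ne_zero.2 hne) with ⟨j, hj⟩ | h
      · have := hdiam z hz z' hz' j
        rw [Pi.sub_apply, Int.cast_sub] at hj
        linarith
      · rw [map_sub] at h
        refine lt_of_le_of_lt ?_ h
        have h1 : 2 * (σ * δ) = c * (δ / 2 / g) := by rw [hσ]; field_simp; ring
        have h2 : c * (δ / 2 / g) ≤ c * (η / g) := by gcongr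
        linarith
    · intro z hz j hj
      refine ⟨boundedSums_mono ?_ (add_mem_boundedSums (hu1 z hz) (mul_mem_boundedSums _ _)), ?_⟩
      · have h1 : |(5 * j : ℤ)| = 5 * j := abs_of_nonneg (by positivity)
        have h2 : ((S ^ 2 + g * ((1 + g) * S ^ 2 + S ^ 2) + 5 * J : ℕ) : ℤ) ≤ k := by
          exact_mod_cast hJ
        rw [h1]
        push_cast at h2 ⊢
        have h3 : (j : ℤ) ≤ J := by exact_mod_cast hj.le
        linarith
      · have h1 : u z + ((5 * j : ℤ) : ℝ) * a i₁ - (ψ z + 5 * j * a i₁) = u z - ψ z := by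
          push_cast; ring
        rw [h1]
        exact hu2 z hz
    · intro F hF hF2
      rw [le_div_iff₀ hσ0, mul_comm]
      exact H σ hσ0 (by linarith) F hF hF2
  have hN0 : 0 ≤ N := by
    have := (mul_nonneg (Nat.cast_nonneg Q.card) (Nat.cast_nonneg J)).trans hcount
    exact (div_nonneg_iff.1 this).elim (·.1) fun h => absurd h.2 (not_le.2 hσ0)
  have hKP : Nat.card (ψ '' {z : E → ℤ | z ∈ Λ' ∧ (∀ j, |(z j : ℝ)| ≤ (1 + g) * w) ∧
      |ψ z| ≤ 2 * M}) ≤ (2 * L + 1) ^ g * Q.card := by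
    rw [Nat.card_coe_set_eq]
    calc _ ≤ _ := Set.ncard_image_le hfin
      _ = hfin.toFinset.card := Set.ncard_eq_toFinset_card _ hfin
      _ ≤ _ := hPQ
      _ ≤ _ := by gcongr; omega
  have hKP' := (Nat.cast_le (α := ℝ)).2 hKP
  push_cast at hKP'
  rw [le_div_iff₀ hσ0] at hcount
  calc _ ≤ σ * ((2 * (L : ℝ) + 1) ^ g * Q.card * J) := by gcongr
    _ = (2 * (L : ℝ) + 1) ^ g * (Q.card * J * σ) := by ring
    _ ≤ _ := by gcongr

theorem exists_fourth_powers_around (S₀ : ℕ) :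
    ∀ k ≥ S₀ ^ 4, ∃ S ≥ S₀, S ^ 4 ≤ k ∧ k < (S + 1) ^ 4 := by
  intro k hk
  refine ⟨k.sqrt.sqrt, ?_, ?_, ?_⟩
  · rw [ge_iff_le, Nat.le_sqrt', Nat.le_sqrt', ← pow_mul]
    exact hk
  · calc k.sqrt.sqrt ^ 4 = (k.sqrt.sqrt ^ 2) ^ 2 := by ring
      _ ≤ k.sqrt ^ 2 := Nat.pow_le_pow_left (Nat.sqrt_le' _) 2
      _ ≤ k := Nat.sqrt_le' _
  · have h1 := Nat.succ_le_of_lt (Nat.lt_succ_sqrt' k.sqrt)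
    calc k < (k.sqrt + 1) ^ 2 := Nat.lt_succ_sqrt' _
      _ ≤ ((k.sqrt.sqrt + 1) ^ 2) ^ 2 := Nat.pow_le_pow_left h1 2
      _ = _ := by ring

theorem eventually_pow_lt_two_pow (g : ℕ) :
    ∀ᶠ S : ℕ in Filter.atTop, ((S : ℝ) + 1) ^ g < 2 ^ (S + 1) := by
  have h := (tendsto_pow_const_div_const_pow_of_one_lt g (one_lt_two (α := ℝ))).eventually_lt_const
    one_pos
  filter_upwards [(Filter.tendsto_add_atTop_nat 1).eventually h] with S hS
  rw [div_lt_one (by positivity)] at hS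
  exact_mod_cast hS

/-- If the sums of at most `k` terms `a i` contain at most `σ⁻¹ N` values separated by `σ δ`, for
all `σ`, and `N` is polynomial in `k`, then the `a i` lie within `δ` of a CGAP of bounded rank and
of size `O(N / k)`. -/
theorem exists_isCGAP_of_packing (γ : ℕ) : ∃ (k₀ R : ℕ) (C : ℝ), 0 < C ∧
    ∀ (ι : Type) [Fintype ι] (a : ι → ℝ) (δ : ℝ), 0 ≤ δ → ∀ k : ℕ, k₀ ≤ k →
    ∀ N : ℝ, N ≤ k ^ γ →
    (∀ σ : ℝ, 0 < σ → σ ≤ 1 → ∀ F : Finset ℝ, (∀ x ∈ F, x ∈ boundedSums a k) →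
      (∀ x ∈ F, ∀ y ∈ F, x ≠ y → σ * δ < |x - y|) → σ * F.card ≤ N) →
    ∃ (r m : ℕ) (K : Set ℝ), IsCGAP r m K ∧ r ≤ R ∧ (∀ i, ∃ y ∈ K, |a i - y| ≤ δ) ∧
      (Nat.card K : ℝ) ≤ max (C * (N / k)) 1 := by
  set g := 4 * (γ + 2) with hg
  set σ : ℝ := (1 / 2) ^ (g + 1) / (4 * g) with hσ
  have hg0 : 1 ≤ g := by omega
  have hgR : (0 : ℝ) < g := by exact_mod_cast hg0
  have hσ0 : 0 < σ := by positivity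
  obtain ⟨S₁, hS₁⟩ := Filter.eventually_atTop.1 (eventually_pow_lt_two_pow g)
  set S₀ := max S₁ (max (2 * (1 + g * (2 + g))) ⌈2 / σ⌉₊) with hS₀
  set B : ℝ := (2 * ((1 + g) * 2 ^ (g + 1) : ℕ) + 1) ^ g with hB
  refine ⟨S₀ ^ 4 , g, 20 * B / σ, by positivity, fun ι _ a δ hδ k hk N hN H => ?_⟩
  obtain ⟨S, hS, hSk, hkS⟩ := exists_fourth_powers_around S₀ k hk
  have hS1 : S₁ ≤ S := (le_max_left _ _).trans hS
  have hS2 : 2 * (1 + g * (2 + g)) ≤ S := ((le_max_left _ _).trans (le_max_right _ _)).trans hS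
  have hS3 : 2 / σ ≤ S := (Nat.le_ceil _).trans
    (by exact_mod_cast ((le_max_right _ _).trans (le_max_right _ _)).trans hS)
  have hS8 : 8 ≤ S := by nlinarith
  have hSS : S ^ 2 * S ^ 2 ≤ k := by rw [← pow_add]; exact hSk
  have hS2S : S ≤ S ^ 2 := Nat.le_self_pow two_ne_zero S
  have hS2k : S ^ 2 ≤ k := by nlinarith
  have hk64 : 64 ≤ k := by nlinarith
  have hkR : (0 : ℝ) < k := by exact_mod_cast (by omega : 0 < k)
  have hN2 : N * k ^ 2 < ((S : ℝ) + 1) ^ g := by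
    have h1 : (k : ℝ) < ((S : ℝ) + 1) ^ 4 := by exact_mod_cast hkS
    calc N * k ^ 2 ≤ k ^ γ * k ^ 2 := by gcongr
      _ = (k : ℝ) ^ (γ + 2) := by rw [pow_add]
      _ < (((S : ℝ) + 1) ^ 4) ^ (γ + 2) := pow_lt_pow_left₀ h1 hkR.le (by omega)
      _ = _ := by rw [← pow_mul]
  have hkσ : 2 * (S : ℝ) ^ 2 ≤ σ * k ^ 2 := by
    have h1 : (S : ℝ) ^ 2 ≤ k := by exact_mod_cast hS2k
    have h2 : (S : ℝ) ≤ (S : ℝ) ^ 2 := by exact_mod_cast hS2S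
    have h3 : 2 ≤ σ * k := by
      rw [← div_le_iff₀' hσ0]; linarith
    nlinarith
  have hkJ : (k : ℝ) ≤ 20 * (k / 10 : ℕ) := by exact_mod_cast (by omega : k ≤ 20 * (k / 10))
  obtain ⟨r, m, K, h1, h2, h3, h4⟩ := exists_isCGAP_of_card_le a hδ (J := k / 10)
    (by omega : 1 ≤ S) hg0 (by nlinarith) (hN2.trans (hS₁ S hS1)) hN2 (by nlinarith)
    (by
      have h5 : S ^ 2 * (2 * (1 + g * (2 + g))) ≤ k :=
        (Nat.mul_le_mul_left _ (hS2.trans hS2S)).trans hSS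
      have h6 : 5 * (k / 10) * 2 ≤ k := by omega
      nlinarith) hσ hkσ H
  refine ⟨r, m, K, h1, h2, h3, ?_⟩
  rcases h4 with h4 | h4
  · exact le_max_of_le_right (by exact_mod_cast h4)
  · refine le_max_of_le_left ?_
    have h5 : σ * (Nat.card K * k) ≤ 20 * (B * N) := by
      calc σ * (Nat.card K * (k : ℝ)) ≤ σ * (Nat.card K * (20 * (k / 10 : ℕ))) := by gcongr
        _ = 20 * (σ * (Nat.card K * (k / 10 : ℕ))) := by ring
        _ ≤ _ := by gcongr
    have h6 : 20 * B / σ * (N / k) = 20 * (B * N) / (σ * k) := by field_simp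
    rw [h6, le_div_iff₀ (by positivity)]
    linarith

section charFun

open Complex in
theorem re_charFun (ν : Measure ℝ) [IsFiniteMeasure ν] (t : ℝ) :
    (charFun ν t).re = ∫ x, Real.cos (t * x) ∂ν := by
  have hint : Integrable (fun x : ℝ => cexp (t * x * I)) ν := by
    refine Integrable.of_bound (by fun_prop) 1 (ae_of_all _ fun x => ?_)
    rw [← ofReal_mul, norm_exp_ofReal_mul_I]
  rw [charFun_apply_real, ← reCLM_apply, ← reCLM.integral_comp_comm hint]
  refine integral_congr_ae (ae_of_all _ fun x => ?_)
  simp only [reCLM_apply]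
  rw [← ofReal_mul, exp_ofReal_mul_I_re]

theorem integral_cos_sub_le_norm_charFun (ν : Measure ℝ) [IsFiniteMeasure ν] (t x : ℝ) :
    ∫ s, Real.cos (t * (s - x)) ∂ν ≤ ‖charFun ν t‖ := by
  have h1 : ‖charFun (ν.map (· + -x)) t‖ = ‖charFun ν t‖ := by
    rw [charFun_map_add_const, norm_mul, Complex.norm_exp_ofReal_mul_I, mul_one]
  rw [← h1]
  refine le_trans (le_of_eq ?_) (Complex.re_le_norm _)
  rw [re_charFun, integral_map (by fun_prop) (by fun_prop)]
  simp only [sub_eq_add_neg]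

open Complex in
theorem integral_cos_symG (μ : Measure ℝ) [IsProbabilityMeasure μ] (t : ℝ) :
    ∫ z, Real.cos (t * z) ∂symG μ = ‖charFun μ t‖ ^ 2 := by
  have hp : IsProbabilityMeasure (symG μ) := Measure.isProbabilityMeasure_map (by fun_prop)
  have h : charFun (symG μ) t = charFun μ t * charFun μ (-t) := by
    rw [charFun_apply_real, charFun_apply_real, charFun_apply_real, ← integral_prod_mul, symG,
      integral_map (by fun_prop) (by fun_prop)]
    refine integral_congr_ae (ae_of_all _ fun x => ?_)
    simp only [← Complex.exp_add]
    push_cast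
    ring_nf
  rw [← re_charFun, h, charFun_neg, mul_conj, ofReal_re, normSq_eq_norm_sq]

open Complex in
theorem charFun_map_sum_mul {ι : Type*} [Fintype ι] (μ : Measure ℝ) [IsProbabilityMeasure μ]
    (b : ι → ℝ) (t : ℝ) :
    charFun ((Measure.pi fun _ : ι => μ).map fun x => ∑ k, x k * b k) t
      = ∏ k, charFun μ (t * b k) := by
  have hm : Measurable fun x : ι → ℝ => ∑ k, x k * b k := by fun_prop
  rw [charFun_apply_real, integral_map hm.aemeasurable (by fun_prop)]
  simp only [charFun_apply_real]
  rw [← integral_fintype_prod_eq_prod]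
  refine integral_congr_ae (ae_of_all _ fun x => ?_)
  simp only [← exp_sum]
  push_cast
  rw [Finset.mul_sum, Finset.sum_mul]
  congr 1
  exact Finset.sum_congr rfl fun k _ => by ring

/-- The function `t ↦ ∑ k, E (1 - cos (t bₖ X̃))`. -/
noncomputable def symDefect {ι : Type*} [Fintype ι] (μ : Measure ℝ) (b : ι → ℝ) (t : ℝ) : ℝ :=
  ∑ k, ∫ z, (1 - Real.cos (t * b k * z)) ∂symG μ

theorem integrable_one_sub_cos (ν : Measure ℝ) [IsFiniteMeasure ν] (t : ℝ) :
    Integrable (fun z => 1 - Real.cos (t * z)) ν :=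
  Integrable.of_bound (by fun_prop) 2 (ae_of_all _ fun x => by
    rw [Real.norm_eq_abs, abs_le]
    constructor <;> linarith [Real.neg_one_le_cos (t * x), Real.cos_le_one (t * x)])

theorem isProbabilityMeasure_symG (μ : Measure ℝ) [IsProbabilityMeasure μ] :
    IsProbabilityMeasure (symG μ) := Measure.isProbabilityMeasure_map (by fun_prop)

theorem norm_charFun_map_sum_mul_le {ι : Type*} [Fintype ι] (μ : Measure ℝ)
    [IsProbabilityMeasure μ] (b : ι → ℝ) (t : ℝ) :
    ‖charFun ((Measure.pi fun _ : ι => μ).map fun x => ∑ k, x k * b k) t‖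
      ≤ Real.exp (-symDefect μ b t / 2) := by
  have hp := isProbabilityMeasure_symG μ
  rw [charFun_map_sum_mul, norm_prod]
  refine (pow_le_pow_iff_left₀ (by positivity) (Real.exp_pos _).le two_ne_zero).1 ?_
  rw [← Finset.prod_pow, ← Real.exp_nat_mul, symDefect]
  have h1 : ((2 : ℕ) : ℝ) * (-(∑ k, ∫ z, (1 - Real.cos (t * b k * z)) ∂symG μ) / 2)
      = ∑ k, -∫ z, (1 - Real.cos (t * b k * z)) ∂symG μ := by
    rw [Finset.sum_neg_distrib]; push_cast; ring
  rw [h1, Real.exp_sum]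
  refine Finset.prod_le_prod (fun _ _ => by positivity) fun k _ => ?_
  rw [← integral_cos_symG]
  have h2 : ∫ z, (1 - Real.cos (t * b k * z)) ∂symG μ
      = 1 - ∫ z, Real.cos (t * b k * z) ∂symG μ := by
    rw [integral_sub (integrable_const _)]
    · simp
    · refine Integrable.of_bound (by fun_prop) 1 (ae_of_all _ fun x => ?_)
      exact Real.abs_cos_le_one _
  have h3 := Real.add_one_le_exp (-∫ z, (1 - Real.cos (t * b k * z)) ∂symG μ)
  rw [h2] at h3 ⊢
  linarith

theorem symDefect_nonneg {ι : Type*} [Fintype ι] (μ : Measure ℝ) (b : ι → ℝ) (t : ℝ) :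
    0 ≤ symDefect μ b t :=
  Finset.sum_nonneg fun _ _ => integral_nonneg fun _ => by
    simpa using Real.cos_le_one _

theorem symDefect_le {ι : Type*} [Fintype ι] (μ : Measure ℝ) [IsProbabilityMeasure μ]
    (b : ι → ℝ) (t : ℝ) : symDefect μ b t ≤ 2 * Fintype.card ι := by
  have hp := isProbabilityMeasure_symG μ
  calc symDefect μ b t ≤ ∑ k : ι, (2 : ℝ) := by
        refine Finset.sum_le_sum fun k _ => ?_
        calc _ ≤ ∫ z, (2 : ℝ) ∂symG μ := by
              refine integral_mono (integrable_one_sub_cos _ _) (integrable_const _) fun z => ?_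
              simp only
              linarith [Real.neg_one_le_cos (t * b k * z)]
          _ = 2 := by simp
    _ = _ := by simp [mul_comm]

theorem measurable_symDefect {ι : Type*} [Fintype ι] (μ : Measure ℝ) [IsProbabilityMeasure μ]
    (b : ι → ℝ) : Measurable (symDefect μ b) := by
  have hp := isProbabilityMeasure_symG μ
  refine Finset.measurable_sum _ fun k _ => ?_
  exact (StronglyMeasurable.integral_prod_right
    (f := fun t z => 1 - Real.cos (t * b k * z)) (by fun_prop)).measurable

end charFun

section esseen

theorem integral_one_sub_mul_cos {w : ℝ} (hw : w ≠ 0) :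
    ∫ ξ in (0 : ℝ)..1, (1 - ξ) * Real.cos (ξ * w) = (1 - Real.cos w) / w ^ 2 := by
  have h : ∀ ξ : ℝ, HasDerivAt
      (fun ξ => (1 - ξ) * (Real.sin (ξ * w) / w) - Real.cos (ξ * w) / w ^ 2)
      ((1 - ξ) * Real.cos (ξ * w)) ξ := fun ξ => by
    have h1 : HasDerivAt (fun ξ => ξ * w) w ξ := by simpa using (hasDerivAt_id ξ).mul_const w
    have h2 := (h1.sin.div_const w)
    have h3 := (h1.cos.div_const (w ^ 2))
    have h4 := (((hasDerivAt_id ξ).const_sub 1).mul h2).sub h3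
    refine h4.congr_deriv ?_
    simp only [id]
    field_simp
    ring
  rw [intervalIntegral.integral_eq_sub_of_hasDerivAt (fun ξ _ => h ξ)
    (Continuous.intervalIntegrable (by fun_prop) _ _)]
  simp
  ring

theorem integral_one_sub_mul_cos_nonneg (w : ℝ) :
    0 ≤ ∫ ξ in (0 : ℝ)..1, (1 - ξ) * Real.cos (ξ * w) := by
  by_cases hw : w = 0
  · subst hw
    simp only [mul_zero, Real.cos_zero, mul_one]
    exact intervalIntegral.integral_nonneg zero_le_one fun ξ hξ => by linarith [hξ.2]
  · rw [integral_one_sub_mul_cos hw]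
    exact div_nonneg (by linarith [Real.cos_le_one w]) (sq_nonneg w)

theorem seven_sixteenths_le_integral_one_sub_mul_cos {w : ℝ} (hw : |w| ≤ 1 / 2) :
    7 / 16 ≤ ∫ ξ in (0 : ℝ)..1, (1 - ξ) * Real.cos (ξ * w) := by
  have h1 : ∫ ξ in (0 : ℝ)..1, (1 - ξ) * (7 / 8) = 7 / 16 := by
    rw [intervalIntegral.integral_mul_const, intervalIntegral.integral_sub (by simp) (by simp)]
    simp
    norm_num
  rw [← h1]
  refine intervalIntegral.integral_mono_on zero_le_one
    (Continuous.intervalIntegrable (by fun_prop) _ _)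
    (Continuous.intervalIntegrable (by fun_prop) _ _) fun ξ hξ => ?_
  refine mul_le_mul_of_nonneg_left ?_ (by linarith [hξ.2])
  have h2 := Real.one_sub_sq_div_two_le_cos (x := ξ * w)
  have h3 : |ξ * w| ≤ 1 / 2 := by
    rw [abs_mul, abs_of_nonneg hξ.1]
    nlinarith [hξ.1, hξ.2, abs_nonneg w]
  have h4 := sq_le_sq' (abs_le.1 h3).1 (abs_le.1 h3).2
  linarith

/-- Esseen's inequality. -/
theorem measureReal_closedBall_le_integral_norm_charFun (ν : Measure ℝ) [IsProbabilityMeasure ν]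
    (x : ℝ) : ν.real (Metric.closedBall x (1 / 2)) ≤
      16 / 7 * ∫ ξ in (0 : ℝ)..1, ‖charFun ν ξ‖ := by
  have hint : Integrable (Function.uncurry fun ξ s : ℝ => (1 - ξ) * Real.cos (ξ * (s - x)))
      ((volume.restrict (Set.uIoc 0 1)).prod ν) := by
    rw [Set.uIoc_of_le zero_le_one]
    refine Integrable.of_bound (by fun_prop) 1 ?_
    rw [← Measure.restrict_univ (μ := ν), Measure.prod_restrict]
    refine (ae_restrict_iff' (measurableSet_Ioc.prod MeasurableSet.univ)).2
      (ae_of_all _ fun p hp => ?_)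
    simp only [Function.uncurry, norm_mul, Real.norm_eq_abs]
    have h1 : |1 - p.1| ≤ 1 := by
      rw [abs_le]; constructor <;> linarith [hp.1.1, hp.1.2]
    have h2 := Real.abs_cos_le_one (p.1 * (p.2 - x))
    nlinarith [abs_nonneg (1 - p.1), abs_nonneg (Real.cos (p.1 * (p.2 - x)))]
  have hswap := intervalIntegral_integral_swap (μ := ν) (a := 0) (b := 1) hint
  have h1 : 7 / 16 * ν.real (Metric.closedBall x (1 / 2)) ≤
      ∫ s, (∫ ξ in (0 : ℝ)..1, (1 - ξ) * Real.cos (ξ * (s - x))) ∂ν := by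
    refine le_trans ?_ (mul_meas_ge_le_integral_of_nonneg
      (ae_of_all _ fun s => integral_one_sub_mul_cos_nonneg (s - x)) ?_ (7 / 16))
    · refine mul_le_mul_of_nonneg_left (measureReal_mono fun s hs => ?_) (by norm_num)
      exact seven_sixteenths_le_integral_one_sub_mul_cos
        (by rwa [Metric.mem_closedBall, Real.dist_eq] at hs)
    · have := hint.integral_prod_right
      rw [Set.uIoc_of_le zero_le_one] at this
      simpa only [intervalIntegral.integral_of_le zero_le_one, Function.uncurry] using this
  have h2 : ∫ ξ in (0 : ℝ)..1, ∫ s, (1 - ξ) * Real.cos (ξ * (s - x)) ∂ν ≤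
      ∫ ξ in (0 : ℝ)..1, ‖charFun ν ξ‖ := by
    refine intervalIntegral.integral_mono_on zero_le_one
      (intervalIntegrable_iff.2 hint.integral_prod_left) intervalIntegrable_charFun.norm
      fun ξ hξ => ?_
    rw [integral_const_mul]
    have h3 := integral_cos_sub_le_norm_charFun ν ξ x
    have h4 := norm_nonneg (charFun ν ξ)
    nlinarith [hξ.1, hξ.2]
  rw [← hswap] at h1
  linarith

end esseen

section levelSets

theorem exists_measureReal_level_ge {G : ℝ → ℝ} (hG : Measurable G) (hG0 : ∀ ξ, 0 ≤ G ξ) {M : ℕ}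
    (hGM : ∀ ξ, G ξ ≤ M) {q : ℝ} (hq : 0 < q)
    (h : q ≤ 16 / 7 * ∫ ξ in (0 : ℝ)..1, Real.exp (-G ξ / 2)) :
    ∃ m : ℕ, 1 ≤ m ∧
      q * Real.exp (m / 4) / 20 ≤ volume.real {ξ ∈ Set.Ioc (0 : ℝ) 1 | G ξ ≤ m} := by
  by_contra! hcon
  have hT (m : ℕ) : MeasurableSet {ξ | G ξ ≤ m} := hG measurableSet_Iic
  have hind (m : ℕ) : Integrable (fun ξ => Real.exp (-m / 2) *
      Set.indicator {ξ | G ξ ≤ (m + 1 : ℕ)} 1 ξ) (volume.restrict (Set.Ioc (0 : ℝ) 1)) :=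
    ((integrable_const 1).indicator (hT _)).const_mul _
  have hle : ∫ ξ in (0 : ℝ)..1, Real.exp (-G ξ / 2) ≤
      ∑ m ∈ Finset.range (M + 1), Real.exp (-m / 2) *
        volume.real {ξ ∈ Set.Ioc (0 : ℝ) 1 | G ξ ≤ (m + 1 : ℕ)} := by
    rw [intervalIntegral.integral_of_le zero_le_one]
    calc _ ≤ ∫ ξ in Set.Ioc (0 : ℝ) 1, ∑ m ∈ Finset.range (M + 1), Real.exp (-m / 2) *
          Set.indicator {ξ | G ξ ≤ (m + 1 : ℕ)} 1 ξ := by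
          refine integral_mono ?_ (integrable_finsetSum _ fun m _ => hind m) fun ξ => ?_
          · refine Integrable.of_bound (by fun_prop) 1 (ae_of_all _ fun ξ => ?_)
            rw [Real.norm_eq_abs, Real.abs_exp, Real.exp_le_one_iff]
            linarith [hG0 ξ]
          · have h1 : ⌊G ξ⌋₊ ∈ Finset.range (M + 1) := by
              rw [Finset.mem_range, Nat.lt_succ_iff]
              exact Nat.floor_le_of_le (hGM ξ)
            refine le_trans ?_ (Finset.single_le_sum (fun m _ => ?_) h1)
            · rw [Set.indicator_of_mem]
              · simp only [Pi.one_apply, mul_one]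
                exact Real.exp_le_exp.2 (by linarith [Nat.floor_le (hG0 ξ)])
              · simpa using (Nat.lt_floor_add_one (G ξ)).le
            · exact mul_nonneg (Real.exp_pos _).le
                (Set.indicator_nonneg (fun _ _ => zero_le_one) _)
      _ = _ := by
          rw [integral_finsetSum _ fun m _ => hind m]
          refine Finset.sum_congr rfl fun m _ => ?_
          rw [integral_const_mul, integral_indicator_one (hT _),
            measureReal_restrict_apply (hT _), Set.inter_comm]
          rfl
  have h2 : ∑ m ∈ Finset.range (M + 1), Real.exp (-m / 2) *
        volume.real {ξ ∈ Set.Ioc (0 : ℝ) 1 | G ξ ≤ (m + 1 : ℕ)} ≤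
      ∑ m ∈ Finset.range (M + 1), q * Real.exp (1 / 4) / 20 * (4 / 5) ^ m := by
    refine Finset.sum_le_sum fun m _ => ?_
    have h3 := (hcon (m + 1) (by omega)).le
    have h4 : Real.exp (-(1 / 4)) ≤ 4 / 5 := by
      rw [Real.exp_neg, inv_le_comm₀ (Real.exp_pos _) (by norm_num)]
      linarith [Real.add_one_le_exp (1 / 4)]
    calc _ ≤ Real.exp (-m / 2) * (q * Real.exp ((m + 1 : ℕ) / 4) / 20) :=
          mul_le_mul_of_nonneg_left h3 (Real.exp_pos _).le
      _ = q * Real.exp (1 / 4) / 20 * Real.exp (-(1 / 4)) ^ m := by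
          rw [← Real.exp_nat_mul]
          have : Real.exp (-m / 2) * Real.exp ((m + 1 : ℕ) / 4) =
              Real.exp (1 / 4) * Real.exp (m * -(1 / 4)) := by
            rw [← Real.exp_add, ← Real.exp_add]
            push_cast
            ring_nf
          linear_combination q / 20 * this
      _ ≤ _ := by gcongr
  rw [← Finset.mul_sum] at h2
  have h5 : ∑ m ∈ Finset.range (M + 1), (4 / 5 : ℝ) ^ m ≤ 5 := by
    rw [geom_sum_eq (by norm_num), div_le_iff_of_neg (by norm_num)]
    have : (0 : ℝ) ≤ (4 / 5) ^ (M + 1) := by positivity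
    linarith
  have h6 : Real.exp (1 / 4) ≤ 4 / 3 := by
    have := Real.add_one_le_exp (-(1 / 4))
    rw [Real.exp_neg] at this
    have h7 := Real.exp_pos (1 / 4)
    rw [← one_div, le_div_iff₀ h7] at this
    linarith
  have h8 : q * Real.exp (1 / 4) / 20 * ∑ m ∈ Finset.range (M + 1), (4 / 5 : ℝ) ^ m ≤
      q * (4 / 3) / 20 * 5 := by gcongr
  linarith

theorem integrable_restrict_prod_one_sub_cos (T : Set ℝ) (hT : T ⊆ Set.Ioc 0 1) (ν : Measure ℝ)
    [IsFiniteMeasure ν] (c : ℝ) :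
    Integrable (Function.uncurry fun ξ z : ℝ => 1 - Real.cos (ξ * c * z))
      ((volume.restrict T).prod ν) := by
  have : IsFiniteMeasure (volume.restrict T) :=
    isFiniteMeasure_restrict.2 (measure_mono hT |>.trans_lt measure_Ioc_lt_top).ne
  refine Integrable.of_bound (by fun_prop) 2 (ae_of_all _ fun x => ?_)
  simp only [Function.uncurry]
  rw [Real.norm_eq_abs, abs_le]
  constructor <;>
    linarith [Real.neg_one_le_cos (x.1 * c * x.2), Real.cos_le_one (x.1 * c * x.2)]

theorem exists_sum_integral_one_sub_cos_le {ι : Type*} [Fintype ι] (μ : Measure ℝ)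
    [IsProbabilityMeasure μ] (hp : 0 < pOf μ 1) (b : ι → ℝ) {T : Set ℝ} (hTm : MeasurableSet T)
    (hT : T ⊆ Set.Ioc 0 1) {m : ℝ} (h : ∀ ξ ∈ T, symDefect μ b ξ ≤ m) :
    ∃ z : ℝ, 1 < |z| ∧
      pOf μ 1 * ∑ k, ∫ ξ in T, (1 - Real.cos (ξ * (z * b k))) ≤ m * volume.real T := by
  have hpm := isProbabilityMeasure_symG μ
  have : IsFiniteMeasure (volume.restrict T) :=
    isFiniteMeasure_restrict.2 (measure_mono hT |>.trans_lt measure_Ioc_lt_top).ne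
  have hS : MeasurableSet {z : ℝ | 1 < |z|} := measurableSet_lt measurable_const (by fun_prop)
  have hint := fun k => integrable_restrict_prod_one_sub_cos T hT (symG μ) (b k)
  have hint2 : Integrable (fun z => ∑ k, ∫ ξ in T, (1 - Real.cos (ξ * b k * z))) (symG μ) :=
    integrable_finsetSum _ fun k _ => (hint k).integral_prod_right
  have hswap : ∫ z, (∑ k, ∫ ξ in T, (1 - Real.cos (ξ * b k * z))) ∂symG μ =
      ∫ ξ in T, symDefect μ b ξ := by
    simp only [symDefect]
    rw [integral_finsetSum, integral_finsetSum]
    · exact Finset.sum_congr rfl fun k _ => (integral_integral_swap (hint k)).symm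
    · exact fun k _ => (hint k).integral_prod_left
    · exact fun k _ => (hint k).integral_prod_right
  have hle : ∫ ξ in T, symDefect μ b ξ ≤ m * volume.real T := by
    calc _ ≤ ∫ ξ in T, m := by
          refine setIntegral_mono_on ?_ (integrable_const _) hTm h
          refine Integrable.of_bound (measurable_symDefect μ b).aestronglyMeasurable
            (2 * Fintype.card ι) (ae_of_all _ fun ξ => ?_)
          rw [Real.norm_eq_abs, abs_of_nonneg (symDefect_nonneg μ b ξ)]
          exact symDefect_le μ b ξ
      _ = _ := by simp [mul_comm]
  have hS0 : symG μ {z : ℝ | 1 < |z|} ≠ 0 := fun h0 => by simp [pOf, h0] at hp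
  obtain ⟨z, hz, hzle⟩ := exists_le_setAverage hS0 (measure_ne_top _ _) hint2.integrableOn
  refine ⟨z, hz, ?_⟩
  have hz' : pOf μ 1 * ∑ k, ∫ ξ in T, (1 - Real.cos (ξ * b k * z)) ≤
      ∫ z in {z : ℝ | 1 < |z|}, (∑ k, ∫ ξ in T, (1 - Real.cos (ξ * b k * z))) ∂symG μ := by
    rw [setAverage_eq, smul_eq_mul] at hzle
    exact (le_inv_mul_iff₀ hp).1 hzle
  have hmono : ∫ z in {z : ℝ | 1 < |z|}, (∑ k, ∫ ξ in T, (1 - Real.cos (ξ * b k * z))) ∂symG μ ≤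
      ∫ z, (∑ k, ∫ ξ in T, (1 - Real.cos (ξ * b k * z))) ∂symG μ :=
    setIntegral_le_integral hint2 (ae_of_all _ fun z => Finset.sum_nonneg fun k _ =>
      integral_nonneg fun ξ => by simpa using Real.cos_le_one _)
  simp only [mul_comm z, ← mul_assoc]
  linarith

theorem abs_sin_add_le (x y : ℝ) : |Real.sin (x + y)| ≤ |Real.sin x| + |Real.sin y| := by
  rw [Real.sin_add]
  refine (abs_add_le _ _).trans (add_le_add ?_ ?_)
  · rw [abs_mul]
    exact mul_le_of_le_one_right (abs_nonneg _) (Real.abs_cos_le_one _)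
  · rw [abs_mul]
    exact mul_le_of_le_one_left (abs_nonneg _) (Real.abs_cos_le_one _)

theorem abs_sin_nat_mul_le (n : ℕ) (x : ℝ) : |Real.sin (n * x)| ≤ n * |Real.sin x| := by
  induction n with
  | zero => simp
  | succ n ih =>
    push_cast
    rw [add_mul, one_mul, add_mul, one_mul]
    exact (abs_sin_add_le _ _).trans (by linarith)

theorem abs_sin_int_mul_le (c : ℤ) (x : ℝ) : |Real.sin (c * x)| ≤ |c| * |Real.sin x| := by
  have h := abs_sin_nat_mul_le c.natAbs x
  rw [Nat.cast_natAbs] at h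
  rcases abs_choice c with hc | hc <;> rw [hc] at h ⊢
  · exact h
  · push_cast at h ⊢
    rwa [neg_mul, Real.sin_neg, abs_neg] at h

theorem abs_sin_sum_le {ι : Type*} (s : Finset ι) (c : ι → ℤ) (u : ι → ℝ) :
    |Real.sin (∑ k ∈ s, c k * u k)| ≤ ∑ k ∈ s, |c k| * |Real.sin (u k)| := by
  classical
  induction s using Finset.induction_on with
  | empty => simp
  | insert k s hk ih =>
    rw [Finset.sum_insert hk, Finset.sum_insert hk]
    exact (abs_sin_add_le _ _).trans (add_le_add (abs_sin_int_mul_le _ _) ih)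

theorem one_sub_cos_sum_le {ι : Type*} [Fintype ι] (c : ι → ℤ) (u : ι → ℝ) :
    1 - Real.cos (∑ k, c k * u k) ≤
      (∑ k, |c k| : ℤ) * ∑ k, |c k| * (1 - Real.cos (u k)) := by
  have hcos (x : ℝ) : 1 - Real.cos x = 2 * |Real.sin (x / 2)| ^ 2 := by
    rw [sq_abs, Real.sin_sq_eq_half_sub, mul_div_cancel₀ _ two_ne_zero]
    ring
  have h1 : (∑ k, c k * u k) / 2 = ∑ k, c k * (u k / 2) := by
    rw [Finset.sum_div]
    exact Finset.sum_congr rfl fun k _ => by ring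
  have h2 : (∑ k, |c k| * |Real.sin (u k / 2)|) ^ 2 ≤
      (∑ k, ((|c k| : ℤ) : ℝ)) * ∑ k, |c k| * |Real.sin (u k / 2)| ^ 2 :=
    Finset.sum_sq_le_sum_mul_sum_of_sq_le_mul _ (fun _ _ => by positivity)
      (fun _ _ => by positivity) fun _ _ => le_of_eq (by ring)
  have h3 := pow_le_pow_left₀ (abs_nonneg _) (abs_sin_sum_le Finset.univ c fun k => u k / 2) 2
  have h4 : ∑ k, |c k| * (1 - Real.cos (u k)) =
      2 * ∑ k, |c k| * |Real.sin (u k / 2)| ^ 2 := by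
    rw [Finset.mul_sum]
    exact Finset.sum_congr rfl fun k _ => by rw [hcos]; ring
  rw [hcos, h1]
  push_cast at h2 h3 h4 ⊢
  rw [h4]
  linarith

theorem integral_one_sub_cos_le_of_mem_boundedSums {ι : Type*} [Fintype ι] {y : ι → ℝ}
    {T : Set ℝ} (hT : T ⊆ Set.Ioc 0 1) {κ : ℝ} (hκ : 0 ≤ κ)
    (hy : ∀ k, ∫ ξ in T, (1 - Real.cos (ξ * y k)) ≤ κ) {N : ℕ} {x : ℝ}
    (hx : x ∈ boundedSums y N) :
    ∫ ξ in T, (1 - Real.cos (ξ * x)) ≤ N ^ 2 * κ := by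
  have : IsFiniteMeasure (volume.restrict T) :=
    isFiniteMeasure_restrict.2 (measure_mono hT |>.trans_lt measure_Ioc_lt_top).ne
  have hint (w : ℝ) : Integrable (fun ξ => 1 - Real.cos (ξ * w)) (volume.restrict T) := by
    simpa only [mul_comm w] using integrable_one_sub_cos (volume.restrict T) w
  obtain ⟨c, hc, rfl⟩ := hx
  have hcN : ((∑ k, |c k| : ℤ) : ℝ) ≤ N := by exact_mod_cast hc
  have hc0 : (0 : ℝ) ≤ (∑ k, |c k| : ℤ) := by
    exact_mod_cast Finset.sum_nonneg fun k _ => abs_nonneg (c k)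
  have hint2 : Integrable (fun ξ => ∑ k, ((|c k| : ℤ) : ℝ) * (1 - Real.cos (ξ * y k)))
      (volume.restrict T) := integrable_finsetSum _ fun k _ => (hint _).const_mul _
  calc _ ≤ ∫ ξ in T, (∑ k, |c k| : ℤ) * ∑ k, |c k| * (1 - Real.cos (ξ * y k)) := by
        refine integral_mono (hint _) ?_ fun ξ => ?_
        · exact_mod_cast hint2.const_mul _
        · have := one_sub_cos_sum_le c fun k => ξ * y k
          simp only
          rw [Finset.mul_sum Finset.univ (fun k => (c k : ℝ) * y k) ξ]
          simpa only [mul_left_comm ξ] using this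
    _ = (∑ k, |c k| : ℤ) * ∑ k, |c k| * ∫ ξ in T, (1 - Real.cos (ξ * y k)) := by
        rw [integral_const_mul, integral_finsetSum]
        · simp only [integral_const_mul]
        · exact fun k _ => (hint _).const_mul _
    _ ≤ (∑ k, |c k| : ℤ) * ((∑ k, |c k| : ℤ) * κ) := by
        refine mul_le_mul_of_nonneg_left ?_ hc0
        push_cast
        rw [Finset.sum_mul]
        exact Finset.sum_le_sum fun k _ => mul_le_mul_of_nonneg_left (hy k) (abs_nonneg _)
    _ ≤ _ := by
        rw [← mul_assoc, ← sq]
        gcongr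

end levelSets

section largeSieve

theorem exists_sum_exp_neg_sq_le : ∃ C : ℝ, 0 < C ∧ ∀ (F : Finset ℝ) (σ : ℝ), 0 < σ → σ ≤ 1 →
    (∀ x ∈ F, ∀ y ∈ F, x ≠ y → σ < |x - y|) → ∀ y : ℝ,
    σ * ∑ x ∈ F, Real.exp (-(x - y) ^ 2 / 2) ≤ C := by
  have hint0 : Integrable fun t : ℝ => Real.exp (1 / 4) * Real.exp (-(1 / 4) * t ^ 2) :=
    (integrable_exp_neg_mul_sq (by norm_num)).const_mul _
  have hpos : 0 < ∫ t : ℝ, Real.exp (1 / 4) * Real.exp (-(1 / 4) * t ^ 2) := by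
    rw [integral_const_mul, integral_gaussian]
    positivity
  refine ⟨_, hpos, fun F σ hσ hσ1 hF y => ?_⟩
  have hint := hint0.comp_sub_right y
  rw [← integral_sub_right_eq_self _ y, Finset.mul_sum]
  have hdisj : (F : Set ℝ).PairwiseDisjoint fun x => Set.Ioc (x - σ / 2) (x + σ / 2) := by
    intro x hx x' hx' hne
    refine Set.disjoint_left.2 fun t ht ht' => ?_
    refine absurd (hF x hx x' hx' hne) (not_lt.2 (abs_le.2 ⟨?_, ?_⟩)) <;>
      linarith [ht.1, ht.2, ht'.1, ht'.2]
  calc _ ≤ ∑ x ∈ F, ∫ t in Set.Ioc (x - σ / 2) (x + σ / 2),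
        Real.exp (1 / 4) * Real.exp (-(1 / 4) * (t - y) ^ 2) := by
        refine Finset.sum_le_sum fun x _ => ?_
        have h1 : ∫ t in Set.Ioc (x - σ / 2) (x + σ / 2), Real.exp (-(x - y) ^ 2 / 2) =
            σ * Real.exp (-(x - y) ^ 2 / 2) := by
          rw [setIntegral_const, Real.volume_real_Ioc_of_le (by linarith), smul_eq_mul]
          ring
        rw [← h1]
        refine setIntegral_mono_on (integrable_const _) hint.integrableOn measurableSet_Ioc
          fun t ht => ?_
        rw [← Real.exp_add, Real.exp_le_exp]
        have h2 : |t - x| ≤ 1 / 2 := abs_le.2 ⟨by linarith [ht.1], by linarith [ht.2]⟩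
        have h3 := sq_le_sq' (abs_le.1 h2).1 (abs_le.1 h2).2
        nlinarith [sq_nonneg ((t - x) - (x - y))]
    _ = ∫ t in ⋃ x ∈ F, Set.Ioc (x - σ / 2) (x + σ / 2),
        Real.exp (1 / 4) * Real.exp (-(1 / 4) * (t - y) ^ 2) :=
        (integral_biUnion_finset F (fun _ _ => measurableSet_Ioc) hdisj
          fun _ _ => hint.integrableOn).symm
    _ ≤ _ := setIntegral_le_integral hint (ae_of_all _ fun t => by positivity)

theorem integral_cos_gaussianReal (y : ℝ) :
    ∫ ξ, Real.cos (y * ξ) ∂ProbabilityTheory.gaussianReal 0 1 = Real.exp (-y ^ 2 / 2) := by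
  rw [← re_charFun, ProbabilityTheory.charFun_gaussianReal]
  have : (y * (0 : ℝ) * Complex.I - (1 : NNReal) * y ^ 2 / 2 : ℂ) = ((-y ^ 2 / 2 : ℝ) : ℂ) := by
    push_cast
    simp
    ring
  rw [this, Complex.exp_ofReal_re]

theorem sq_sum_cos (F : Finset ℝ) (ξ : ℝ) :
    (∑ x ∈ F, Real.cos (x * ξ)) ^ 2 =
      ∑ x ∈ F, ∑ y ∈ F, (Real.cos ((x - y) * ξ) + Real.cos ((x - -y) * ξ)) / 2 := by
  rw [sq, Finset.sum_mul_sum]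
  refine Finset.sum_congr rfl fun x _ => Finset.sum_congr rfl fun y _ => ?_
  rw [sub_neg_eq_add, sub_mul, add_mul, Real.cos_sub, Real.cos_add]
  ring

theorem integral_sq_sum_cos_gaussianReal (F : Finset ℝ) :
    ∫ ξ, (∑ x ∈ F, Real.cos (x * ξ)) ^ 2 ∂ProbabilityTheory.gaussianReal 0 1 =
      ∑ x ∈ F, ∑ y ∈ F, (Real.exp (-(x - y) ^ 2 / 2) + Real.exp (-(x - -y) ^ 2 / 2)) / 2 := by
  have hint (y : ℝ) : Integrable (fun ξ => Real.cos (y * ξ))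
      (ProbabilityTheory.gaussianReal 0 1) :=
    Integrable.of_bound (by fun_prop) 1 (ae_of_all _ fun ξ => Real.abs_cos_le_one _)
  have hint2 (x y : ℝ) : Integrable
      (fun ξ => (Real.cos ((x - y) * ξ) + Real.cos ((x - -y) * ξ)) / 2)
      (ProbabilityTheory.gaussianReal 0 1) := ((hint _).add (hint _)).div_const 2
  simp only [sq_sum_cos]
  rw [integral_finsetSum _ fun x _ => integrable_finsetSum _ fun y _ => hint2 x y]
  refine Finset.sum_congr rfl fun x _ => ?_
  rw [integral_finsetSum _ fun y _ => hint2 x y]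
  refine Finset.sum_congr rfl fun y _ => ?_
  rw [integral_div, integral_add (hint _) (hint _), integral_cos_gaussianReal,
    integral_cos_gaussianReal]

theorem exists_setIntegral_le_integral_gaussianReal : ∃ C : ℝ, 0 < C ∧ ∀ (f : ℝ → ℝ),
    Continuous f → (∀ ξ, 0 ≤ f ξ) → Integrable f (ProbabilityTheory.gaussianReal 0 1) →
    ∀ T ⊆ Set.Ioc (0 : ℝ) 1, MeasurableSet T →
    ∫ ξ in T, f ξ ≤ C * ∫ ξ, f ξ ∂ProbabilityTheory.gaussianReal 0 1 := by
  refine ⟨√(2 * Real.pi) * Real.exp (1 / 2), by positivity, fun f hf hf0 hint T hT hTm => ?_⟩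
  have hint' : Integrable fun ξ => ProbabilityTheory.gaussianPDFReal 0 1 ξ * f ξ := by
    rw [ProbabilityTheory.gaussianReal_of_var_ne_zero 0 one_ne_zero] at hint
    have := (integrable_withDensity_iff_integrable_smul₀'
      (ProbabilityTheory.measurable_gaussianPDF 0 1).aemeasurable (ae_of_all _ fun x =>
        ProbabilityTheory.gaussianPDF_lt_top)).1 hint
    simpa only [ProbabilityTheory.toReal_gaussianPDF, smul_eq_mul] using this
  rw [ProbabilityTheory.integral_gaussianReal_eq_integral_smul one_ne_zero, ← integral_const_mul]
  simp only [smul_eq_mul]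
  have hfi : IntegrableOn f T := (hf.integrableOn_Icc.mono_set
    (hT.trans Set.Ioc_subset_Icc_self))
  refine le_trans ?_ (setIntegral_le_integral (s := T) (hint'.const_mul _)
    (ae_of_all _ fun ξ => ?_))
  · refine setIntegral_mono_on hfi (hint'.const_mul _).integrableOn hTm fun ξ hξ => ?_
    have h1 : 1 ≤ √(2 * Real.pi) * Real.exp (1 / 2) *
        ProbabilityTheory.gaussianPDFReal 0 1 ξ := by
      rw [ProbabilityTheory.gaussianPDFReal]
      have h2 : √(2 * Real.pi) * (√(2 * Real.pi))⁻¹ = 1 :=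
        mul_inv_cancel₀ (by positivity)
      have h3 : 1 ≤ Real.exp (1 / 2) * Real.exp (-ξ ^ 2 / 2) := by
        rw [← Real.exp_add, Real.one_le_exp_iff]
        nlinarith [(hT hξ).1, (hT hξ).2]
      simp only [NNReal.coe_one, mul_one, sub_zero]
      calc (1 : ℝ) ≤ _ := h3
        _ = _ := by linear_combination (-Real.exp (1 / 2) * Real.exp (-ξ ^ 2 / 2)) * h2
    nlinarith [hf0 ξ]
  · have := ProbabilityTheory.gaussianPDFReal_nonneg 0 1 ξ
    have := hf0 ξ
    simp only [Pi.zero_apply]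
    positivity

theorem sq_setIntegral_le (T : Set ℝ) (hT : volume T ≠ ⊤) {f : ℝ → ℝ}
    (hf : IntegrableOn f T) (hf2 : IntegrableOn (fun ξ => f ξ ^ 2) T) :
    (∫ ξ in T, f ξ) ^ 2 ≤ volume.real T * ∫ ξ in T, f ξ ^ 2 := by
  have : IsFiniteMeasure (volume.restrict T) := isFiniteMeasure_restrict.2 hT
  set I := ∫ ξ in T, f ξ with hI
  set t := volume.real T with ht
  have h0 : 0 ≤ ∫ ξ in T, (t * f ξ - I) ^ 2 := integral_nonneg fun ξ => sq_nonneg _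
  have h1 : ∫ ξ in T, (t * f ξ - I) ^ 2 = t * (t * ∫ ξ in T, f ξ ^ 2) - t * I ^ 2 := by
    have : ∀ ξ, (t * f ξ - I) ^ 2 = t ^ 2 * f ξ ^ 2 - 2 * t * I * f ξ + I ^ 2 := fun ξ => by ring
    simp only [this]
    have e₁ : Integrable (fun ξ => t ^ 2 * f ξ ^ 2) (volume.restrict T) := hf2.const_mul _
    have e₂ : Integrable (fun ξ => 2 * t * I * f ξ) (volume.restrict T) := hf.const_mul _
    have e₃ : Integrable (fun ξ => t ^ 2 * f ξ ^ 2 - 2 * t * I * f ξ) (volume.restrict T) :=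
      e₁.sub e₂
    rw [integral_add e₃ (integrable_const _), integral_sub e₁ e₂, integral_const_mul,
      integral_const_mul, setIntegral_const, smul_eq_mul, ← hI, ← ht]
    ring
  rcases (measureReal_nonneg : 0 ≤ volume.real T).eq_or_lt with h | h
  · have : volume.restrict T = 0 := by
      rw [Measure.restrict_eq_zero]
      exact (measureReal_eq_zero_iff hT).1 h.symm
    simp [hI, ht, this]
  · rw [h1] at h0
    nlinarith

theorem exists_card_mul_le_of_large_integral_cos : ∃ C : ℝ, 0 < C ∧
    ∀ T ⊆ Set.Ioc (0 : ℝ) 1, MeasurableSet T →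
    ∀ (F : Finset ℝ) (σ : ℝ), 0 < σ → σ ≤ 1 →
    (∀ x ∈ F, ∀ y ∈ F, x ≠ y → σ < |x - y|) →
    (∀ x ∈ F, ∫ ξ in T, (1 - Real.cos (ξ * x)) ≤ volume.real T / 8) →
    F.card * σ * volume.real T ≤ C := by
  obtain ⟨C₁, hC₁, h₁⟩ := exists_sum_exp_neg_sq_le
  obtain ⟨C₂, hC₂, h₂⟩ := exists_setIntegral_le_integral_gaussianReal
  refine ⟨2 * C₁ * C₂, by positivity, fun T hT hTm F σ hσ hσ1 hF hcos => ?_⟩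
  have hTt : volume T ≠ ⊤ := (measure_mono hT |>.trans_lt measure_Ioc_lt_top).ne
  have : IsFiniteMeasure (volume.restrict T) := isFiniteMeasure_restrict.2 hTt
  set t := volume.real T with ht
  set f : ℝ → ℝ := fun ξ => ∑ x ∈ F, Real.cos (x * ξ) with hf
  have hfc : Continuous f := by fun_prop
  have hfi : IntegrableOn f T := hfc.integrableOn_Icc.mono_set (hT.trans Set.Ioc_subset_Icc_self)
  have hfi2 : IntegrableOn (fun ξ => f ξ ^ 2) T :=
    (hfc.pow 2).integrableOn_Icc.mono_set (hT.trans Set.Ioc_subset_Icc_self)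
  have hint (x : ℝ) : Integrable (fun ξ => Real.cos (x * ξ)) (volume.restrict T) :=
    Integrable.of_bound (by fun_prop) 1 (ae_of_all _ fun ξ => Real.abs_cos_le_one _)
  have hlow : F.card * (7 / 8 * t) ≤ ∫ ξ in T, f ξ := by
    rw [integral_finsetSum _ fun x _ => hint x, ← nsmul_eq_mul]
    refine Finset.card_nsmul_le_sum _ _ _ fun x hx => ?_
    have := hcos x hx
    simp only [mul_comm _ x] at this
    rw [integral_sub (integrable_const _) (hint x), setIntegral_const] at this
    simp only [smul_eq_mul, mul_one, ← ht] at this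
    linarith
  have hgauss : σ * ∫ ξ, f ξ ^ 2 ∂ProbabilityTheory.gaussianReal 0 1 ≤ F.card * C₁ := by
    rw [integral_sq_sum_cos_gaussianReal, Finset.mul_sum, ← nsmul_eq_mul]
    refine Finset.sum_le_card_nsmul _ _ _ fun x _ => ?_
    rw [← Finset.sum_div, Finset.sum_add_distrib]
    have e₁ := h₁ F σ hσ hσ1 hF x
    have e₂ := h₁ F σ hσ hσ1 hF (-x)
    have e₃ : ∑ y ∈ F, Real.exp (-(x - y) ^ 2 / 2) = ∑ y ∈ F, Real.exp (-(y - x) ^ 2 / 2) :=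
      Finset.sum_congr rfl fun y _ => by ring_nf
    have e₄ : ∑ y ∈ F, Real.exp (-(x - -y) ^ 2 / 2) = ∑ y ∈ F, Real.exp (-(y - -x) ^ 2 / 2) :=
      Finset.sum_congr rfl fun y _ => by ring_nf
    rw [e₃, e₄]
    linarith
  have hbd : Integrable (fun ξ => f ξ ^ 2) (ProbabilityTheory.gaussianReal 0 1) := by
    refine Integrable.of_bound (by fun_prop) ((F.card : ℝ) ^ 2) (ae_of_all _ fun ξ => ?_)
    rw [norm_pow]
    refine pow_le_pow_left₀ (norm_nonneg _) ?_ 2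
    refine (norm_sum_le_of_le F fun x _ =>
      (Real.abs_cos_le_one _ : ‖Real.cos (x * ξ)‖ ≤ 1)).trans ?_
    simp
  have hup := h₂ (fun ξ => f ξ ^ 2) (by fun_prop) (fun ξ => sq_nonneg _) hbd T hT hTm
  have hcs := sq_setIntegral_le T hTt hfi hfi2
  have ht0 : 0 ≤ t := measureReal_nonneg
  rcases ht0.eq_or_lt with h | h
  · rw [← h, mul_zero]
    positivity
  rcases F.card.cast_nonneg (α := ℝ) |>.eq_or_lt with h' | h'
  · rw [← h', zero_mul, zero_mul]
    positivity
  have key : σ * (F.card * (7 / 8 * t)) ^ 2 ≤ t * (C₂ * (F.card * C₁)) := by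
    calc _ ≤ σ * (∫ ξ in T, f ξ) ^ 2 := by gcongr
      _ ≤ σ * (t * (C₂ * ∫ ξ, f ξ ^ 2 ∂ProbabilityTheory.gaussianReal 0 1)) := by
          gcongr
          exact hcs.trans (by gcongr)
      _ = t * (C₂ * (σ * ∫ ξ, f ξ ^ 2 ∂ProbabilityTheory.gaussianReal 0 1)) := by ring
      _ ≤ _ := by gcongr
  have : (t * F.card) * (F.card * σ * t * (49 / 64)) ≤ (t * F.card) * (C₁ * C₂) := by
    calc _ = σ * (F.card * (7 / 8 * t)) ^ 2 := by ring
      _ ≤ _ := key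
      _ = _ := by ring
  have := le_of_mul_le_mul_left this (by positivity)
  have : 0 ≤ C₁ * C₂ := by positivity
  linarith

end largeSieve

section smallBall

theorem mul_mem_boundedSums_mul {ι : Type*} [Fintype ι] {a : ι → ℝ} {N : ℤ} {x : ℝ}
    (hx : x ∈ boundedSums a N) (w : ℝ) : w * x ∈ boundedSums (fun i => w * a i) N := by
  obtain ⟨c, hc, rfl⟩ := hx
  refine ⟨c, hc, ?_⟩
  rw [Finset.mul_sum]
  exact Finset.sum_congr rfl fun i _ => by ring

theorem concFn_map_sum_mul_le {ι : Type*} [Fintype ι] (μ : Measure ℝ) [IsProbabilityMeasure μ]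
    (a : ι → ℝ) {τ : ℝ} (hτ : 0 < τ) :
    concFn ((Measure.pi fun _ : ι => μ).map fun x => ∑ k, x k * a k) τ ≤
      16 / 7 * ∫ ξ in (0 : ℝ)..1, Real.exp (-symDefect μ (fun k => a k / τ) ξ / 2) := by
  have hm (b : ι → ℝ) : Measurable fun x : ι → ℝ => ∑ k, x k * b k := by fun_prop
  have hp : IsProbabilityMeasure
      ((Measure.pi fun _ : ι => μ).map fun x => ∑ k, x k * (a k / τ)) :=
    Measure.isProbabilityMeasure_map (hm _).aemeasurable
  refine ciSup_le fun x => ?_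
  have h1 : ((Measure.pi fun _ : ι => μ).map fun x => ∑ k, x k * a k)
      (Metric.closedBall x (τ / 2)) =
      ((Measure.pi fun _ : ι => μ).map fun x => ∑ k, x k * (a k / τ))
      (Metric.closedBall (x / τ) (1 / 2)) := by
    rw [Measure.map_apply (hm a) measurableSet_closedBall,
      Measure.map_apply (hm _) measurableSet_closedBall]
    congr 1
    ext y
    have h2 : ∑ k, y k * (a k / τ) = (∑ k, y k * a k) / τ := by
      rw [Finset.sum_div]
      exact Finset.sum_congr rfl fun k _ => by ring
    simp only [Set.mem_preimage, Metric.mem_closedBall, Real.dist_eq]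
    rw [h2, ← sub_div, abs_div, abs_of_pos hτ, div_le_iff₀ hτ, one_div_mul_eq_div]
  rw [h1]
  refine (measureReal_closedBall_le_integral_norm_charFun _ _).trans ?_
  refine mul_le_mul_of_nonneg_left ?_ (by norm_num)
  refine intervalIntegral.integral_mono_on zero_le_one intervalIntegrable_charFun.norm ?_
    fun ξ _ => norm_charFun_map_sum_mul_le μ _ ξ
  have hmeas := measurable_symDefect μ fun k => a k / τ
  rw [intervalIntegrable_iff, Set.uIoc_of_le zero_le_one]
  refine Integrable.of_bound (by fun_prop) 1 (ae_of_all _ fun ξ => ?_)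
  rw [Real.norm_eq_abs, Real.abs_exp, Real.exp_le_one_iff]
  linarith [symDefect_nonneg μ (fun k => a k / τ) ξ]

theorem exists_packing_bound : ∃ C : ℝ, 0 < C ∧
    ∀ (n : ℕ) (μ : Measure ℝ) [IsProbabilityMeasure μ], 0 < pOf μ 1 →
    ∀ (a : Fin n → ℝ) (τ : ℝ), 0 < τ → ∀ q : ℝ, 0 < q →
    q ≤ concFn ((Measure.pi fun _ : Fin n => μ).map fun x => ∑ k, x k * a k) τ →
    ∀ n' : ℝ, 0 < n' →
    ∃ (m : ℕ) (I : Finset (Fin n)), 1 ≤ m ∧ n - n' ≤ I.card ∧ q * Real.exp (m / 4) ≤ C ∧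
    ∀ k : ℕ, 8 * m * k ^ 2 ≤ pOf μ 1 * n' → ∀ σ : ℝ, 0 < σ → σ ≤ 1 → ∀ F : Finset ℝ,
    (∀ x ∈ F, x ∈ boundedSums (fun i : I => a i) k) →
    (∀ x ∈ F, ∀ y ∈ F, x ≠ y → σ * τ < |x - y|) →
    F.card * σ * (q * Real.exp (m / 4)) ≤ C := by
  obtain ⟨C, hC, hsieve⟩ := exists_card_mul_le_of_large_integral_cos
  refine ⟨20 + 20 * C, by positivity, fun n μ _ hp a τ hτ q hq hqle n' hn' => ?_⟩
  set b : Fin n → ℝ := fun k => a k / τ with hb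
  obtain ⟨m, hm1, hm⟩ := exists_measureReal_level_ge (measurable_symDefect μ b)
    (symDefect_nonneg μ b) (M := 2 * n) (fun ξ => by simpa using symDefect_le μ b ξ) hq
    (hqle.trans (concFn_map_sum_mul_le μ a hτ))
  set T : Set ℝ := {ξ ∈ Set.Ioc (0 : ℝ) 1 | symDefect μ b ξ ≤ m} with hT
  have hTsub : T ⊆ Set.Ioc 0 1 := fun ξ hξ => hξ.1
  have hTm : MeasurableSet T := measurableSet_Ioc.inter (measurable_symDefect μ b measurableSet_Iic)
  have ht : 0 < volume.real T := lt_of_lt_of_le (by positivity) hm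
  have ht1 : volume.real T ≤ 1 := by
    refine (measureReal_mono hTsub measure_Ioc_lt_top.ne).trans ?_
    simp
  obtain ⟨z, hz, hsum⟩ := exists_sum_integral_one_sub_cos_le μ hp b hTm hTsub fun ξ hξ => hξ.2
  have hm0 : (0 : ℝ) < m := by exact_mod_cast hm1
  set κ : ℝ := m * volume.real T / (pOf μ 1 * n') with hκ
  have hκ0 : 0 < κ := by positivity
  set ω : Fin n → ℝ := fun k => ∫ ξ in T, (1 - Real.cos (ξ * (z * b k))) with hω
  have hω0 (k : Fin n) : 0 ≤ ω k :=
    integral_nonneg fun ξ => by simpa using Real.cos_le_one _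
  refine ⟨m, Finset.univ.filter fun k => ω k ≤ κ, hm1, ?_, by linarith,
    fun k hk σ hσ hσ1 F hFk hFσ => ?_⟩
  · have h1 : ((Finset.univ.filter fun k => ¬ω k ≤ κ).card : ℝ) * κ ≤ ∑ k, ω k := by
      rw [← nsmul_eq_mul]
      refine (Finset.card_nsmul_le_sum _ ω κ fun k hk => ?_).trans
        (Finset.sum_le_univ_sum_of_nonneg hω0)
      exact (not_le.1 (Finset.mem_filter.1 hk).2).le
    have h2 : ∑ k, ω k ≤ n' * κ := by
      have h3 : pOf μ 1 * (n' * κ) = m * volume.real T := by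
        rw [hκ]
        field_simp
      exact le_of_mul_le_mul_left (hsum.trans h3.ge) hp
    have h4 := le_of_mul_le_mul_right (h1.trans h2) hκ0
    have h5 := Finset.card_filter_add_card_filter_not (s := Finset.univ) fun k => ω k ≤ κ
    rw [Finset.card_univ, Fintype.card_fin] at h5
    have h6 : ((Finset.univ.filter fun k => ω k ≤ κ).card : ℝ) +
        (Finset.univ.filter fun k => ¬ω k ≤ κ).card = n := by exact_mod_cast h5
    linarith
  · have hz0 : z ≠ 0 := by
      rintro rfl
      norm_num at hz
    have hw : z / τ ≠ 0 := div_ne_zero hz0 hτ.ne'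
    have hcard : (F.image (z / τ * ·)).card = F.card :=
      Finset.card_image_of_injective _ (mul_right_injective₀ hw)
    have h1 := hsieve T hTsub hTm (F.image (z / τ * ·)) σ hσ hσ1 ?_ ?_
    · rw [hcard] at h1
      have h2 : F.card * σ * (q * Real.exp (m / 4) / 20) ≤ F.card * σ * volume.real T := by gcongr
      linarith
    · simp only [Finset.mem_image]
      rintro _ ⟨x, hx, rfl⟩ _ ⟨y, hy, rfl⟩ hne
      rw [← mul_sub, abs_mul, abs_div, abs_of_pos hτ]
      have h3 := hFσ x hx y hy fun h => hne (by rw [h])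
      have h4 : σ < |x - y| / τ := by rwa [lt_div_iff₀ hτ]
      calc σ < |x - y| / τ := h4
        _ ≤ |z| * (|x - y| / τ) := le_mul_of_one_le_left (by positivity) hz.le
        _ = _ := by ring
    · simp only [Finset.mem_image]
      rintro _ ⟨x, hx, rfl⟩
      have h5 := mul_mem_boundedSums_mul (hFk x hx) (z / τ)
      refine (integral_one_sub_cos_le_of_mem_boundedSums hTsub hκ0.le (fun i => ?_) h5).trans ?_
      · have h6 := (Finset.mem_filter.1 i.2).2
        simp only [hω, hb] at h6
        rwa [div_mul_eq_mul_div, ← mul_div_assoc']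
      · rw [hκ, mul_div_assoc', div_le_div_iff₀ (by positivity) (by norm_num)]
        nlinarith

end smallBall

section assembly

theorem exists_isCGAP_of_mem {n : ℕ} (a : Fin n → ℝ) :
    ∃ (m : ℕ) (K : Set ℝ), IsCGAP n m K ∧ (∀ i, a i ∈ K) ∧ Nat.card K ≤ 3 ^ n := by
  set V : Set (Fin n → ℝ) := {v | ∀ i, |v i| ≤ 1} with hV
  have hset : {ν : Fin n → ℤ | (fun j => (ν j : ℝ)) ∈ V} =
      (Finset.Icc (fun _ => -1) (fun _ => 1) : Finset (Fin n → ℤ)) := by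
    ext ν
    simp only [hV, Set.mem_ofPred_eq, Finset.coe_Icc, Set.mem_Icc, Pi.le_def, ← forall_and]
    refine forall_congr' fun i => ?_
    rw [← abs_le]
    exact_mod_cast Iff.rfl
  have hcard : (Finset.Icc (fun _ => -1) (fun _ => 1) : Finset (Fin n → ℤ)).card = 3 ^ n := by
    simp [Pi.card_Icc]
  have hfin : {ν : Fin n → ℤ | (fun j => (ν j : ℝ)) ∈ V}.Finite := by
    rw [hset]
    exact Finset.finite_toSet _
  refine ⟨_, _, ⟨a, V, ?_, ?_, hfin, le_rfl, rfl⟩, fun i => ?_, ?_⟩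
  · intro v hv i
    simpa using hv i
  · intro v hv w hw s t hs ht hst i
    simp only [Pi.add_apply, Pi.smul_apply, smul_eq_mul]
    refine (abs_add_le _ _).trans ?_
    rw [abs_mul, abs_mul, abs_of_nonneg hs, abs_of_nonneg ht]
    nlinarith [hv i, hw i]
  · refine ⟨Pi.single i 1, fun j => ?_, ?_⟩
    · rcases eq_or_ne j i with rfl | h <;> simp [*]
    · rw [Finset.sum_eq_single i] <;> simp +contextual
  · have himg : {x : ℝ | ∃ ν : Fin n → ℤ, (fun j => (ν j : ℝ)) ∈ V ∧ x = ∑ j, (ν j : ℝ) * a j} =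
        (fun ν : Fin n → ℤ => ∑ j, (ν j : ℝ) * a j) ''
          {ν : Fin n → ℤ | (fun j => (ν j : ℝ)) ∈ V} := by
      ext x
      simp only [Set.mem_ofPred_eq, Set.mem_image, eq_comm]
    rw [himg, Nat.card_coe_set_eq, ← hcard]
    refine (Set.ncard_image_le hfin).trans ?_
    rw [hset, Set.ncard_coe_finset]

theorem finite_boundedSums {ι : Type*} [Fintype ι] (a : ι → ℝ) (N : ℤ) :
    (boundedSums a N).Finite := by
  classical
  refine ((Finset.finite_toSet (Finset.Icc (fun _ : ι => -N) fun _ => N)).image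
    fun c : ι → ℤ => ∑ i, (c i : ℝ) * a i).subset ?_
  rintro _ ⟨c, hc, rfl⟩
  refine ⟨c, ?_, rfl⟩
  have h (i : ι) : |c i| ≤ N :=
    (Finset.single_le_sum (fun j _ => abs_nonneg (c j)) (Finset.mem_univ i)).trans hc
  simp only [Finset.coe_Icc, Set.mem_Icc, Pi.le_def, ← forall_and]
  exact fun i => abs_le.1 (h i)

theorem exists_pos_scale {S : Set ℝ} (hS : S.Finite) {τ : ℝ} (hτ : 0 ≤ τ) :
    ∃ τ' : ℝ, 0 < τ' ∧ τ ≤ τ' ∧ ∀ x ∈ S, ∀ y ∈ S, ∀ s : ℝ, s ≤ 1 →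
      s * τ < |x - y| → s * τ' < |x - y| := by
  rcases hτ.eq_or_lt with rfl | h
  · have h1 : ∀ᶠ η : ℝ in nhdsWithin 0 (Set.Ioi 0), ∀ z ∈ (S ×ˢ S).image fun z => |z.1 - z.2|,
        0 < z → η < z := by
      refine (Filter.eventually_all_finite ((hS.prod hS).image _)).2 fun z _ => ?_
      by_cases hz : 0 < z
      · filter_upwards [Ioo_mem_nhdsGT hz] with η hη _ using hη.2
      · exact Filter.Eventually.of_forall fun η h => absurd h hz
    obtain ⟨η, hη, hη0⟩ := (h1.and self_mem_nhdsWithin).exists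
    refine ⟨η, hη0, hη0.le, fun x hx y hy s hs hxy => ?_⟩
    rw [mul_zero] at hxy
    have h2 := hη _ ⟨(x, y), ⟨hx, hy⟩, rfl⟩ hxy
    exact (mul_le_of_le_one_left hη0.le hs).trans_lt h2
  · exact ⟨τ, h, le_rfl, fun _ _ _ _ _ _ h => h⟩

theorem bddAbove_range_measure_closedBall {E : Type*} [MeasurableSpace E] [PseudoMetricSpace E]
    (ν : Measure E) [IsProbabilityMeasure ν] (τ : ℝ) :
    BddAbove (Set.range fun x : E => (ν (Metric.closedBall x (τ / 2))).toReal) :=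
  ⟨1, by rintro _ ⟨x, rfl⟩; exact measureReal_le_one⟩

theorem concFn_mono {E : Type*} [MeasurableSpace E] [PseudoMetricSpace E]
    (ν : Measure E) [IsProbabilityMeasure ν] {τ τ' : ℝ} (h : τ ≤ τ') :
    concFn ν τ ≤ concFn ν τ' :=
  ciSup_mono (bddAbove_range_measure_closedBall ν τ') fun x =>
    measureReal_mono (Metric.closedBall_subset_closedBall (by linarith))

theorem concFn_le_one {E : Type*} [MeasurableSpace E] [PseudoMetricSpace E] [Nonempty E]
    (ν : Measure E) [IsProbabilityMeasure ν] (τ : ℝ) : concFn ν τ ≤ 1 :=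
  ciSup_le fun _ => measureReal_le_one

theorem sqrt_le_exp_div_four {x : ℝ} (hx : 0 ≤ x) : √x ≤ Real.exp (x / 4) := by
  have h1 := Real.add_one_le_exp (x / 4)
  have h2 := Real.sq_sqrt hx
  nlinarith [sq_nonneg (√x - 2)]

theorem inv_floor_sqrt_le {x : ℝ} (hx : 0 < x) (h : 1 ≤ ⌊√x⌋₊) : (⌊√x⌋₊ : ℝ)⁻¹ ≤ 2 * (√x)⁻¹ := by
  have h1 := Nat.lt_floor_add_one √x
  have h2 : (1 : ℝ) ≤ ⌊√x⌋₊ := by exact_mod_cast h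
  have h3 := Real.sqrt_pos.2 hx
  rw [← div_eq_mul_inv, inv_le_comm₀ (by linarith) (by positivity), inv_div]
  linarith

end assembly

section oneDim

open Filter in
theorem eventually_le_mul_rpow_of_exp_le (C A c s : ℝ) (hC : 0 < C) (hc : 0 < c) (hs : 0 < s) :
    ∀ᶠ n : ℕ in atTop, ∀ y : ℝ, Real.exp y ≤ C * (n : ℝ) ^ A → y ≤ c * (n : ℝ) ^ s := by
  have h1 : (fun x : ℝ => Real.log C + A * Real.log x) =o[atTop] fun x => x ^ s := by
    refine Asymptotics.IsLittleO.add ?_ ((isLittleO_log_rpow_atTop hs).const_mul_left A)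
    rw [Asymptotics.isLittleO_const_left]
    exact Or.inr (tendsto_norm_atTop_atTop.comp (tendsto_rpow_atTop hs))
  have h2 := tendsto_natCast_atTop_atTop.eventually (h1.def hc)
  filter_upwards [h2, eventually_ge_atTop 1] with n hn hn1 y hy
  have hn0 : (0 : ℝ) < n := by exact_mod_cast hn1
  have h3 := (Real.le_log_iff_exp_le (by positivity)).2 hy
  rw [Real.log_mul hC.ne' (by positivity), Real.log_rpow hn0] at h3
  rw [Real.norm_eq_abs, Real.norm_eq_abs, abs_of_nonneg (by positivity : (0 : ℝ) ≤ n ^ s)] at hn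
  exact h3.trans ((le_abs_self _).trans hn)

open Filter in
theorem exists_isCGAP_of_le_concFn (ε θ A B p : ℝ) (hε : 0 < ε) (hθ : 0 < θ) (hp : 0 < p) :
    ∃ (R : ℕ) (C : ℝ), 0 < C ∧
      ∀ (n : ℕ) (μ : Measure ℝ) [IsProbabilityMeasure μ], pOf μ 1 = p →
      ∀ (a : Fin n → ℝ) (τ : ℝ), 0 ≤ τ → ∀ q : ℝ,
      q = concFn ((Measure.pi fun _ : Fin n => μ).map fun x => ∑ k, x k * a k) τ →
      (n : ℝ) ^ (-A) ≤ q → ∀ ρ : ℝ, (n : ℝ) ^ (-B) ≤ ρ → ρ ≤ 1 →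
      ∀ n' : ℝ, ε * (n : ℝ) ^ θ ≤ n' → n' ≤ n →
      ∃ (r m : ℕ) (K : Set ℝ) (I : Finset (Fin n)), IsCGAP r m K ∧ r ≤ R ∧ n - n' ≤ I.card ∧
        (∀ i ∈ I, ∃ y ∈ K, |a i - y| ≤ τ * ρ) ∧
        (Nat.card K : ℝ) ≤ max (C * q⁻¹ * ρ⁻¹ * n' ^ (-(1 : ℝ) / 2)) 1 := by
  obtain ⟨C₁, hC₁, hpack⟩ := exists_packing_bound
  set γ : ℕ := ⌈4 * (A + B + 1) / θ⌉₊ with hγ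
  obtain ⟨k₀, R, C₂, hC₂, hcgap⟩ := exists_isCGAP_of_packing γ
  have hlarge : ∀ᶠ n : ℕ in atTop, 1 ≤ n ∧ C₁ ≤ n ∧ (k₀ : ℝ) ≤ (n : ℝ) ^ (θ / 4) ∧
      ∀ y : ℝ, Real.exp y ≤ C₁ * (n : ℝ) ^ A → y ≤ p * ε / 128 * (n : ℝ) ^ (θ / 2) := by
    refine (eventually_ge_atTop 1).and ((tendsto_natCast_atTop_atTop.eventually_ge_atTop C₁).and
      ((((tendsto_rpow_atTop (by positivity)).comp
        tendsto_natCast_atTop_atTop).eventually_ge_atTop (k₀ : ℝ)).and ?_))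
    exact eventually_le_mul_rpow_of_exp_le C₁ A _ _ hC₁ (by positivity) (by positivity)
  obtain ⟨n₀, hn₀⟩ := eventually_atTop.1 hlarge
  refine ⟨max n₀ R, max (3 ^ n₀ * (n₀ + 1)) (C₂ * C₁ * 2 * √(8 / p)), by positivity, ?_⟩
  intro n μ _ hμ a τ hτ q hq hqA ρ hρB hρ1 n' hn'ε hn'n
  set ν := (Measure.pi fun _ : Fin n => μ).map fun x => ∑ k, x k * a k with hν
  have hm : Measurable fun x : Fin n → ℝ => ∑ k, x k * a k := by fun_prop
  have hνp : IsProbabilityMeasure ν := Measure.isProbabilityMeasure_map hm.aemeasurable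
  rcases lt_or_ge n n₀ with hlt | hge
  · obtain ⟨m, K, hK, haK, hcard⟩ := exists_isCGAP_of_mem a
    have hn'0 : 0 ≤ n' := le_trans (by positivity) hn'ε
    refine ⟨n, m, K, Finset.univ, hK, le_max_of_le_left hlt.le, by simpa, fun i _ =>
      ⟨a i, haK i, ?_⟩, ?_⟩
    · rw [sub_self, abs_zero]
      exact mul_nonneg hτ (le_trans (by positivity) hρB)
    rcases Nat.eq_zero_or_pos n with rfl | hn
    · refine le_max_of_le_right ?_
      exact_mod_cast hcard
    have hn0 : (0 : ℝ) < n := by exact_mod_cast hn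
    have hq0 : 0 < q := lt_of_lt_of_le (by positivity) hqA
    have hρ0 : 0 < ρ := lt_of_lt_of_le (by positivity) hρB
    have hn'1 : 0 < n' := lt_of_lt_of_le (by positivity) hn'ε
    have hq1 : 1 ≤ q⁻¹ := (one_le_inv₀ hq0).2 (hq ▸ concFn_le_one ν τ)
    have hρ2 : 1 ≤ ρ⁻¹ := (one_le_inv₀ hρ0).2 hρ1
    have hn'2 : ((n₀ : ℝ) + 1)⁻¹ ≤ n' ^ (-(1 : ℝ) / 2) := by
      have h1 : n' ≤ n₀ + 1 := hn'n.trans (by exact_mod_cast (hlt.le.trans n₀.le_succ))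
      calc ((n₀ : ℝ) + 1)⁻¹ = ((n₀ : ℝ) + 1) ^ (-1 : ℝ) := (Real.rpow_neg_one _).symm
        _ ≤ ((n₀ : ℝ) + 1) ^ (-(1 : ℝ) / 2) :=
            Real.rpow_le_rpow_of_exponent_le (by linarith [n₀.cast_nonneg (α := ℝ)]) (by norm_num)
        _ ≤ _ := Real.rpow_le_rpow_of_nonpos hn'1 h1 (by norm_num)
    refine le_max_of_le_left ?_
    calc (Nat.card K : ℝ) ≤ 3 ^ n := by exact_mod_cast hcard
      _ ≤ 3 ^ n₀ := pow_le_pow_right₀ (by norm_num) hlt.le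
      _ = 3 ^ n₀ * (n₀ + 1) * 1 * 1 * ((n₀ : ℝ) + 1)⁻¹ := by field_simp
      _ ≤ _ := by
          gcongr
          exact le_max_left _ _
  · obtain ⟨hn, hC₁n, hk₀n, hlog⟩ := hn₀ n hge
    have hn0 : (0 : ℝ) < n := by exact_mod_cast hn
    have hn1 : (1 : ℝ) ≤ n := by exact_mod_cast hn
    have hq0 : 0 < q := lt_of_lt_of_le (by positivity) hqA
    have hρ0 : 0 < ρ := lt_of_lt_of_le (by positivity) hρB
    have hn'0 : 0 < n' := lt_of_lt_of_le (by positivity) hn'ε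
    obtain ⟨τ', hτ'0, hττ', hsep⟩ := exists_pos_scale (finite_boundedSums a n) hτ
    obtain ⟨m, I, hm1, hI, hqm, hF⟩ := hpack n μ (hμ ▸ hp) a τ' hτ'0 q hq0
      (hq.trans_le (concFn_mono ν hττ')) n' hn'0
    rw [hμ] at hF
    have hm0 : (0 : ℝ) < m := by exact_mod_cast hm1
    set E := q * Real.exp (m / 4) with hE
    have hE0 : 0 < E := by positivity
    set w := p * n' / (8 * m) with hw
    have hw0 : 0 < w := by positivity
    set k := ⌊√w⌋₊ with hk
    have hkw : 8 * m * (k : ℝ) ^ 2 ≤ p * n' := by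
      have h1 : (k : ℝ) ^ 2 ≤ w := by
        rw [← Real.sq_sqrt hw0.le]
        gcongr
        exact Nat.floor_le (Real.sqrt_nonneg _)
      rwa [hw, le_div_iff₀' (by positivity)] at h1
    have hmle : (m : ℝ) / 4 ≤ p * ε / 128 * (n : ℝ) ^ (θ / 2) := by
      refine hlog _ ?_
      have h1 : (n : ℝ) ^ (-A) * Real.exp (m / 4) ≤ C₁ :=
        le_trans (mul_le_mul_of_nonneg_right hqA (Real.exp_pos _).le) hqm
      rw [Real.rpow_neg hn0.le, inv_mul_le_iff₀ (by positivity)] at h1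
      linarith
    have hkn : (n : ℝ) ^ (θ / 4) ≤ k := by
      have h1 : (2 * (n : ℝ) ^ (θ / 4)) ^ 2 ≤ w := by
        rw [hw, le_div_iff₀ (by positivity)]
        have h2 : (n : ℝ) ^ θ = (n : ℝ) ^ (θ / 2) * (n : ℝ) ^ (θ / 2) := by
          rw [← Real.rpow_add hn0]
          ring_nf
        have h3 : (n : ℝ) ^ (θ / 2) = (n : ℝ) ^ (θ / 4) * (n : ℝ) ^ (θ / 4) := by
          rw [← Real.rpow_add hn0]
          ring_nf
        calc _ = 128 * (n : ℝ) ^ (θ / 2) * (m / 4) := by rw [h3]; ring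
          _ ≤ 128 * (n : ℝ) ^ (θ / 2) * (p * ε / 128 * (n : ℝ) ^ (θ / 2)) := by gcongr
          _ = p * (ε * (n : ℝ) ^ θ) := by rw [h2]; ring
          _ ≤ p * n' := by gcongr
      have h2 := Real.le_sqrt_of_sq_le h1
      have h3 := Nat.lt_floor_add_one √w
      have h4 : 1 ≤ (n : ℝ) ^ (θ / 4) := Real.one_le_rpow hn1 (by positivity)
      linarith
    have hk1 : 1 ≤ k := by
      have h4 : 1 ≤ (n : ℝ) ^ (θ / 4) := Real.one_le_rpow hn1 (by positivity)
      exact_mod_cast h4.trans hkn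
    have hk₀k : k₀ ≤ k := by exact_mod_cast hk₀n.trans hkn
    have hp1 : p ≤ 1 := by
      have := isProbabilityMeasure_symG μ
      rw [← hμ]
      exact measureReal_le_one
    have hkn' : (k : ℤ) ≤ n := by
      have h1 : (k : ℝ) ≤ n := by
        have h2 : (1 : ℝ) ≤ k := by exact_mod_cast hk1
        have h3 : (1 : ℝ) ≤ m := by exact_mod_cast hm1
        calc (k : ℝ) ≤ 8 * m * (k : ℝ) ^ 2 := by nlinarith
          _ ≤ p * n' := hkw
          _ ≤ 1 * n := by gcongr
          _ = n := one_mul _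
      exact_mod_cast h1
    have hN : C₁ / (ρ * E) ≤ (k : ℝ) ^ γ := by
      have h1 : (n : ℝ) ^ (-A) ≤ E := by
        refine hqA.trans (le_mul_of_one_le_right hq0.le ?_)
        rw [Real.one_le_exp_iff]
        positivity
      have h2 : (n : ℝ) ^ (-B) * (n : ℝ) ^ (-A) ≤ ρ * E := by gcongr
      calc C₁ / (ρ * E) ≤ n / ((n : ℝ) ^ (-B) * (n : ℝ) ^ (-A)) := by gcongr
        _ = (n : ℝ) ^ (A + B + 1) := by
            rw [← Real.rpow_add hn0, div_eq_mul_inv, ← Real.rpow_neg hn0.le]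
            nth_rewrite 1 [← Real.rpow_one (n : ℝ)]
            rw [← Real.rpow_add hn0]
            ring_nf
        _ ≤ (n : ℝ) ^ (θ / 4 * γ) := by
            refine Real.rpow_le_rpow_of_exponent_le hn1 ?_
            have h3 := Nat.le_ceil (4 * (A + B + 1) / θ)
            rw [← hγ, div_le_iff₀ hθ] at h3
            linarith
        _ = ((n : ℝ) ^ (θ / 4)) ^ γ := by rw [Real.rpow_mul hn0.le, Real.rpow_natCast]
        _ ≤ _ := by gcongr
    have hsub : boundedSums (fun i : I => a i) k ⊆ boundedSums a n := by
      rintro _ ⟨c, hc, rfl⟩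
      exact boundedSums_mono (hc.trans hkn') (sum_mem_boundedSums _ c)
    obtain ⟨r, M, K, hK, hr, hclose, hcard⟩ := hcgap I (fun i => a i) (τ * ρ)
      (mul_nonneg hτ hρ0.le) k hk₀k (C₁ / (ρ * E)) hN fun σ hσ hσ1 F hFk hFσ => by
        have h1 := hF k hkw (σ * ρ) (by positivity) (mul_le_one₀ hσ1 hρ0.le hρ1) F hFk
          fun x hx y hy hxy => hsep x (hsub (hFk x hx)) y (hsub (hFk y hy)) _
            (mul_le_one₀ hσ1 hρ0.le hρ1) (by
              have := hFσ x hx y hy hxy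
              linarith)
        rw [le_div_iff₀ (by positivity)]
        linarith
    refine ⟨r, M, K, I, hK, le_max_of_le_right hr, hI, fun i hi => hclose ⟨i, hi⟩,
      hcard.trans (max_le_max_right 1 ?_)⟩
    have hkinv := inv_floor_sqrt_le hw0 hk1
    have hwinv : (√w)⁻¹ = √(8 / p) * √m * n' ^ (-(1 : ℝ) / 2) := by
      rw [neg_div, Real.rpow_neg hn'0.le, ← Real.sqrt_eq_rpow, ← Real.sqrt_inv, ← Real.sqrt_inv,
        ← Real.sqrt_mul (by positivity), ← Real.sqrt_mul (by positivity), hw]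
      congr 1
      field_simp
    have hsqrt := sqrt_le_exp_div_four hm0.le
    calc C₂ * (C₁ / (ρ * E) / k) = C₂ * C₁ * q⁻¹ * ρ⁻¹ * (Real.exp (m / 4))⁻¹ * (k : ℝ)⁻¹ := by
          rw [hE]
          field_simp
      _ ≤ C₂ * C₁ * q⁻¹ * ρ⁻¹ * (Real.exp (m / 4))⁻¹ *
          (2 * (√(8 / p) * Real.exp (m / 4) * n' ^ (-(1 : ℝ) / 2))) := by
          rw [hwinv] at hkinv
          have : (0 : ℝ) ≤ n' ^ (-(1 : ℝ) / 2) := by positivity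
          refine mul_le_mul_of_nonneg_left (hkinv.trans ?_) (by positivity)
          gcongr
      _ = C₂ * C₁ * 2 * √(8 / p) * q⁻¹ * ρ⁻¹ * n' ^ (-(1 : ℝ) / 2) := by field_simp
      _ ≤ _ := by
          gcongr
          exact le_max_right _ _

end oneDim

section coordinates

theorem FaCoord_eq {d : ℕ} (n : ℕ) (μ : Measure ℝ) (a : Fin n → EuclideanSpace ℝ (Fin d))
    (j : Fin d) :
    FaCoord n μ a j = (Measure.pi fun _ : Fin n => μ).map fun x => ∑ k, x k * a k j := by
  rw [FaCoord, Fa, Measure.map_map (by fun_prop) (by fun_prop)]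
  congr 1
  ext x
  simp

theorem card_sub_le_card_filter_forall_mem {ι κ : Type*} [Fintype ι] [Fintype κ] [DecidableEq ι]
    (I : κ → Finset ι) {s : ℝ} (hI : ∀ j, Fintype.card ι - s ≤ (I j).card) :
    Fintype.card ι - Fintype.card κ * s ≤ (Finset.univ.filter fun i => ∀ j, i ∈ I j).card := by
  have h1 : ((Finset.univ.filter fun i => ∀ j, i ∈ I j)ᶜ).card ≤ ∑ j, ((I j)ᶜ).card := by
    refine (Finset.card_le_card fun i hi => ?_).trans Finset.card_biUnion_le
    simpa using hi
  have h2 : ((∑ j, ((I j)ᶜ).card : ℕ) : ℝ) ≤ Fintype.card κ * s := by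
    push_cast
    rw [← Finset.card_univ, ← nsmul_eq_mul]
    refine Finset.sum_le_card_nsmul _ _ _ fun j _ => ?_
    rw [Finset.card_compl, Nat.cast_sub (Finset.card_le_univ _)]
    linarith [hI j]
  have h3 : (((Finset.univ.filter fun i => ∀ j, i ∈ I j)ᶜ).card : ℝ) ≤
      ((∑ j, ((I j)ᶜ).card : ℕ) : ℝ) := by exact_mod_cast h1
  rw [Finset.card_compl, Nat.cast_sub (Finset.card_le_univ _)] at h3
  linarith

theorem natCard_euclidean_pi {d : ℕ} (K : Fin d → Set ℝ) :
    Nat.card {x : EuclideanSpace ℝ (Fin d) | ∀ j, x j ∈ K j} = ∏ j, Nat.card (K j) := by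
  rw [← Nat.card_pi]
  exact Nat.card_congr
    { toFun := fun x j => ⟨x.1 j, x.2 j⟩
      invFun := fun f => ⟨WithLp.toLp 2 fun j => (f j : ℝ), fun j => (f j).2⟩
      left_inv := fun _ => rfl
      right_inv := fun _ => rfl }

end coordinates

theorem stmt5 (d : ℕ) (hd : 0 < d) (ε θ A B : ℝ)
    (hε : 0 < ε) (hε1 : ε ≤ 1) (hθ : 0 < θ) (hθ1 : θ ≤ 1) (hA : 0 < A) (hB : 0 < B)
    (p1 : ℝ) (hp1 : 0 < p1) :
    -- the constants depend only on `ε, θ, A, B, d` and `p(1)`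
    ∃ C : ℝ, 0 < C ∧
      ∀ (n : ℕ) (μ : Measure ℝ), ∀ _ : IsProbabilityMeasure μ,
      pOf μ 1 = p1 →
      ∀ (a : Fin n → EuclideanSpace ℝ (Fin d)) (τ : ℝ), 0 ≤ τ →
      -- `q_j = Q(F_a^{(j)}, τ) ≥ n^{-A}`
      (∀ j : Fin d, (n : ℝ) ^ (-A) ≤ concFn (FaCoord n μ a j) τ) →
      ∀ ρ : ℝ, (n : ℝ) ^ (-B) ≤ ρ → ρ ≤ 1 →
      ∀ n' : ℝ, ε * (n : ℝ) ^ θ ≤ n' → n' ≤ n →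
      -- there is a `d`-dimensional CGAP `K = K₁ × ⋯ × K_d`
      ∃ (r m : Fin d → ℕ) (Kj : Fin d → Set ℝ),
        (∀ j, IsCGAP (r j) (m j) (Kj j)) ∧
        -- rank `R = O(1)`
        ((∑ j, r j : ℕ) : ℝ) ≤ C ∧
        -- at least `n - d·n'` elements of `a` are `τ·ρ_n`-close to `K` in the sup-norm
        (n : ℝ) - d * n' ≤
          (Nat.card {k : Fin n | ∃ y : EuclideanSpace ℝ (Fin d),
            (∀ j, y j ∈ Kj j) ∧ ∀ j, |a k j - y j| ≤ τ * ρ} : ℝ) ∧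
        -- `|K| ≤ ∏_j max(O(q_j⁻¹ ρ⁻¹ (n')^{-1/2}), 1)`
        (Nat.card {x : EuclideanSpace ℝ (Fin d) | ∀ j, x j ∈ Kj j} : ℝ) ≤
          ∏ j, max (C * (concFn (FaCoord n μ a j) τ)⁻¹ * ρ⁻¹ * n' ^ (-(1 : ℝ) / 2)) 1 := by

  obtain ⟨R, C, hC, h⟩ := exists_isCGAP_of_le_concFn ε θ A B p1 hε hθ hp1
  refine ⟨max C (d * R), lt_max_of_lt_left hC, fun n μ _ hμ a τ hτ hq ρ hρB hρ1 n' hn' hn'n => ?_⟩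
  choose r m K I hK hr hI hclose hcard using fun j => h n μ hμ (fun k => a k j) τ hτ
    (concFn (FaCoord n μ a j) τ) (by rw [FaCoord_eq]) (hq j) ρ hρB hρ1 n' hn' hn'n
  refine ⟨r, m, K, hK, le_max_of_le_right ?_, ?_, ?_⟩
  · have h1 : ∑ j, r j ≤ d * R := by
      simpa using Finset.sum_le_card_nsmul Finset.univ r R fun j _ => hr j
    exact_mod_cast h1
  · have h1 := card_sub_le_card_filter_forall_mem I (s := n') (by simpa using hI)
    rw [Fintype.card_fin, Fintype.card_fin] at h1
    refine h1.trans ?_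
    rw [← Set.ncard_coe_finset, Nat.card_coe_set_eq]
    refine Nat.cast_le.2 (Set.ncard_le_ncard (fun k hk => ?_) (Set.toFinite _))
    simp only [Finset.coe_filter, Finset.mem_univ, true_and, Set.mem_ofPred_eq] at hk
    choose y hyK hy using fun j => hclose j k (hk j)
    exact ⟨WithLp.toLp 2 y, hyK, hy⟩
  · rw [natCard_euclidean_pi]
    push_cast
    refine Finset.prod_le_prod (fun _ _ => Nat.cast_nonneg _) fun j _ => (hcard j).trans ?_
    have hq0 : 0 ≤ concFn (FaCoord n μ a j) τ := le_trans (by positivity) (hq j)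
    have hρ0 : 0 ≤ ρ := le_trans (by positivity) hρB
    have hn0 : 0 ≤ n' := le_trans (by positivity) hn'
    gcongr
    exact le_max_left _ _
end

section
/- Every one-dimensional CGAP of rank r and volume m is contained in a symmetric generalized arithmetic progression of rank at most r and volume at most c(r)·m, where c(r) depends only on r. -/
/-- The symmetric GAP with generators `g` and dimensions `L`:
`{m₁ g₁ + ⋯ + m_s g_s : |m_j| ≤ L j, m_j ∈ ℤ}`. -/
def symmGAP {s : ℕ} (g L : Fin s → ℝ) : Set ℝ :=
  {x : ℝ | ∃ m : Fin s → ℤ, (∀ j, |(m j : ℝ)| ≤ L j) ∧ x = ∑ j, (m j : ℝ) * g j}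

/-- The volume of a (symmetric) GAP: the cardinality of the corresponding integer box. -/
noncomputable def symmGAPvol {s : ℕ} (L : Fin s → ℝ) : ℕ :=
  Nat.card {m : Fin s → ℤ | ∀ j, |(m j : ℝ)| ≤ L j}

open scoped Pointwise

section DiscreteJohn

variable {E : Type*} [AddCommGroup E] [Module ℝ E]

theorem Convex.smul_set_mono {V : Set E} (hV : Convex ℝ V) (h0 : (0 : E) ∈ V) {a b : ℝ}
    (ha : 0 ≤ a) (hab : a ≤ b) : a • V ⊆ b • V := by
  intro x hx
  have h : (0 : E) ∈ (b - a) • V := ⟨0, h0, smul_zero _⟩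
  have := hV.add_smul ha (sub_nonneg.2 hab)
  rw [add_sub_cancel] at this
  rw [this]
  simpa using Set.add_mem_add hx h

theorem Convex.add_mem_add_smul {V : Set E} (hV : Convex ℝ V) {a b : ℝ} (ha : 0 ≤ a)
    (hb : 0 ≤ b) {x y : E} (hx : x ∈ a • V) (hy : y ∈ b • V) : x + y ∈ (a + b) • V := by
  rw [hV.add_smul ha hb]
  exact Set.add_mem_add hx hy

theorem Convex.sum_mem_sum_smul {V : Set E} (hV : Convex ℝ V) (h0 : (0 : E) ∈ V) {ι : Type*}
    (S : Finset ι) {a : ι → ℝ} {x : ι → E} (ha : ∀ i ∈ S, 0 ≤ a i)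
    (hx : ∀ i ∈ S, x i ∈ a i • V) : ∑ i ∈ S, x i ∈ (∑ i ∈ S, a i) • V := by
  classical
  induction S using Finset.induction_on with
  | empty => exact ⟨0, h0, by simp⟩
  | insert i S hi ih =>
    rw [Finset.sum_insert hi, Finset.sum_insert hi]
    simp only [Finset.mem_insert, forall_eq_or_imp] at ha hx
    exact hV.add_mem_add_smul ha.1 (Finset.sum_nonneg ha.2) hx.1 (ih ha.2 hx.2)

/-- Real multiples of points of a symmetric convex set. -/
theorem Convex.smul_mem_smul_set_of_abs_le {V : Set E} (hV : Convex ℝ V)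
    (hs : ∀ v ∈ V, -v ∈ V) (h0 : (0 : E) ∈ V) {v : E} (hv : v ∈ V) {a b : ℝ} (hab : |a| ≤ b) :
    a • v ∈ b • V := by
  refine hV.smul_set_mono h0 (abs_nonneg a) hab ?_
  rcases abs_cases a with ⟨h, -⟩ | ⟨h, -⟩
  · exact ⟨v, hv, by simp [h]⟩
  · exact ⟨-v, hs v hv, by simp [h]⟩

/-- A set of lattice points of a symmetric convex set is controlled by the lattice points of its
half, when the lattice has finitely many classes modulo `4`. -/
theorem finite_and_ncard_le_of_half {κ : Type*} [Fintype κ] (Λ : AddSubgroup E) (c : E → κ)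
    (hc : ∀ x ∈ Λ, ∀ y ∈ Λ, c x = c y → ∃ z ∈ Λ, x - y = (4 : ℝ) • z)
    {V : Set E} (hV : Convex ℝ V) (hs : ∀ v ∈ V, -v ∈ V)
    (hB : {x | x ∈ Λ ∧ (2 : ℝ) • x ∈ V}.Finite) :
    {x | x ∈ Λ ∧ x ∈ V}.Finite ∧
      {x | x ∈ Λ ∧ x ∈ V}.ncard ≤ Fintype.card κ * {x | x ∈ Λ ∧ (2 : ℝ) • x ∈ V}.ncard := by
  classical
  set A := {x | x ∈ Λ ∧ x ∈ V} with hA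
  set B := {x | x ∈ Λ ∧ (2 : ℝ) • x ∈ V} with hBdef
  have hrep : ∃ rep : κ → E, ∀ x ∈ A, rep (c x) ∈ A ∧ c (rep (c x)) = c x := by
    refine ⟨fun k => if h : ∃ y ∈ A, c y = k then h.choose else 0, fun x hx => ?_⟩
    have h : ∃ y ∈ A, c y = c x := ⟨x, hx, rfl⟩
    simp only [dif_pos h]
    exact h.choose_spec
  obtain ⟨rep, hrep⟩ := hrep
  let f : E → κ × E := fun x => (c x, (1 / 4 : ℝ) • (x - rep (c x)))
  have hmaps : Set.MapsTo f A (Set.univ ×ˢ B) := by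
    intro x hx
    obtain ⟨hr, hcr⟩ := hrep x hx
    obtain ⟨z, hz, hxz⟩ := hc x hx.1 _ hr.1 hcr.symm
    refine ⟨trivial, ?_⟩
    have hfz : (f x).2 = z := by
      simp only [f, hxz, smul_smul]; norm_num
    rw [hfz]
    refine ⟨hz, ?_⟩
    have h2 : (2 : ℝ) • z = (1 / 2 : ℝ) • x + (1 / 2 : ℝ) • (-rep (c x)) := by
      rw [← smul_add, ← sub_eq_add_neg, hxz, smul_smul]; norm_num
    rw [h2]
    exact hV hx.2 (hs _ hr.2) (by norm_num) (by norm_num) (by norm_num)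
  have hinj : Set.InjOn f A := by
    intro x _ y _ hxy
    simp only [f, Prod.mk.injEq] at hxy
    obtain ⟨h1, h2⟩ := hxy
    rw [h1] at h2
    have := smul_right_injective E (by norm_num : (1 / 4 : ℝ) ≠ 0) h2
    simpa using this
  have hfin : ((Set.univ : Set κ) ×ˢ B).Finite := Set.finite_univ.prod hB
  refine ⟨Set.Finite.of_injOn hmaps hinj hfin, ?_⟩
  calc A.ncard ≤ ((Set.univ : Set κ) ×ˢ B).ncard := Set.ncard_le_ncard_of_injOn f hmaps hinj hfin
    _ = Fintype.card κ * B.ncard := by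
      rw [Set.ncard_prod, Set.ncard_univ, Nat.card_eq_fintype_card]

/-- An additive subgroup meeting a convex set in a finite set has a nonzero vector whose
multiples stay nearly as long as possible inside the set. -/
theorem exists_near_maximal_multiple (Λ : AddSubgroup E) {V : Set E} (hV : Convex ℝ V)
    (h0 : (0 : E) ∈ V) (hfin : {x | x ∈ Λ ∧ x ∈ V}.Finite)
    (hne : ∃ x ∈ Λ, x ∈ V ∧ x ≠ 0) :
    ∃ e ∈ Λ, e ≠ 0 ∧ ∃ t : ℝ, 1 ≤ t ∧ t • e ∈ V ∧
      ∀ u ∈ Λ, u ≠ 0 → ∀ y a : ℝ, 0 < a → y • u ∈ a • V → y ≤ 3 / 2 * t * a := by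
  set T : Set ℝ := {t | ∃ e ∈ Λ, e ≠ 0 ∧ t • e ∈ V} with hT
  have h1 : (1 : ℝ) ∈ T := by
    obtain ⟨x, hx, hxV, hx0⟩ := hne
    exact ⟨x, hx, hx0, by simpa using hxV⟩
  have hbdd : BddAbove T := by
    refine ⟨{x | x ∈ Λ ∧ x ∈ V}.ncard, ?_⟩
    rintro t ⟨e, he, he0, hte⟩
    rcases le_or_gt t 0 with ht | ht
    · exact ht.trans (Nat.cast_nonneg _)
    have hle : (Set.Iic ⌊t⌋₊).ncard ≤ {x | x ∈ Λ ∧ x ∈ V}.ncard := by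
      refine Set.ncard_le_ncard_of_injOn (fun k : ℕ => (k : ℝ) • e) ?_ ?_ hfin
      · intro k hk
        have hkt : (k : ℝ) ≤ t := (Nat.le_floor_iff ht.le).1 hk
        refine ⟨?_, ?_⟩
        · simpa only [Nat.cast_smul_eq_nsmul] using Λ.nsmul_mem he k
        · have : (k : ℝ) • e = ((k : ℝ) / t) • (t • e) := by
            rw [smul_smul, div_mul_cancel₀ _ ht.ne']
          rw [this]
          exact hV.smul_mem_of_zero_mem h0 hte ⟨by positivity, (div_le_one ht).2 hkt⟩
      · intro k _ l _ hkl
        exact Nat.cast_injective (smul_left_injective ℝ he0 hkl)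
    have hcard : (Set.Iic ⌊t⌋₊).ncard = ⌊t⌋₊ + 1 := by
      rw [← Finset.coe_Iic, Set.ncard_coe_finset, Nat.card_Iic]
    rw [hcard] at hle
    have := Nat.lt_floor_add_one t
    have h2 : ((⌊t⌋₊ : ℝ) + 1) ≤ ({x | x ∈ Λ ∧ x ∈ V}.ncard : ℝ) := by exact_mod_cast hle
    linarith
  have hS1 : 1 ≤ sSup T := le_csSup hbdd h1
  obtain ⟨t₁, ht₁, hlt⟩ := exists_lt_of_lt_csSup ⟨1, h1⟩
    (show 2 / 3 * sSup T < sSup T by linarith)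
  have hmem : max t₁ 1 ∈ T := by
    rcases max_choice t₁ 1 with h | h <;> rw [h] <;> assumption
  obtain ⟨e, he, he0, hte⟩ := hmem
  refine ⟨e, he, he0, max t₁ 1, le_max_right _ _, hte, ?_⟩
  rintro u hu hu0 y a ha ⟨v, hv, hvy⟩
  have hyT : y / a ∈ T := by
    refine ⟨u, hu, hu0, ?_⟩
    have : (y / a) • u = v := by
      have hvy' : a • v = y • u := hvy
      rw [div_eq_inv_mul, ← smul_smul, ← hvy', smul_smul, inv_mul_cancel₀ ha.ne', one_smul]
    rwa [this]
  have h3 := le_csSup hbdd hyT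
  have h4 : y / a ≤ 3 / 2 * max t₁ 1 := by
    have := le_max_left t₁ 1
    linarith
  rwa [div_le_iff₀ ha] at h4

/-- If all multiples of lattice vectors inside `V` are at most `3 / 2` times as long as those of
`e`, then the lattice meets the line through `e` only in integer multiples of `e`. -/
theorem exists_int_of_smul_mem (Λ : AddSubgroup E) {V : Set E} (hV : Convex ℝ V)
    (hs : ∀ v ∈ V, -v ∈ V) (h0 : (0 : E) ∈ V) {e : E} (he : e ∈ Λ) (he0 : e ≠ 0) {t : ℝ}
    (ht : 1 ≤ t) (hte : t • e ∈ V)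
    (hmax : ∀ u ∈ Λ, u ≠ 0 → ∀ y a : ℝ, 0 < a → y • u ∈ a • V → y ≤ 3 / 2 * t * a)
    {p : ℝ} (hp : p • e ∈ Λ) : ∃ n : ℤ, p = n := by
  refine ⟨round p, ?_⟩
  by_contra hne
  have hq0 : p - round p ≠ 0 := sub_ne_zero.2 hne
  have hq : |p - round p| ≤ 1 / 2 := abs_sub_round p
  set q := p - round p with hqdef
  have hqΛ : q • e ∈ Λ := by
    rw [hqdef, sub_smul, Int.cast_smul_eq_zsmul]
    exact Λ.sub_mem hp (Λ.zsmul_mem he _)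
  have hmem : t • (q • e) ∈ |q| • V := by
    rw [smul_comm]
    exact hV.smul_mem_smul_set_of_abs_le hs h0 hte le_rfl
  have := hmax _ hqΛ (smul_ne_zero hq0 he0) t |q| (abs_pos.2 hq0) hmem
  nlinarith

/-- Fibre counting for the projection along `e`. -/
theorem finite_and_floor_mul_ncard_le (Λ : AddSubgroup E) {V : Set E} (hV : Convex ℝ V)
    (hs : ∀ v ∈ V, -v ∈ V) (h0 : (0 : E) ∈ V) (hfin : {x | x ∈ Λ ∧ x ∈ V}.Finite)
    {e : E} (he : e ∈ Λ) (he0 : e ≠ 0) {t : ℝ} (ht : 1 ≤ t) (hte : t • e ∈ V)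
    {E' : Type*} [AddCommGroup E'] [Module ℝ E'] (π : E →ₗ[ℝ] E')
    (hker : ∀ x, π x = 0 ↔ ∃ a : ℝ, x = a • e) :
    {x | x ∈ Λ.map π.toAddMonoidHom ∧ (2 : ℝ) • x ∈ π '' V}.Finite ∧
      ⌊t⌋₊ * {x | x ∈ Λ.map π.toAddMonoidHom ∧ (2 : ℝ) • x ∈ π '' V}.ncard ≤
        {x | x ∈ Λ ∧ x ∈ V}.ncard := by
  set B := {x | x ∈ Λ.map π.toAddMonoidHom ∧ (2 : ℝ) • x ∈ π '' V} with hB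
  set A := {x | x ∈ Λ ∧ x ∈ V} with hA
  have hπe : π e = 0 := (hker e).2 ⟨1, (one_smul _ _).symm⟩
  have hlift : ∀ x : E', ∃ y : E, x ∈ B →
      y ∈ Λ ∧ π y = x ∧ ∀ k : ℕ, k < ⌊t⌋₊ → y + (k : ℝ) • e ∈ V := by
    intro x
    by_cases hx : x ∈ B
    swap
    · exact ⟨0, fun h => absurd h hx⟩
    obtain ⟨⟨l, hl, hlx⟩, v, hv, hvx⟩ := hx
    have hlx' : π l = x := hlx
    obtain ⟨a, ha⟩ := (hker (l - (1 / 2 : ℝ) • v)).1 (by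
      rw [map_sub, map_smul, hvx, hlx', smul_smul]; norm_num)
    have hl_eq : l = (1 / 2 : ℝ) • v + a • e := by rw [← ha]; abel
    refine ⟨l + (⌈-a - t / 2⌉ : ℝ) • e, fun _ => ⟨?_, ?_, ?_⟩⟩
    · rw [Int.cast_smul_eq_zsmul]
      exact Λ.add_mem hl (Λ.zsmul_mem he _)
    · rw [map_add, map_smul, hπe, smul_zero, add_zero, hlx']
    · intro k hk
      have hc1 := Int.le_ceil (-a - t / 2)
      have hc2 := Int.ceil_lt_add_one (-a - t / 2)
      have hkt : (k : ℝ) + 1 ≤ t := by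
        have h1 : ((k + 1 : ℕ) : ℝ) ≤ ⌊t⌋₊ := by exact_mod_cast hk
        have h2 := Nat.floor_le (by linarith : 0 ≤ t)
        push_cast at h1
        linarith
      have hk0 : (0 : ℝ) ≤ k := Nat.cast_nonneg k
      set b : ℝ := a + ⌈-a - t / 2⌉ + k with hb
      have hbt : |b| ≤ t / 2 := abs_le.2 ⟨by linarith, by linarith⟩
      have htpos : 0 < t := by linarith
      have hbe : b • e ∈ (1 / 2 : ℝ) • V := by
        have : b • e = (b / t) • (t • e) := by
          rw [smul_smul, div_mul_cancel₀ _ htpos.ne']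
        rw [this]
        refine hV.smul_mem_smul_set_of_abs_le hs h0 hte ?_
        rw [abs_div, abs_of_pos htpos, div_le_iff₀ htpos]
        linarith
      have := hV.add_mem_add_smul (a := 1 / 2) (by norm_num) (by norm_num)
        (Set.smul_mem_smul_set hv) hbe
      have h1 : ((1 / 2 : ℝ) + 1 / 2) • V = V := by norm_num
      rw [h1] at this
      convert this using 1
      rw [hl_eq, hb, add_smul, add_smul]
      abel
  choose f hf using hlift
  have hN : 0 < ⌊t⌋₊ := Nat.floor_pos.2 ht
  refine ⟨?_, ?_⟩
  · refine Set.Finite.of_injOn (f := f) (t := A) ?_ ?_ hfin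
    · intro x hx
      obtain ⟨h1, -, h3⟩ := hf x hx
      exact ⟨h1, by simpa using h3 0 hN⟩
    · intro x hx y hy hxy
      rw [← (hf x hx).2.1, ← (hf y hy).2.1, hxy]
  · have hcard : ((Set.Iio ⌊t⌋₊) ×ˢ B).ncard = ⌊t⌋₊ * B.ncard := by
      rw [Set.ncard_prod, ← Finset.coe_Iio, Set.ncard_coe_finset, Nat.card_Iio]
    rw [← hcard]
    refine Set.ncard_le_ncard_of_injOn (fun p => f p.2 + (p.1 : ℝ) • e) ?_ ?_ hfin
    · rintro ⟨k, x⟩ ⟨hk, hx⟩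
      obtain ⟨h1, -, h3⟩ := hf x hx
      refine ⟨?_, h3 k hk⟩
      simp only [Nat.cast_smul_eq_nsmul]
      exact Λ.add_mem h1 (Λ.nsmul_mem he k)
    · rintro ⟨k, x⟩ ⟨hk, hx⟩ ⟨l, y⟩ ⟨hl, hy⟩ hxy
      have hxy' : f x + (k : ℝ) • e = f y + (l : ℝ) • e := hxy
      have h := congrArg π hxy'
      rw [map_add, map_add, map_smul, map_smul, hπe, smul_zero, smul_zero, add_zero, add_zero,
        (hf x hx).2.1, (hf y hy).2.1] at h
      subst h
      have hkl := smul_left_injective ℝ he0 (add_left_cancel hxy')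
      rw [Nat.cast_injective hkl]

end DiscreteJohn

/-- A system of steps `w` and lengths `L` describing the points of `Λ` in `V` up to a factor `C`. -/
structure IsProperCover {E : Type*} [AddCommGroup E] [Module ℝ E] (Λ : AddSubgroup E) (V : Set E)
    (C : ℝ) {s : ℕ} (w : Fin s → E) (L : Fin s → ℝ) : Prop where
  mem : ∀ j, w j ∈ Λ
  ne_zero : ∀ j, w j ≠ 0
  one_le : ∀ j, 1 ≤ L j
  smul_mem : ∀ j, L j • w j ∈ C • V
  cover : ∀ x ∈ Λ, x ∈ V →
    ∃ m : Fin s → ℤ, (∀ j, |(m j : ℝ)| ≤ L j) ∧ x = ∑ j, (m j : ℝ) • w j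
  prod_le : ∏ j, (2 * L j + 1) ≤ C * {x | x ∈ Λ ∧ x ∈ V}.ncard

theorem isProperCover_of_forall_eq_zero {E : Type*} [AddCommGroup E] [Module ℝ E]
    {Λ : AddSubgroup E} {V : Set E} (h0 : (0 : E) ∈ V) (h : ∀ x ∈ Λ, x ∈ V → x = 0) {C : ℝ}
    (hC : 1 ≤ C) : IsProperCover Λ V C (Fin.elim0 : Fin 0 → E) Fin.elim0 where
  mem j := j.elim0
  ne_zero j := j.elim0
  one_le j := j.elim0
  smul_mem j := j.elim0
  cover x hx hxV := ⟨Fin.elim0, fun j => j.elim0, by simp [h x hx hxV]⟩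
  prod_le := by
    have : {x | x ∈ Λ ∧ x ∈ V} = {0} := by
      ext x
      refine ⟨fun hx => h x hx.1 hx.2, ?_⟩
      rintro rfl
      exact ⟨Λ.zero_mem, h0⟩
    simp [this, hC]

/-- Lifting a cover along the projection that kills a near-maximal vector `e`. -/
theorem IsProperCover.lift {E E' : Type*} [AddCommGroup E] [Module ℝ E] [AddCommGroup E']
    [Module ℝ E'] {Λ : AddSubgroup E} {V : Set E} (hV : Convex ℝ V)
    (hs : ∀ v ∈ V, -v ∈ V) (h0 : (0 : E) ∈ V)
    {e : E} (he : e ∈ Λ) (he0 : e ≠ 0) {t : ℝ} (ht : 1 ≤ t) (hte : t • e ∈ V)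
    (hmax : ∀ u ∈ Λ, u ≠ 0 → ∀ y a : ℝ, 0 < a → y • u ∈ a • V → y ≤ 3 / 2 * t * a)
    (π : E →ₗ[ℝ] E') (hker : ∀ x, π x = 0 ↔ ∃ a : ℝ, x = a • e)
    {C M : ℝ} (hC : 1 ≤ C) (hM : 1 ≤ M) {s d : ℕ} (hsd : s ≤ d) {w : Fin s → E'} {L : Fin s → ℝ}
    (hw : IsProperCover (Λ.map π.toAddMonoidHom) (π '' V) C w L)
    (hcard : t * ({x | x ∈ Λ.map π.toAddMonoidHom ∧ x ∈ π '' V}.ncard : ℝ) ≤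
      2 * M * {x | x ∈ Λ ∧ x ∈ V}.ncard) :
    ∃ (w' : Fin (s + 1) → E) (L' : Fin (s + 1) → ℝ),
      IsProperCover Λ V (6 * (2 + 5 * C * d) * C * M) w' L' := by
  have htpos : 0 < t := by linarith
  have hCpos : 0 < C := by linarith
  have hπe : π e = 0 := (hker e).2 ⟨1, (one_smul _ _).symm⟩
  have hlift : ∀ j, ∃ u ∈ Λ, π u = w j ∧ ∃ v ∈ V, ∃ b : ℝ, |b| ≤ 1 / 2 ∧
      u = (C / L j) • v + b • e := by
    intro j
    obtain ⟨l, hl, hlw⟩ := hw.mem j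
    have hlw' : π l = w j := hlw
    obtain ⟨_, ⟨v, hv, rfl⟩, hvw⟩ := hw.smul_mem j
    have hvw' : C • π v = L j • w j := hvw
    have hL : L j ≠ 0 := by have := hw.one_le j; positivity
    obtain ⟨a, ha⟩ := (hker (l - (C / L j) • v)).1 (by
      rw [map_sub, map_smul, hlw', div_eq_inv_mul, ← smul_smul, hvw', smul_smul,
        inv_mul_cancel₀ hL, one_smul, sub_self])
    refine ⟨l - (round a : ℝ) • e, ?_, ?_, v, hv, a - round a, abs_sub_round a, ?_⟩
    · rw [Int.cast_smul_eq_zsmul]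
      exact Λ.sub_mem hl (Λ.zsmul_mem he _)
    · rw [map_sub, map_smul, hπe, smul_zero, sub_zero, hlw']
    · rw [sub_smul, ← ha]; abel
  choose u huΛ huw v hv b hb hu using hlift
  have hu0 : ∀ j, u j ≠ 0 := fun j h => hw.ne_zero j (by rw [← huw j, h, map_zero])
  have hLpos : ∀ j, 0 < L j := fun j => by have := hw.one_le j; linarith
  have hbe : ∀ y : ℝ, y • e ∈ (|y| / t) • V := by
    intro y
    have : y • e = (y / t) • (t • e) := by rw [smul_smul, div_mul_cancel₀ _ htpos.ne']
    rw [this]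
    refine hV.smul_mem_smul_set_of_abs_le hs h0 hte ?_
    rw [abs_div, abs_of_pos htpos]
  have hLt : ∀ j, L j ≤ 6 * C * t := by
    intro j
    have hCL : 0 < C / L j := div_pos hCpos (hLpos j)
    have h1 : u j ∈ (C / L j + |b j| / t) • V := by
      rw [hu j]
      exact hV.add_mem_add_smul hCL.le (by positivity) (Set.smul_mem_smul_set (hv j)) (hbe _)
    have h2 := hmax (u j) (huΛ j) (hu0 j) 1 (C / L j + |b j| / t) (by positivity)
      (by simpa using h1)
    have h3 : 3 / 2 * t * (C / L j + |b j| / t) = 3 / 2 * t * C / L j + 3 / 2 * |b j| := by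
      field_simp
    rw [h3] at h2
    have h4 : 1 / 4 ≤ 3 / 2 * t * C / L j := by linarith [hb j]
    rw [le_div_iff₀ (hLpos j)] at h4
    linarith
  have hD1 : (0 : ℝ) ≤ C * d := by positivity
  set D : ℝ := 2 + 5 * C * d with hD
  have hD2 : 2 ≤ D := by rw [hD]; nlinarith
  have hCM : 1 ≤ C * M := by nlinarith
  have hDle : D ≤ 6 * D * C * M := by nlinarith
  have h4C : 4 * C ≤ 6 * D * C * M := by
    have : C ≤ C * M := by nlinarith
    nlinarith
  refine ⟨Fin.cons e u, Fin.cons (D * t) L, ?_, ?_, ?_, ?_, ?_, ?_⟩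
  · exact Fin.cases he huΛ
  · exact Fin.cases he0 hu0
  · refine Fin.cases ?_ hw.one_le
    simp only [Fin.cons_zero]; nlinarith
  · refine Fin.cases ?_ fun j => ?_
    · simp only [Fin.cons_zero]
      rw [mul_smul D t e]
      exact hV.smul_set_mono h0 (by linarith) hDle (Set.smul_mem_smul_set hte)
    · simp only [Fin.cons_succ]
      have hb0 : 0 ≤ |L j * b j| / t := by positivity
      refine hV.smul_set_mono h0 (a := C + |L j * b j| / t) (by linarith) ?_ ?_
      · refine le_trans ?_ h4C
        have : |L j * b j| / t ≤ 3 * C := by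
          rw [div_le_iff₀ htpos, abs_mul, abs_of_pos (hLpos j)]
          nlinarith [hLt j, hb j, abs_nonneg (b j), hLpos j]
        linarith
      · have : L j • u j = C • v j + (L j * b j) • e := by
          rw [hu j, smul_add, smul_smul, smul_smul, mul_div_cancel₀ _ (hLpos j).ne']
        rw [this]
        exact hV.add_mem_add_smul hCpos.le hb0 (Set.smul_mem_smul_set (hv j)) (hbe _)
  · intro x hx hxV
    obtain ⟨m, hm, hxm⟩ := hw.cover (π x) ⟨x, hx, rfl⟩ ⟨x, hxV, rfl⟩
    obtain ⟨p, hp⟩ := (hker (x - ∑ j, (m j : ℝ) • u j)).1 (by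
      rw [map_sub, map_sum, hxm, sub_eq_zero]
      exact Finset.sum_congr rfl fun j _ => by rw [map_smul, huw])
    have hpΛ : p • e ∈ Λ := by
      rw [← hp]
      refine Λ.sub_mem hx (Λ.sum_mem fun j _ => ?_)
      rw [Int.cast_smul_eq_zsmul]
      exact Λ.zsmul_mem (huΛ j) _
    obtain ⟨n, rfl⟩ := exists_int_of_smul_mem Λ hV hs h0 he he0 ht hte hmax hpΛ
    refine ⟨Fin.cons n m, ?_, ?_⟩
    · refine Fin.cases ?_ fun j => by simpa using hm j
      simp only [Fin.cons_zero]
      set q : ℝ := ∑ j, (m j : ℝ) * b j with hq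
      have hsd' : (s : ℝ) ≤ d := by exact_mod_cast hsd
      have hqle : |q| ≤ 3 * C * d * t := by
        calc |q| ≤ ∑ j, |(m j : ℝ) * b j| := Finset.abs_sum_le_sum_abs _ _
          _ ≤ ∑ _j : Fin s, 3 * C * t := by
            refine Finset.sum_le_sum fun j _ => ?_
            rw [abs_mul]
            nlinarith [hLt j, hb j, abs_nonneg (b j), hm j, abs_nonneg (m j : ℝ)]
          _ = s * (3 * C * t) := by simp
          _ ≤ d * (3 * C * t) := by gcongr
          _ = 3 * C * d * t := by ring
      have hmem : ((n : ℝ) + q) • e ∈ (1 + C * d) • V := by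
        have hsum : ∑ j, -((m j : ℝ) * (C / L j)) • v j ∈ (∑ _j : Fin s, C) • V := by
          refine hV.sum_mem_sum_smul h0 _ (fun _ _ => hCpos.le) fun j _ => ?_
          refine hV.smul_mem_smul_set_of_abs_le hs h0 (hv j) ?_
          rw [abs_neg, abs_mul, abs_of_pos (div_pos hCpos (hLpos j)), mul_div_assoc',
            div_le_iff₀ (hLpos j)]
          nlinarith [hm j]
        have hCs : (∑ _j : Fin s, C) ≤ C * d := by
          simp only [Finset.sum_const, Finset.card_univ, Fintype.card_fin, nsmul_eq_mul]
          nlinarith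
        have hsum' := hV.smul_set_mono h0 (Finset.sum_nonneg fun _ _ => hCpos.le) hCs hsum
        have hx1 : x ∈ (1 : ℝ) • V := by simpa using hxV
        have := hV.add_mem_add_smul zero_le_one hD1 hx1 hsum'
        convert this using 1
        rw [add_smul, ← hp, hq, Finset.sum_smul, sub_add, sub_eq_add_neg, ← Finset.sum_sub_distrib,
          ← Finset.sum_neg_distrib]
        congr 1
        refine Finset.sum_congr rfl fun j _ => ?_
        rw [hu j]
        module
      have hpos : 0 < 1 + C * d := by linarith
      have hup := hmax e he he0 _ _ hpos hmem
      have hneg : (-((n : ℝ) + q)) • e ∈ (1 + C * d) • V := by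
        obtain ⟨z, hz, hze⟩ := hmem
        refine ⟨-z, hs z hz, ?_⟩
        have hze' : (1 + C * d) • z = ((n : ℝ) + q) • e := hze
        simp only [smul_neg, hze', neg_smul]
      have hlo := hmax e he he0 _ _ hpos hneg
      have hDt : D * t = 2 * t + 5 * (C * d * t) := by rw [hD]; ring
      have h32 : 3 / 2 * t * (1 + C * d) = 3 / 2 * t + 3 / 2 * (C * d * t) := by ring
      have h3 : 3 * C * d * t = 3 * (C * d * t) := by ring
      have hnn : 0 ≤ C * d * t := by positivity
      rw [abs_le] at hqle ⊢
      constructor <;> linarith [hqle.1, hqle.2]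
    · rw [Fin.sum_univ_succ]
      simp only [Fin.cons_zero, Fin.cons_succ]
      rw [← hp]; abel
  · rw [Fin.prod_univ_succ]
    simp only [Fin.cons_zero, Fin.cons_succ]
    have hDt : 1 ≤ D * t := by nlinarith
    have hprod := hw.prod_le
    set A' : ℝ := ({x | x ∈ Λ.map π.toAddMonoidHom ∧ x ∈ π '' V}.ncard : ℝ)
    set A : ℝ := ({x | x ∈ Λ ∧ x ∈ V}.ncard : ℝ)
    calc (2 * (D * t) + 1) * ∏ j, (2 * L j + 1) ≤ (3 * (D * t)) * (C * A') := by
          refine mul_le_mul (by linarith) hprod ?_ (by positivity)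
          exact Finset.prod_nonneg fun j _ => by linarith [hLpos j]
      _ = 3 * D * C * (t * A') := by ring
      _ ≤ 3 * D * C * (2 * M * A) := by gcongr
      _ = 6 * D * C * M * A := by ring

/-- **Discrete John theorem**, in the covering form. -/
theorem exists_isProperCover (κ : Type*) [Fintype κ] (d : ℕ) :
    ∃ C : ℝ, 1 ≤ C ∧ ∀ (E : Type) [AddCommGroup E] [Module ℝ E] [FiniteDimensional ℝ E]
      (Λ : AddSubgroup E) (c : E → κ),
      (∀ x ∈ Λ, ∀ y ∈ Λ, c x = c y → ∃ z ∈ Λ, x - y = (4 : ℝ) • z) →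
      Module.finrank ℝ E = d →
      ∀ V : Set E, Convex ℝ V → (∀ v ∈ V, -v ∈ V) → (0 : E) ∈ V →
      {x | x ∈ Λ ∧ x ∈ V}.Finite →
      ∃ s ≤ d, ∃ (w : Fin s → E) (L : Fin s → ℝ), IsProperCover Λ V C w L := by
  induction d with
  | zero =>
    refine ⟨1, le_rfl, fun E _ _ _ Λ c _ hd V _ _ h0 _ => ⟨0, le_rfl, _, _,
      isProperCover_of_forall_eq_zero h0 (fun x _ _ => ?_) le_rfl⟩⟩
    have := Module.finrank_zero_iff.1 hd
    exact Subsingleton.elim _ _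
  | succ d ih =>
    obtain ⟨C, hC, ih⟩ := ih
    set M : ℝ := Fintype.card κ + 1 with hM
    have hM1 : 1 ≤ M := by rw [hM]; linarith [(Nat.cast_nonneg (Fintype.card κ) : (0 : ℝ) ≤ _)]
    have hCM : 1 ≤ C * M := by nlinarith
    have hD : 0 ≤ C * d := by positivity
    have hnew : 1 ≤ 6 * (2 + 5 * C * d) * C * M := by nlinarith
    refine ⟨6 * (2 + 5 * C * d) * C * M, hnew, fun E _ _ _ Λ c hc hd V hV hs h0 hfin => ?_⟩
    by_cases hne : ∃ x ∈ Λ, x ∈ V ∧ x ≠ 0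
    swap
    · push Not at hne
      exact ⟨0, Nat.zero_le _, _, _, isProperCover_of_forall_eq_zero h0 hne hnew⟩
    obtain ⟨e, he, he0, t, ht, hte, hmax⟩ := exists_near_maximal_multiple Λ hV h0 hfin hne
    let π := (Submodule.span ℝ {e}).mkQ
    have hker : ∀ x, π x = 0 ↔ ∃ a : ℝ, x = a • e := by
      intro x
      rw [Submodule.mkQ_apply, Submodule.Quotient.mk_eq_zero, Submodule.mem_span_singleton]
      exact exists_congr fun a => eq_comm
    have hd' : Module.finrank ℝ (E ⧸ Submodule.span ℝ {e}) = d := by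
      have := Submodule.finrank_quotient_add_finrank (Submodule.span ℝ {e})
      rw [finrank_span_singleton he0, hd] at this
      omega
    have hV' : Convex ℝ (π '' V) := hV.linear_image π
    have hs' : ∀ v ∈ π '' V, -v ∈ π '' V := by
      rintro _ ⟨v, hv, rfl⟩
      exact ⟨-v, hs v hv, map_neg _ _⟩
    obtain ⟨sec, hsec⟩ : ∃ sec : E ⧸ Submodule.span ℝ {e} → E,
        ∀ x ∈ Λ.map π.toAddMonoidHom, sec x ∈ Λ ∧ π (sec x) = x := by
      have : ∀ x, ∃ y, x ∈ Λ.map π.toAddMonoidHom → y ∈ Λ ∧ π y = x := by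
        intro x
        by_cases hx : x ∈ Λ.map π.toAddMonoidHom
        · obtain ⟨y, hy, hyx⟩ := hx
          exact ⟨y, fun _ => ⟨hy, hyx⟩⟩
        · exact ⟨0, fun h => absurd h hx⟩
      choose f hf using this
      exact ⟨f, hf⟩
    have hc' : ∀ x ∈ Λ.map π.toAddMonoidHom, ∀ y ∈ Λ.map π.toAddMonoidHom,
        c (sec x) = c (sec y) → ∃ z ∈ Λ.map π.toAddMonoidHom, x - y = (4 : ℝ) • z := by
      intro x hx y hy hxy
      obtain ⟨z, hz, hxyz⟩ := hc _ (hsec x hx).1 _ (hsec y hy).1 hxy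
      refine ⟨π z, ⟨z, hz, rfl⟩, ?_⟩
      rw [← (hsec x hx).2, ← (hsec y hy).2, ← map_sub, hxyz, map_smul]
    obtain ⟨hB, hBcard⟩ := finite_and_floor_mul_ncard_le Λ hV hs h0 hfin he he0 ht hte π hker
    obtain ⟨hA', hAcard⟩ := finite_and_ncard_le_of_half _ (fun x => c (sec x)) hc' hV' hs' hB
    obtain ⟨s, hsd, w, L, hw⟩ := ih _ (Λ.map π.toAddMonoidHom) (fun x => c (sec x)) hc' hd'
      (π '' V) hV' hs' ⟨0, h0, map_zero _⟩ hA'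
    have hcard : t * ({x | x ∈ Λ.map π.toAddMonoidHom ∧ x ∈ π '' V}.ncard : ℝ) ≤
        2 * M * {x | x ∈ Λ ∧ x ∈ V}.ncard := by
      set A' := {x | x ∈ Λ.map π.toAddMonoidHom ∧ x ∈ π '' V}.ncard
      set B := {x | x ∈ Λ.map π.toAddMonoidHom ∧ (2 : ℝ) • x ∈ π '' V}.ncard
      set A := {x | x ∈ Λ ∧ x ∈ V}.ncard
      have h1 : (A' : ℝ) ≤ M * B := by
        have : (A' : ℝ) ≤ Fintype.card κ * B := by exact_mod_cast hAcard
        have hB0 : (0 : ℝ) ≤ B := Nat.cast_nonneg _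
        rw [hM]; linarith
      have h2 : (⌊t⌋₊ : ℝ) * B ≤ A := by exact_mod_cast hBcard
      have h3 : t ≤ 2 * ⌊t⌋₊ := by
        have h4 := Nat.lt_floor_add_one t
        have h5 : (1 : ℝ) ≤ ⌊t⌋₊ := by exact_mod_cast Nat.floor_pos.2 ht
        linarith
      calc t * (A' : ℝ) ≤ (2 * ⌊t⌋₊) * (M * B) := by gcongr
        _ = 2 * M * (⌊t⌋₊ * B) := by ring
        _ ≤ 2 * M * A := by gcongr
    obtain ⟨w', L', h⟩ := hw.lift hV hs h0 he he0 ht hte hmax π hker hC hM1 hsd hcard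
    exact ⟨s + 1, by omega, w', L', h⟩

theorem symmGAPvol_le_prod {s : ℕ} {L : Fin s → ℝ} (hL : ∀ j, 0 ≤ L j) :
    (symmGAPvol L : ℝ) ≤ ∏ j, (2 * L j + 1) := by
  have hset : {m : Fin s → ℤ | ∀ j, |(m j : ℝ)| ≤ L j} =
      ↑(Fintype.piFinset fun j => Finset.Icc (-⌊L j⌋) ⌊L j⌋) := by
    ext m
    simp only [Set.mem_ofPred_eq, Finset.mem_coe, Fintype.mem_piFinset, Finset.mem_Icc]
    refine forall_congr' fun j => ?_
    rw [← abs_le, Int.le_floor, Int.cast_abs]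
  rw [symmGAPvol, Nat.card_coe_set_eq, hset, Set.ncard_coe_finset, Fintype.card_piFinset]
  push_cast
  refine Finset.prod_le_prod (fun _ _ => Nat.cast_nonneg _) fun j _ => ?_
  have h0 : 0 ≤ ⌊L j⌋ := Int.floor_nonneg.2 (hL j)
  have h1 : ((⌊L j⌋ + 1 - -⌊L j⌋).toNat : ℤ) = 2 * ⌊L j⌋ + 1 := by omega
  have h2 : ((⌊L j⌋ + 1 - -⌊L j⌋).toNat : ℝ) = 2 * ⌊L j⌋ + 1 := by exact_mod_cast h1
  rw [Int.card_Icc, h2]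
  linarith [Int.floor_le (L j)]

/-- The additive map `ℤ ^ r → ℝ ^ r`. -/
def intVecCast (r : ℕ) : (Fin r → ℤ) →+ (Fin r → ℝ) where
  toFun ν j := ν j
  map_zero' := by ext; simp
  map_add' _ _ := by ext; simp

theorem intVecCast_injective (r : ℕ) : Function.Injective (intVecCast r) := by
  intro a b hab
  ext j
  have h : (a j : ℝ) = b j := congrFun hab j
  exact_mod_cast h

theorem exists_sub_eq_four_smul_of_floor_eq {r : ℕ} :
    ∀ x ∈ (intVecCast r).range, ∀ y ∈ (intVecCast r).range,
      (fun j => ((⌊x j⌋ : ℤ) : ZMod 4)) = (fun j => ((⌊y j⌋ : ℤ) : ZMod 4)) →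
      ∃ z ∈ (intVecCast r).range, x - y = (4 : ℝ) • z := by
  rintro _ ⟨a, rfl⟩ _ ⟨b, rfl⟩ hab
  have hdvd : ∀ j, ∃ k, a j - b j = 4 * k := by
    intro j
    have h : ((⌊(a j : ℝ)⌋ : ℤ) : ZMod 4) = ((⌊(b j : ℝ)⌋ : ℤ) : ZMod 4) := congrFun hab j
    rw [Int.floor_intCast, Int.floor_intCast, ZMod.intCast_eq_intCast_iff_dvd_sub] at h
    obtain ⟨k, hk⟩ := h
    exact ⟨-k, by push_cast at hk; linarith⟩
  choose k hk using hdvd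
  refine ⟨_, ⟨k, rfl⟩, ?_⟩
  ext j
  have : ((a j - b j : ℤ) : ℝ) = ((4 * k j : ℤ) : ℝ) := by rw [hk j]
  push_cast at this
  simpa [intVecCast] using this

theorem stmt13 (r : ℕ) (hr : 0 < r) :
    ∃ C : ℝ, 0 < C ∧
      ∀ (m : ℕ), 0 < m → ∀ K : Set ℝ, IsCGAP r m K →
      ∃ (s : ℕ) (g L : Fin s → ℝ), s ≤ r ∧
        K ⊆ symmGAP g L ∧
        (symmGAPvol L : ℝ) ≤ C * m := by
  obtain ⟨C, hC, H⟩ := exists_isProperCover (Fin r → ZMod 4) r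
  refine ⟨C, by linarith, fun m hm K hK => ?_⟩
  obtain ⟨h, V, hs, hV, hfin, hcard, rfl⟩ := hK
  have hm1 : (1 : ℝ) ≤ m := by exact_mod_cast hm
  rcases V.eq_empty_or_nonempty with rfl | ⟨v, hv⟩
  · refine ⟨0, Fin.elim0, Fin.elim0, Nat.zero_le _, ?_, ?_⟩
    · rintro x ⟨ν, hν, -⟩
      exact hν.elim
    · refine (symmGAPvol_le_prod fun j => j.elim0).trans ?_
      simp only [Finset.univ_eq_empty, Finset.prod_empty]
      nlinarith
  have h0 : (0 : Fin r → ℝ) ∈ V := by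
    have := hV hv (hs v hv) (by norm_num : (0 : ℝ) ≤ 1 / 2) (by norm_num : (0 : ℝ) ≤ 1 / 2)
      (by norm_num)
    simpa using this
  have himage : {x | x ∈ (intVecCast r).range ∧ x ∈ V} =
      intVecCast r '' {ν | (fun j => (ν j : ℝ)) ∈ V} := by
    ext x
    constructor
    · rintro ⟨⟨ν, rfl⟩, hν⟩
      exact ⟨ν, hν, rfl⟩
    · rintro ⟨ν, hν, rfl⟩
      exact ⟨⟨ν, rfl⟩, hν⟩
  obtain ⟨s, hsr, w, L, hw⟩ := H (Fin r → ℝ) (intVecCast r).range _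
    exists_sub_eq_four_smul_of_floor_eq (by simp) V hV hs h0 (by rw [himage]; exact hfin.image _)
  refine ⟨s, fun j => ∑ i, w j i * h i, L, hsr, ?_, ?_⟩
  · rintro x ⟨ν, hν, rfl⟩
    obtain ⟨n, hn, hνn⟩ := hw.cover (intVecCast r ν) ⟨ν, rfl⟩ hν
    refine ⟨n, hn, ?_⟩
    have hcoord : ∀ i, (ν i : ℝ) = ∑ j, (n j : ℝ) * w j i := by
      intro i
      have : (ν i : ℝ) = _ := congrFun hνn i
      simpa using this
    simp only [hcoord, Finset.sum_mul, Finset.mul_sum]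
    rw [Finset.sum_comm]
    simp only [mul_assoc]
  · refine (symmGAPvol_le_prod fun j => by linarith [hw.one_le j]).trans (hw.prod_le.trans ?_)
    rw [himage, Set.ncard_image_of_injective _ (intVecCast_injective r), ← Nat.card_coe_set_eq]
    gcongr
end
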